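/- Linnik's Theorem (qualitative form): There exists a constant L > 0 such that for every natural number q ≥ 2 and every integer a with gcd(a,q) = 1, there exists a prime p with p ≡ a (mod q) and p ≤ q^L. -/

import Mathlib

namespace Linnik

open Finset ArithmeticFunction

section Mertens

theorem sum_log_eq (N : ℕ) :
    ∑ n ∈ Ioc 0 N, Real.log n = ∑ n ∈ Ioc 0 N, Λ n * ((N / n : ℕ) : ℝ) := by
  have h := sum_Ioc_mul_zeta_eq_sum Λ N
  rw [vonMangoldt_mul_zeta] at h
  simpa [log_apply] using h

theorem sum_log_eq_log_factorial (N : ℕ) :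
    ∑ n ∈ Ioc 0 N, Real.log n = Real.log (N.factorial) := by
  induction N with
  | zero => simp
  | succ n ih =>
    rw [← Finset.insert_Ioc_right_eq_Ioc_add_one (by omega), sum_insert (by simp), ih,
      Nat.factorial_succ, Nat.cast_mul, Real.log_mul (by positivity) (by positivity)]

theorem mertens_vonMangoldt (N : ℕ) (hN : 1 ≤ N) :
    |∑ n ∈ Ioc 0 N, Λ n / n - Real.log N| ≤ 6 := by
  have hN0 : (0 : ℝ) < N := by exact_mod_cast hN
  have h1 : Real.log (N.factorial) ≤ N * Real.log N := by
    rw [← sum_log_eq_log_factorial]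
    calc ∑ n ∈ Ioc 0 N, Real.log n ≤ ∑ n ∈ Ioc 0 N, Real.log N := by
          apply sum_le_sum
          intro n hn
          simp only [mem_Ioc] at hn
          apply Real.log_le_log (by exact_mod_cast hn.1)
          exact_mod_cast hn.2
      _ = _ := by simp
  have h2 : N * Real.log N - N ≤ Real.log (N.factorial) := by
    have := Stirling.le_log_factorial_stirling (n := N) (by omega)
    have h3 : 0 ≤ Real.log N := Real.log_nonneg (by exact_mod_cast hN)
    have h4 : 0 ≤ Real.log (2 * Real.pi) := Real.log_nonneg (by linarith [Real.pi_gt_three])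
    linarith
  have h3 : ∑ n ∈ Ioc 0 N, Λ n ≤ 6 * N := by
    have h := Chebyshev.psi_le_const_mul_self (x := N) hN0.le
    have h4 : Real.log 4 ≤ 2 := by
      rw [show (4 : ℝ) = 2 ^ 2 by norm_num, Real.log_pow]
      have := Real.log_two_lt_d9
      norm_num; linarith
    have h5 : Chebyshev.psi N = ∑ n ∈ Ioc 0 N, Λ n := by
      simp [Chebyshev.psi]
    rw [← h5]
    nlinarith
  rw [← sum_log_eq_log_factorial, sum_log_eq] at h1 h2
  have h4 : ∑ n ∈ Ioc 0 N, Λ n * ((N / n : ℕ) : ℝ) ≤ N * ∑ n ∈ Ioc 0 N, Λ n / n := by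
    rw [mul_sum]
    apply sum_le_sum
    intro n hn
    have := Nat.cast_div_le (α := ℝ) (m := N) (n := n)
    calc _ ≤ Λ n * (N / n) := mul_le_mul_of_nonneg_left this vonMangoldt_nonneg
      _ = _ := by ring
  have h5 : N * ∑ n ∈ Ioc 0 N, Λ n / n ≤
      ∑ n ∈ Ioc 0 N, Λ n * ((N / n : ℕ) : ℝ) + ∑ n ∈ Ioc 0 N, Λ n := by
    rw [mul_sum, ← sum_add_distrib]
    apply sum_le_sum
    intro n hn
    simp only [mem_Ioc] at hn
    have : (N : ℝ) / n ≤ ((N / n : ℕ) : ℝ) + 1 := by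
      rw [← Nat.floor_div_eq_div (K := ℝ)]
      exact (Nat.lt_floor_add_one _).le
    calc _ = Λ n * (N / n) := by ring
      _ ≤ Λ n * (((N / n : ℕ) : ℝ) + 1) := mul_le_mul_of_nonneg_left this vonMangoldt_nonneg
      _ = _ := by ring
  rw [abs_le]
  constructor
  · have : N * (Real.log N - 1) ≤ N * ∑ n ∈ Ioc 0 N, Λ n / n := by linarith
    have := le_of_mul_le_mul_left this hN0
    linarith
  · have : N * ∑ n ∈ Ioc 0 N, Λ n / n ≤ N * (Real.log N + 6) := by linarith
    have := le_of_mul_le_mul_left this hN0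
    linarith

theorem sum_log_div_prime_le (z : ℕ) (hz : 1 ≤ z) :
    ∑ p ∈ z.primesBelow, Real.log p / p ≤ Real.log z + 6 := by
  have h := (abs_le.mp (mertens_vonMangoldt z hz)).2
  have : ∑ p ∈ z.primesBelow, Real.log p / p ≤ ∑ n ∈ Ioc 0 z, Λ n / n := by
    calc _ = ∑ p ∈ z.primesBelow, Λ p / p := by
          apply sum_congr rfl
          intro p hp
          rw [vonMangoldt_apply_prime (Nat.prime_of_mem_primesBelow hp)]
      _ ≤ _ := by
        apply sum_le_sum_of_subset_of_nonneg
        · intro p hp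
          have h1 := Nat.prime_of_mem_primesBelow hp
          have h2 := Nat.lt_of_mem_primesBelow hp
          simp only [mem_Ioc]
          exact ⟨h1.pos, h2.le⟩
        · intro i _ _
          exact div_nonneg vonMangoldt_nonneg (by positivity)
  linarith

end Mertens

/-- The Mertens product over the primes below `z`. -/
noncomputable def mertensProd (z : ℕ) : ℝ := ∏ p ∈ z.primesBelow, (1 - (p : ℝ)⁻¹)

theorem one_sub_inv_prime_pos {p : ℕ} (hp : p.Prime) : (0 : ℝ) < 1 - (p : ℝ)⁻¹ := by
  have : (1 : ℝ) < p := by exact_mod_cast hp.one_lt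
  have := inv_lt_one_of_one_lt₀ this
  linarith

theorem mertensProd_pos (z : ℕ) : 0 < mertensProd z :=
  prod_pos fun _ hp => one_sub_inv_prime_pos (Nat.prime_of_mem_primesBelow hp)

/-- `n ↦ n⁻¹` as a monoid homomorphism. -/
noncomputable def invHom : ℕ →* ℝ where
  toFun n := (n : ℝ)⁻¹
  map_one' := by simp
  map_mul' := by intros; simp [mul_comm]

/-- The reciprocals of integers up to `M` all of whose prime factors lie in a set `S` of primes. -/
theorem sum_inv_le_prod (S : Finset ℕ) (hS : ∀ p ∈ S, p.Prime) (N : Finset ℕ)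
    (hN : ∀ n ∈ N, n ≠ 0 ∧ ∀ p, p.Prime → p ∣ n → p ∈ S) :
    ∑ n ∈ N, (n : ℝ)⁻¹ ≤ ∏ p ∈ S, (1 - (p : ℝ)⁻¹)⁻¹ := by
  have h := EulerProduct.summable_and_hasSum_factoredNumbers_prod_filter_prime_geometric
    (f := invHom) (by
      intro p hp
      simp only [invHom, MonoidHom.coe_mk, OneHom.coe_mk, norm_inv, Real.norm_natCast]
      exact inv_lt_one_of_one_lt₀ (by exact_mod_cast hp.one_lt)) S
  have hf : S.filter (fun p => p.Prime) = S := by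
    apply filter_true_of_mem hS
  rw [hf] at h
  have h2 := h.2
  have hmem : ∀ n ∈ N, n ∈ Nat.factoredNumbers S := by
    intro n hn
    rw [Nat.mem_factoredNumbers']
    exact fun p hp hd => (hN n hn).2 p hp hd
  have h3 : ∑ n ∈ N.attach, invHom ((⟨n.1, hmem n.1 n.2⟩ : Nat.factoredNumbers S) : ℕ)
      ≤ ∏ p ∈ S, (1 - invHom p)⁻¹ := by
    have hinj : Function.Injective
        (fun n : {x // x ∈ N} => (⟨n.1, hmem n.1 n.2⟩ : Nat.factoredNumbers S)) := by
      intro a b hab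
      simp only [Subtype.mk.injEq] at hab
      exact Subtype.ext hab
    have := sum_le_hasSum (N.attach.map ⟨_, hinj⟩) (fun i _ => by
      simp only [invHom, MonoidHom.coe_mk, OneHom.coe_mk]; positivity) h2
    rwa [sum_map] at this
  rw [sum_attach N (fun n => invHom n)] at h3
  simpa [invHom] using h3

theorem mertensProd_mul_log_le (z : ℕ) : mertensProd z * Real.log z ≤ 1 := by
  rcases Nat.eq_zero_or_pos z with rfl | hz
  · simp
  have h1 : Real.log z ≤ ∑ n ∈ Ioo 0 z, (n : ℝ)⁻¹ := by
    have h := log_add_one_le_harmonic (z - 1)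
    rw [harmonic_eq_sum_Icc] at h
    have he : ((z - 1 : ℕ) : ℝ) + 1 = z := by
      exact_mod_cast Nat.succ_pred_eq_of_pos hz
    push_cast at h
    rw [show ((z - 1 : ℕ) : ℝ) + 1 = z by exact_mod_cast Nat.succ_pred_eq_of_pos hz] at h
    have : Icc 1 (z - 1) = Ioo 0 z := by ext; simp; omega
    rw [this] at h
    exact h
  have h2 : ∑ n ∈ Ioo 0 z, (n : ℝ)⁻¹ ≤ ∏ p ∈ z.primesBelow, (1 - (p : ℝ)⁻¹)⁻¹ := by
    apply sum_inv_le_prod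
    · intro p hp; exact Nat.prime_of_mem_primesBelow hp
    · intro n hn
      simp only [mem_Ioo] at hn
      refine ⟨by omega, fun p hp hd => ?_⟩
      rw [Nat.mem_primesBelow]
      exact ⟨(Nat.le_of_dvd hn.1 hd).trans_lt hn.2, hp⟩
  rw [prod_inv_distrib] at h2
  have h3 := mertensProd_pos z
  calc mertensProd z * Real.log z ≤ mertensProd z * (mertensProd z)⁻¹ :=
        mul_le_mul_of_nonneg_left (h1.trans h2) h3.le
    _ = 1 := mul_inv_cancel₀ h3.ne'

end Linnik

namespace Linnik

open Finset ArithmeticFunction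

theorem rpow_neg_succ_le {α : ℝ} (hα : 0 < α) (n : ℕ) (hn : 1 ≤ n) :
    ((n + 1 : ℕ) : ℝ) ^ (-(1 + α)) ≤ α⁻¹ * ((n : ℝ) ^ (-α) - ((n + 1 : ℕ) : ℝ) ^ (-α)) := by
  have hn0 : (0 : ℝ) < n := by exact_mod_cast hn
  have hm0 : (0 : ℝ) < ((n + 1 : ℕ) : ℝ) := by positivity
  set m : ℝ := ((n + 1 : ℕ) : ℝ) with hm
  have hmn : m = n + 1 := by rw [hm]; push_cast; ring
  have h1 : (n : ℝ) ^ (-α) = m ^ (-α) * (m / n) ^ α := by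
    rw [Real.div_rpow hm0.le hn0.le, Real.rpow_neg hm0.le, Real.rpow_neg hn0.le]
    field_simp
  have h2 : 1 + α / m ≤ (m / n) ^ α := by
    rw [Real.rpow_def_of_pos (by positivity)]
    have h3 : 1 / m ≤ Real.log (m / n) := by
      have := Real.one_sub_inv_le_log_of_pos (x := m / n) (by positivity)
      have h4 : 1 - (m / n)⁻¹ = 1 / m := by
        field_simp; rw [hmn]; ring
      linarith
    have h5 := Real.add_one_le_exp (Real.log (m / n) * α)
    have : α / m = 1 / m * α := by ring
    nlinarith
  have h6 : m ^ (-(1 + α)) = m ^ (-α) * (1 / m) := by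
    rw [show -(1 + α) = -α + -1 by ring, Real.rpow_add hm0, Real.rpow_neg_one, one_div]
  rw [h6, h1]
  have h7 : 0 < m ^ (-α) := by positivity
  rw [show α⁻¹ * (m ^ (-α) * (m / n) ^ α - m ^ (-α)) = m ^ (-α) * (α⁻¹ * ((m / n) ^ α - 1)) by ring]
  apply mul_le_mul_of_nonneg_left _ h7.le
  rw [inv_mul_eq_div, le_div_iff₀ hα]
  have : 1 / m * α = α / m := by ring
  linarith

theorem sum_Icc_rpow_neg_le {α : ℝ} (hα : 0 < α) (N : ℕ) :
    ∑ n ∈ Icc 1 N, (n : ℝ) ^ (-(1 + α)) ≤ 1 + α⁻¹ := by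
  have key : ∀ N : ℕ, ∑ n ∈ Icc 1 (N + 1), (n : ℝ) ^ (-(1 + α)) ≤
      1 + α⁻¹ * (1 - ((N + 1 : ℕ) : ℝ) ^ (-α)) := by
    intro N
    induction N with
    | zero => simp
    | succ N ih =>
      rw [sum_Icc_succ_top (by omega)]
      have := rpow_neg_succ_le hα (N + 1) (by omega)
      nlinarith
  rcases N with _ | N
  · simp; positivity
  · refine (key N).trans ?_
    have : 0 < ((N + 1 : ℕ) : ℝ) ^ (-α) := by positivity
    have h2 : 0 < α⁻¹ := by positivity
    nlinarith

/-- `n ↦ n ^ (-σ)` as a monoid homomorphism. -/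
noncomputable def rpowHom (σ : ℝ) : ℕ →* ℝ where
  toFun n := (n : ℝ) ^ (-σ)
  map_one' := by simp
  map_mul' a b := by
    push_cast
    exact Real.mul_rpow (by positivity) (by positivity)

theorem prod_one_sub_rpow_inv_le {α : ℝ} (hα : 0 < α) (S : Finset ℕ) (hS : ∀ p ∈ S, p.Prime) :
    ∏ p ∈ S, (1 - (p : ℝ) ^ (-(1 + α)))⁻¹ ≤ 1 + α⁻¹ := by
  have h := EulerProduct.summable_and_hasSum_factoredNumbers_prod_filter_prime_geometric
    (f := rpowHom (1 + α)) (by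
      intro p hp
      have hp1 : (1 : ℝ) < p := by exact_mod_cast hp.one_lt
      simp only [rpowHom, MonoidHom.coe_mk, OneHom.coe_mk]
      rw [Real.norm_of_nonneg (by positivity)]
      exact Real.rpow_lt_one_of_one_lt_of_neg hp1 (by linarith)) S
  rw [filter_true_of_mem hS] at h
  have h2 := h.2
  simp only [rpowHom, MonoidHom.coe_mk, OneHom.coe_mk] at h2
  refine hasSum_le_of_sum_le h2 ?_
  intro s
  have : ∑ i ∈ s, ((i : ℕ) : ℝ) ^ (-(1 + α)) =
      ∑ n ∈ s.map (Function.Embedding.subtype _), (n : ℝ) ^ (-(1 + α)) := by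
    rw [sum_map]; rfl
  rw [this]
  refine le_trans ?_ (sum_Icc_rpow_neg_le hα ((s.map (Function.Embedding.subtype _)).sup id))
  apply sum_le_sum_of_subset_of_nonneg
  · intro n hn
    have hn' := hn
    simp only [mem_map, Function.Embedding.subtype_apply] at hn
    obtain ⟨a, ha, rfl⟩ := hn
    rw [mem_Icc]
    refine ⟨Nat.one_le_iff_ne_zero.mpr ?_, Finset.le_sup (f := id) hn'⟩
    exact Nat.ne_zero_of_mem_factoredNumbers a.2
  · intros; positivity

theorem one_sub_inv_inv_le {α : ℝ} (hα : 0 < α) {p : ℕ} (hp : p.Prime) :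
    (1 - (p : ℝ)⁻¹)⁻¹ ≤
      (1 - (p : ℝ) ^ (-(1 + α)))⁻¹ * Real.exp (2 * α * (Real.log p / p)) := by
  have hp0 : (0 : ℝ) < p := by exact_mod_cast hp.pos
  have hp2 : (2 : ℝ) ≤ p := by exact_mod_cast hp.two_le
  have h1 := one_sub_inv_prime_pos hp
  have h2 : (p : ℝ) ^ (-(1 + α)) = (p : ℝ)⁻¹ * (p : ℝ) ^ (-α) := by
    rw [show -(1 + α) = -1 + -α by ring, Real.rpow_add hp0, Real.rpow_neg_one]
  have h3 : (p : ℝ) ^ (-(1 + α)) < 1 :=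
    Real.rpow_lt_one_of_one_lt_of_neg (by linarith) (by linarith)
  have h4 : 1 - α * Real.log p ≤ (p : ℝ) ^ (-α) := by
    rw [Real.rpow_def_of_pos hp0]
    have := Real.add_one_le_exp (Real.log p * -α)
    linarith
  have h5 := Real.add_one_le_exp (2 * α * (Real.log p / p))
  have hl : 0 ≤ Real.log p := Real.log_nonneg (by linarith)
  have h6 : 0 < 1 - (p : ℝ) ^ (-(1 + α)) := by linarith
  rw [inv_mul_eq_div, le_div_iff₀ h6, inv_mul_le_iff₀ h1]
  have h7 : (p : ℝ)⁻¹ ≤ 1 / 2 := by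
    rw [inv_le_comm₀ hp0 (by norm_num)]; norm_num; exact hp.two_le
  have h8 : 1 - (p : ℝ) ^ (-(1 + α)) ≤ 1 - (p : ℝ)⁻¹ + (p : ℝ)⁻¹ * (α * Real.log p) := by
    rw [h2]
    have : 0 < (p : ℝ)⁻¹ := by positivity
    nlinarith
  have h9 : 1 - (p : ℝ)⁻¹ + (p : ℝ)⁻¹ * (α * Real.log p) ≤
      (1 - (p : ℝ)⁻¹) * (2 * α * (Real.log p / p) + 1) := by
    have e : (1 - (p : ℝ)⁻¹) * (2 * α * (Real.log p / p) + 1) =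
      (1 - (p : ℝ)⁻¹) + 2 * (1 - (p : ℝ)⁻¹) * ((p : ℝ)⁻¹ * (α * Real.log p)) := by
      rw [div_eq_mul_inv]; ring
    rw [e]
    have : 0 ≤ (p : ℝ)⁻¹ * (α * Real.log p) := by positivity
    nlinarith
  calc _ ≤ _ := h8
    _ ≤ _ := h9
    _ ≤ _ := mul_le_mul_of_nonneg_left h5 h1.le

theorem le_mertensProd_mul_log (z : ℕ) (hz : 2 ≤ z) :
    Real.exp (-24) ≤ mertensProd z * Real.log z := by
  have hz2 : (2 : ℝ) ≤ z := by exact_mod_cast hz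
  have hl2 : Real.log 2 ≤ Real.log z := Real.log_le_log (by norm_num) hz2
  have hl := Real.log_two_gt_d9
  have hlz : 0.69 < Real.log z := by norm_num; linarith
  set l := Real.log z with hldef
  have hl0 : 0 < l := by linarith
  have h1 : (mertensProd z)⁻¹ ≤ (1 + l) * Real.exp 22 := by
    rw [mertensProd, ← prod_inv_distrib]
    calc ∏ p ∈ z.primesBelow, (1 - (p : ℝ)⁻¹)⁻¹
        ≤ ∏ p ∈ z.primesBelow, ((1 - (p : ℝ) ^ (-(1 + l⁻¹)))⁻¹ *
            Real.exp (2 * l⁻¹ * (Real.log p / p))) := by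
          apply prod_le_prod
          · intro p hp
            have := one_sub_inv_prime_pos (Nat.prime_of_mem_primesBelow hp)
            positivity
          · intro p hp
            exact one_sub_inv_inv_le (by positivity) (Nat.prime_of_mem_primesBelow hp)
      _ = (∏ p ∈ z.primesBelow, (1 - (p : ℝ) ^ (-(1 + l⁻¹)))⁻¹) *
            Real.exp (2 * l⁻¹ * ∑ p ∈ z.primesBelow, (Real.log p / p)) := by
          rw [prod_mul_distrib, ← Real.exp_sum, mul_sum]
      _ ≤ (1 + l) * Real.exp 22 := by
          have hA := prod_one_sub_rpow_inv_le (α := l⁻¹) (by positivity) z.primesBelow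
            (fun p hp => Nat.prime_of_mem_primesBelow hp)
          rw [inv_inv] at hA
          apply mul_le_mul hA _ (by positivity) (by positivity)
          apply Real.exp_le_exp.mpr
          have hB := sum_log_div_prime_le z (by omega)
          calc _ ≤ 2 * l⁻¹ * (l + 6) := by gcongr
            _ = 2 + 12 / l := by field_simp; ring
            _ ≤ 22 := by
              have : 12 / l ≤ 20 := by rw [div_le_iff₀ hl0]; linarith
              linarith
  have h2 := mertensProd_pos z
  have h3 : 1 + l ≤ Real.exp 1 * l := by
    have := Real.exp_one_gt_d9
    nlinarith
  have h4 : 1 ≤ mertensProd z * ((1 + l) * Real.exp 22) := by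
    rwa [inv_le_iff_one_le_mul₀' h2] at h1
  have h5 : (1 + l) * Real.exp 22 ≤ l * Real.exp 24 := by
    calc (1 + l) * Real.exp 22 ≤ (Real.exp 1 * l) * Real.exp 22 := by gcongr
      _ = l * Real.exp 23 := by
        rw [show (23 : ℝ) = 1 + 22 by norm_num, Real.exp_add]; ring
      _ ≤ l * Real.exp 24 := by gcongr; norm_num
  have h6 : 1 ≤ mertensProd z * l * Real.exp 24 := by
    calc 1 ≤ _ := h4
      _ ≤ mertensProd z * (l * Real.exp 24) := by gcongr
      _ = _ := by ring
  rw [Real.exp_neg, inv_le_iff_one_le_mul₀ (Real.exp_pos _)]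
  exact h6

/-- `n` has no prime factor below `z`. -/
def IsRough (z n : ℕ) : Prop := ∀ p ∈ z.primesBelow, ¬ p ∣ n

instance (z n : ℕ) : Decidable (IsRough z n) :=
  inferInstanceAs (Decidable (∀ p ∈ z.primesBelow, ¬ p ∣ n))

theorem IsRough.le_prime {z n p : ℕ} (h : IsRough z n) (hp : p.Prime) (hd : p ∣ n) : z ≤ p := by
  by_contra hlt
  exact h p (Nat.mem_primesBelow.mpr ⟨by omega, hp⟩) hd

theorem IsRough.of_dvd {z n d : ℕ} (h : IsRough z n) (hd : d ∣ n) : IsRough z d :=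
  fun p hp hpd => h p hp (hpd.trans hd)

theorem isRough_mul {z a b : ℕ} : IsRough z (a * b) ↔ IsRough z a ∧ IsRough z b := by
  refine ⟨fun h => ⟨h.of_dvd (Dvd.intro _ rfl), h.of_dvd (Dvd.intro_left _ rfl)⟩, ?_⟩
  rintro ⟨ha, hb⟩ p hp hd
  rcases (Nat.prime_of_mem_primesBelow hp).dvd_mul.mp hd with h | h
  · exact ha p hp h
  · exact hb p hp h

theorem IsRough.eq_one_or_le {z n : ℕ} (h : IsRough z n) (hn : n ≠ 0) : n = 1 ∨ z ≤ n := by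
  by_cases h1 : n = 1
  · exact Or.inl h1
  · right
    exact (h.le_prime (Nat.minFac_prime h1) (Nat.minFac_dvd n)).trans
      (Nat.minFac_le (Nat.pos_of_ne_zero hn))

theorem sum_rough_inv_le (z M : ℕ) (hz : 2 ≤ z) (hM : z ≤ M + 1) :
    ∑ m ∈ (Ioc 0 M).filter (IsRough z), (m : ℝ)⁻¹ ≤
      Real.exp 24 * Real.log (M + 1) / Real.log z := by
  have h1 : ∑ m ∈ (Ioc 0 M).filter (IsRough z), (m : ℝ)⁻¹ ≤
      ∏ p ∈ (M + 1).primesBelow \ z.primesBelow, (1 - (p : ℝ)⁻¹)⁻¹ := by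
    apply sum_inv_le_prod
    · intro p hp
      exact Nat.prime_of_mem_primesBelow (mem_sdiff.mp hp).1
    · intro n hn
      rw [mem_filter, mem_Ioc] at hn
      refine ⟨by omega, fun p hp hd => ?_⟩
      rw [mem_sdiff]
      refine ⟨Nat.mem_primesBelow.mpr ⟨?_, hp⟩, fun h => hn.2 p h hd⟩
      have := Nat.le_of_dvd hn.1.1 hd
      omega
  have hsub : z.primesBelow ⊆ (M + 1).primesBelow := by
    intro p hp
    rw [Nat.mem_primesBelow] at hp ⊢
    exact ⟨by omega, hp.2⟩
  have h2 := prod_sdiff (f := fun p : ℕ => (1 - (p : ℝ)⁻¹)⁻¹) hsub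
  rw [prod_inv_distrib (s := z.primesBelow), prod_inv_distrib (s := (M + 1).primesBelow)] at h2
  change _ * (mertensProd z)⁻¹ = (mertensProd (M + 1))⁻¹ at h2
  have hz0 := mertensProd_pos z
  have hM0 := mertensProd_pos (M + 1)
  rw [mul_inv_eq_iff_eq_mul₀ hz0.ne'] at h2
  rw [h2] at h1
  have h3 := le_mertensProd_mul_log (M + 1) (by omega)
  have h4 := mertensProd_mul_log_le z
  have hlz : 0 < Real.log z := Real.log_pos (by exact_mod_cast hz)
  refine h1.trans ?_
  rw [inv_mul_eq_div, div_le_div_iff₀ hM0 hlz]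
  refine h4.trans ?_
  rw [Real.exp_neg, inv_le_iff_one_le_mul₀ (Real.exp_pos _)] at h3
  push_cast at h3
  linarith

theorem mertensProd_le_mul (w z : ℕ) (hz : 2 ≤ z) (hw : 2 ≤ w) :
    mertensProd w ≤ Real.exp 24 * (Real.log z / Real.log w) * mertensProd z := by
  have h3 := le_mertensProd_mul_log z hz
  have h4 := mertensProd_mul_log_le w
  have hlw : 0 < Real.log w := Real.log_pos (by exact_mod_cast hw)
  rw [Real.exp_neg, inv_le_iff_one_le_mul₀ (Real.exp_pos _)] at h3
  have : mertensProd w * Real.log w ≤ Real.exp 24 * Real.log z * mertensProd z := by linarith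
  calc mertensProd w = (mertensProd w * Real.log w) / Real.log w := by field_simp
    _ ≤ (Real.exp 24 * Real.log z * mertensProd z) / Real.log w := by gcongr
    _ = _ := by ring

end Linnik

namespace Linnik

open Finset

section Selberg

variable {ι : Type*} [DecidableEq ι]

theorem sum_neg_one_pow_filter (v t : Finset ι) (hvt : v ⊆ t) :
    ∑ s ∈ t.powerset.filter (v ⊆ ·), (-1 : ℝ) ^ #s = if t = v then (-1) ^ #v else 0 := by
  have h := Finset.prod_add (fun _ : ι => (-1 : ℝ)) (fun p => if p ∈ v then 0 else 1) t
  rw [sum_filter]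
  have h1 : ∀ s ∈ t.powerset, ((∏ _a ∈ s, (-1 : ℝ)) * ∏ a ∈ t \ s, if a ∈ v then (0 : ℝ) else 1) =
      if v ⊆ s then (-1) ^ #s else 0 := by
    intro s hs
    rw [prod_const]
    split_ifs with hvs
    · rw [prod_eq_one, mul_one]
      intro a ha
      rw [if_neg (fun hav => (mem_sdiff.mp ha).2 (hvs hav))]
    · obtain ⟨a, hav, has⟩ := not_subset.mp hvs
      rw [prod_eq_zero (i := a) (mem_sdiff.mpr ⟨hvt hav, has⟩) (by simp [hav]), mul_zero]
  rw [← sum_congr rfl h1, ← h]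
  split_ifs with htv
  · subst htv
    rw [← prod_const]
    apply prod_congr rfl
    intro p hp
    simp [hp]
  · obtain ⟨a, hat, hav⟩ := not_subset.mp (fun hsub => htv (Subset.antisymm hsub hvt))
    exact prod_eq_zero hat (by simp [hav])

/-- The weight `h` attached to a density `g` in Selberg's sieve. -/
noncomputable def selbergH (g : ι → ℝ) (p : ι) : ℝ := g p / (1 - g p)

/-- The Selberg sum over a family of sets. -/
noncomputable def selbergSum (g : ι → ℝ) (F : Finset (Finset ι)) : ℝ :=
  ∑ t ∈ F, ∏ p ∈ t, selbergH g p

/-- The optimal Selberg weights. -/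
noncomputable def selbergWeight (g : ι → ℝ) (F : Finset (Finset ι)) (s : Finset ι) : ℝ :=
  (-1) ^ #s * (∏ p ∈ s, g p)⁻¹ * (selbergSum g F)⁻¹ *
    ∑ t ∈ F.filter (s ⊆ ·), ∏ p ∈ t, selbergH g p

variable {P : Finset ι} {g : ι → ℝ} {F : Finset (Finset ι)}

theorem selbergH_pos (hg : ∀ p ∈ P, 0 < g p ∧ g p < 1) {p : ι} (hp : p ∈ P) :
    0 < selbergH g p := by
  have := hg p hp
  exact div_pos this.1 (by linarith)

theorem prod_selbergH_pos (hg : ∀ p ∈ P, 0 < g p ∧ g p < 1) {s : Finset ι} (hs : s ⊆ P) :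
    0 < ∏ p ∈ s, selbergH g p := prod_pos fun _ hp => selbergH_pos hg (hs hp)

theorem selbergSum_pos (hg : ∀ p ∈ P, 0 < g p ∧ g p < 1) (hF : ∀ s ∈ F, s ⊆ P)
    (hF0 : ∅ ∈ F) : 0 < selbergSum g F :=
  sum_pos (fun s hs => prod_selbergH_pos hg (hF s hs)) ⟨_, hF0⟩

theorem selbergWeight_empty (hg : ∀ p ∈ P, 0 < g p ∧ g p < 1) (hF : ∀ s ∈ F, s ⊆ P)
    (hF0 : ∅ ∈ F) : selbergWeight g F ∅ = 1 := by
  have := selbergSum_pos hg hF hF0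
  simp only [selbergWeight, card_empty, pow_zero, prod_empty, inv_one, mul_one, one_mul,
    empty_subset, filter_true]
  exact inv_mul_cancel₀ this.ne'

theorem abs_selbergWeight_le (hg : ∀ p ∈ P, 0 < g p ∧ g p < 1) (hF : ∀ s ∈ F, s ⊆ P)
    (hF0 : ∅ ∈ F) {s : Finset ι} (hs : s ⊆ P) :
    |selbergWeight g F s| ≤ (∏ p ∈ s, g p)⁻¹ := by
  have hS := selbergSum_pos hg hF hF0
  have hgs : 0 < ∏ p ∈ s, g p := prod_pos fun p hp => (hg p (hs hp)).1
  have h1 : ∑ t ∈ F.filter (s ⊆ ·), ∏ p ∈ t, selbergH g p ≤ selbergSum g F :=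
    sum_le_sum_of_subset_of_nonneg (filter_subset _ _)
      (fun t ht _ => (prod_selbergH_pos hg (hF t ht)).le)
  have h2 : 0 ≤ ∑ t ∈ F.filter (s ⊆ ·), ∏ p ∈ t, selbergH g p :=
    sum_nonneg fun t ht => (prod_selbergH_pos hg (hF t (mem_filter.mp ht).1)).le
  rw [selbergWeight, abs_mul, abs_mul, abs_mul, abs_pow, abs_neg, abs_one, one_pow, one_mul,
    abs_of_pos (inv_pos.mpr hgs), abs_of_pos (inv_pos.mpr hS), abs_of_nonneg h2, mul_assoc]
  apply mul_le_of_le_one_right (by positivity)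
  rw [inv_mul_le_iff₀ hS]
  linarith

theorem sum_mul_selbergWeight (hg : ∀ p ∈ P, 0 < g p ∧ g p < 1) (hF : ∀ s ∈ F, s ⊆ P)
    (hdown : ∀ t ∈ F, ∀ s ⊆ t, s ∈ F) {v : Finset ι} (hv : v ∈ F) :
    ∑ s ∈ F.filter (v ⊆ ·), (∏ p ∈ s, g p) * selbergWeight g F s =
      (selbergSum g F)⁻¹ * ((-1) ^ #v * ∏ p ∈ v, selbergH g p) := by
  have h1 : ∀ s ∈ F.filter (v ⊆ ·), (∏ p ∈ s, g p) * selbergWeight g F s =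
      (selbergSum g F)⁻¹ * ∑ t ∈ F, if s ⊆ t then (-1) ^ #s * ∏ p ∈ t, selbergH g p else 0 := by
    intro s hs
    have hgs : 0 < ∏ p ∈ s, g p := prod_pos fun p hp => (hg p (hF s (mem_filter.mp hs).1 hp)).1
    rw [selbergWeight, ← sum_filter, ← mul_sum]
    field_simp
  rw [sum_congr rfl h1, ← mul_sum, sum_comm]
  congr 1
  have h2 : ∀ t ∈ F, (∑ s ∈ F.filter (v ⊆ ·),
      if s ⊆ t then (-1 : ℝ) ^ #s * ∏ p ∈ t, selbergH g p else 0) =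
      if t = v then (-1) ^ #v * ∏ p ∈ v, selbergH g p else 0 := by
    intro t ht
    rw [← sum_filter, filter_filter]
    by_cases hvt : v ⊆ t
    · have : F.filter (fun s => v ⊆ s ∧ s ⊆ t) = t.powerset.filter (v ⊆ ·) := by
        ext s
        simp only [mem_filter, mem_powerset]
        exact ⟨fun h => ⟨h.2.2, h.2.1⟩, fun h => ⟨hdown t ht s h.1, h.2, h.1⟩⟩
      rw [this, ← sum_mul, sum_neg_one_pow_filter v t hvt]
      split_ifs with h
      · rw [h]
      · simp
    · rw [if_neg (fun h => hvt (by rw [h]))]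
      apply sum_eq_zero
      intro s hs
      exact absurd ((mem_filter.mp hs).2.1.trans (mem_filter.mp hs).2.2) hvt
  rw [sum_congr rfl h2, sum_ite_eq' F v, if_pos hv]

theorem inv_prod_eq_sum (hg : ∀ p ∈ P, 0 < g p ∧ g p < 1) {u : Finset ι} (hu : u ⊆ P) :
    (∏ p ∈ u, g p)⁻¹ = ∑ v ∈ u.powerset, (∏ p ∈ v, selbergH g p)⁻¹ := by
  have h1 : (∏ p ∈ u, g p)⁻¹ = ∏ p ∈ u, ((selbergH g p)⁻¹ + 1) := by
    rw [← prod_inv_distrib]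
    apply prod_congr rfl
    intro p hp
    have := hg p (hu hp)
    have h3 : 1 - g p ≠ 0 := by linarith
    have := this.1.ne'
    rw [selbergH]
    field_simp
    ring
  rw [h1, prod_add]
  apply sum_congr rfl
  intro v _
  simp [prod_inv_distrib]

theorem selberg_quadratic (hg : ∀ p ∈ P, 0 < g p ∧ g p < 1) (hF : ∀ s ∈ F, s ⊆ P)
    (hF0 : ∅ ∈ F) (hdown : ∀ t ∈ F, ∀ s ⊆ t, s ∈ F) :
    ∑ s ∈ F, ∑ t ∈ F, selbergWeight g F s * selbergWeight g F t * ∏ p ∈ s ∪ t, g p =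
      (selbergSum g F)⁻¹ := by
  have hS := selbergSum_pos hg hF hF0
  have h1 : ∀ s ∈ F, ∀ t ∈ F,
      selbergWeight g F s * selbergWeight g F t * ∏ p ∈ s ∪ t, g p =
      ∑ v ∈ F, (∏ p ∈ v, selbergH g p)⁻¹ *
        ((if v ⊆ s then (∏ p ∈ s, g p) * selbergWeight g F s else 0) *
         (if v ⊆ t then (∏ p ∈ t, g p) * selbergWeight g F t else 0)) := by
    intro s hs t ht
    have h2 : ∏ p ∈ s ∪ t, g p = (∏ p ∈ s, g p) * (∏ p ∈ t, g p) * (∏ p ∈ s ∩ t, g p)⁻¹ := by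
      have hne : ∏ p ∈ s ∩ t, g p ≠ 0 :=
        prod_ne_zero_iff.mpr fun p hp => (hg p (hF s hs (mem_inter.mp hp).1)).1.ne'
      rw [← prod_union_inter, mul_inv_cancel_right₀ hne]
    rw [h2, inv_prod_eq_sum hg (inter_subset_left.trans (hF s hs))]
    have h3 : (s ∩ t).powerset = F.filter (fun v => v ⊆ s ∧ v ⊆ t) := by
      ext v
      simp only [mem_powerset, mem_filter, subset_inter_iff]
      exact ⟨fun h => ⟨hdown s hs v h.1, h⟩, fun h => h.2⟩
    rw [h3, sum_filter, mul_sum, mul_sum]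
    apply sum_congr rfl
    intro v _
    by_cases h4 : v ⊆ s <;> by_cases h5 : v ⊆ t <;> simp [h4, h5]
    ring
  rw [sum_congr rfl fun s hs => sum_congr rfl fun t ht => h1 s hs t ht]
  have h2 : ∑ s ∈ F, ∑ t ∈ F, ∑ v ∈ F, (∏ p ∈ v, selbergH g p)⁻¹ *
        ((if v ⊆ s then (∏ p ∈ s, g p) * selbergWeight g F s else 0) *
         (if v ⊆ t then (∏ p ∈ t, g p) * selbergWeight g F t else 0)) =
      ∑ v ∈ F, (∏ p ∈ v, selbergH g p)⁻¹ *
        (∑ s ∈ F.filter (v ⊆ ·), (∏ p ∈ s, g p) * selbergWeight g F s) ^ 2 := by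
    rw [sum_congr rfl fun s _ => sum_comm, sum_comm]
    apply sum_congr rfl
    intro v _
    rw [sum_filter, sq, sum_mul_sum, mul_sum]
    apply sum_congr rfl
    intro s _
    rw [mul_sum]
  rw [h2]
  have h3 : ∀ v ∈ F, (∏ p ∈ v, selbergH g p)⁻¹ *
        (∑ s ∈ F.filter (v ⊆ ·), (∏ p ∈ s, g p) * selbergWeight g F s) ^ 2 =
      (selbergSum g F)⁻¹ ^ 2 * ∏ p ∈ v, selbergH g p := by
    intro v hv
    rw [sum_mul_selbergWeight hg hF hdown hv]
    have := (prod_selbergH_pos hg (hF v hv)).ne'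
    rw [mul_pow, mul_pow, ← pow_mul, mul_comm #v 2, pow_mul]
    norm_num
    field_simp
  rw [sum_congr rfl h3, ← mul_sum]
  change _ * selbergSum g F = _
  field_simp

theorem selberg_upper (hg : ∀ p ∈ P, 0 < g p ∧ g p < 1) (hF : ∀ s ∈ F, s ⊆ P)
    (hF0 : ∅ ∈ F) (hdown : ∀ t ∈ F, ∀ s ⊆ t, s ∈ F) {ν : Type*} (N : Finset ν) (a : ν → ℝ)
    (ha : ∀ n ∈ N, 0 ≤ a n) (r : ι → ν → Prop) [∀ p n, Decidable (r p n)] (X R : ℝ)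
    (H : ∀ s ∈ F, ∀ t ∈ F,
      |∑ n ∈ N with ∀ p ∈ s ∪ t, r p n, a n - X * ∏ p ∈ s ∪ t, g p| ≤ R) :
    ∑ n ∈ N with ∀ p ∈ P, ¬ r p n, a n ≤
      X * (selbergSum g F)⁻¹ + R * (∑ s ∈ F, |selbergWeight g F s|) ^ 2 := by
  have h1 : ∑ n ∈ N with ∀ p ∈ P, ¬ r p n, a n ≤
      ∑ n ∈ N, a n * (∑ s ∈ F, if ∀ p ∈ s, r p n then selbergWeight g F s else 0) ^ 2 := by
    rw [sum_filter]
    apply sum_le_sum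
    intro n hn
    split_ifs with h
    · have : (∑ s ∈ F, if ∀ p ∈ s, r p n then selbergWeight g F s else 0) = 1 := by
        rw [sum_eq_single_of_mem ∅ hF0]
        · simp [selbergWeight_empty hg hF hF0]
        · intro s hs hne
          obtain ⟨p, hp⟩ := nonempty_iff_ne_empty.mpr hne
          rw [if_neg (fun hh => h p (hF s hs hp) (hh p hp))]
      rw [this]; simp
    · have := ha n hn
      positivity
  have h2 : ∑ n ∈ N, a n * (∑ s ∈ F, if ∀ p ∈ s, r p n then selbergWeight g F s else 0) ^ 2 =
      ∑ s ∈ F, ∑ t ∈ F, selbergWeight g F s * selbergWeight g F t *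
        ∑ n ∈ N with ∀ p ∈ s ∪ t, r p n, a n := by
    simp_rw [sum_filter, mul_sum, sq, sum_mul_sum, mul_sum]
    rw [sum_comm]
    apply sum_congr rfl
    intro s _
    rw [sum_comm]
    apply sum_congr rfl
    intro t _
    apply sum_congr rfl
    intro n _
    have hiff : (∀ p ∈ s ∪ t, r p n) ↔ (∀ p ∈ s, r p n) ∧ (∀ p ∈ t, r p n) := by
      simp only [mem_union, or_imp, forall_and]
    by_cases h4 : ∀ p ∈ s, r p n <;> by_cases h5 : ∀ p ∈ t, r p n
    · rw [if_pos h4, if_pos h5, if_pos (hiff.mpr ⟨h4, h5⟩)]; ring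
    · rw [if_neg h5, if_neg (fun h => h5 (hiff.mp h).2)]; ring
    · rw [if_neg h4, if_neg (fun h => h4 (hiff.mp h).1)]; ring
    · rw [if_neg h4, if_neg (fun h => h4 (hiff.mp h).1)]; ring
  rw [h2] at h1
  refine h1.trans ?_
  rw [← selberg_quadratic hg hF hF0 hdown, sq, sum_mul_sum, mul_sum, mul_sum, ← sum_add_distrib]
  apply sum_le_sum
  intro s hs
  rw [mul_sum, mul_sum, ← sum_add_distrib]
  apply sum_le_sum
  intro t ht
  have h3 := H s hs t ht
  set A := ∑ n ∈ N with ∀ p ∈ s ∪ t, r p n, a n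
  set G := ∏ p ∈ s ∪ t, g p
  set u := selbergWeight g F s * selbergWeight g F t with hu
  rw [← abs_mul, ← hu]
  have h4 : u * (A - X * G) ≤ |u| * R := by
    calc _ ≤ |u * (A - X * G)| := le_abs_self _
      _ = |u| * |A - X * G| := abs_mul _ _
      _ ≤ _ := mul_le_mul_of_nonneg_left h3 (abs_nonneg _)
  linarith

end Selberg

end Linnik

namespace Linnik

open Finset

/-- The sets of primes whose product has square at most `D`. -/
noncomputable def levelSets (P : Finset ℕ) (D : ℝ) : Finset (Finset ℕ) :=
  P.powerset.filter (fun s => ((∏ p ∈ s, p : ℕ) : ℝ) ^ 2 ≤ D)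

theorem sum_log_div_prime_div_log_le {w : ℕ} (hw : 2 ≤ w) {P : Finset ℕ}
    (hP : ∀ p ∈ P, p.Prime ∧ p < w) : ∑ p ∈ P, Real.log p / p / Real.log w ≤ 10 := by
  have hw2 : (2 : ℝ) ≤ w := by exact_mod_cast hw
  have hl2 : Real.log 2 ≤ Real.log w := Real.log_le_log (by norm_num) hw2
  have hl := Real.log_two_gt_d9
  have hlw : 0.69 < Real.log w := by norm_num; linarith
  rw [← sum_div, div_le_iff₀ (by linarith)]
  have h1 : ∑ p ∈ P, Real.log p / p ≤ ∑ p ∈ w.primesBelow, Real.log p / p := by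
    apply sum_le_sum_of_subset_of_nonneg
    · intro p hp
      exact Nat.mem_primesBelow.mpr ⟨(hP p hp).2, (hP p hp).1⟩
    · intro p _ _
      have : 0 ≤ Real.log p := Real.log_natCast_nonneg p
      positivity
  have h2 := sum_log_div_prime_le w (by omega)
  linarith

theorem selbergSum_levelSets_ge {w : ℕ} (hw : 2 ≤ w) {P : Finset ℕ} {g : ℕ → ℝ}
    (hP : ∀ p ∈ P, p.Prime ∧ p < w) (hg : ∀ p ∈ P, 0 < g p ∧ g p < 1)
    (hg2 : ∀ p ∈ P, g p ≤ 2 / p) {D : ℝ} (hD : 1 ≤ D) :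
    (∏ p ∈ P, (1 - g p))⁻¹ * (1 - Real.exp (40 - Real.log D / (2 * Real.log w))) ≤
      selbergSum g (levelSets P D) := by
  have hlw : 0 < Real.log w := Real.log_pos (by exact_mod_cast hw)
  set α := (Real.log w)⁻¹ with hα
  have hα0 : 0 < α := by positivity
  set c : ℕ → ℝ := fun p => Real.exp (α * Real.log p) with hc
  set h := selbergH g with hh
  have hhpos : ∀ p ∈ P, 0 < h p := fun p hp => selbergH_pos hg hp
  have h1 : ∀ p ∈ P, 1 + h p = (1 - g p)⁻¹ := by
    intro p hp
    have := (hg p hp).2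
    have h3 : 1 - g p ≠ 0 := by linarith
    rw [hh, selbergH]; field_simp; ring
  have htot : (∏ p ∈ P, (1 - g p))⁻¹ = ∑ t ∈ P.powerset, ∏ p ∈ t, h p := by
    rw [← prod_inv_distrib, ← prod_congr rfl h1, prod_one_add]
  have hsplit : ∑ t ∈ P.powerset, ∏ p ∈ t, h p = selbergSum g (levelSets P D) +
      ∑ t ∈ P.powerset with ¬ ((∏ p ∈ t, p : ℕ) : ℝ) ^ 2 ≤ D, ∏ p ∈ t, h p := by
    rw [selbergSum, levelSets, sum_filter_add_sum_filter_not]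
  have htail : ∑ t ∈ P.powerset with ¬ ((∏ p ∈ t, p : ℕ) : ℝ) ^ 2 ≤ D, ∏ p ∈ t, h p ≤
      Real.exp (- (α * Real.log D / 2)) * ∏ p ∈ P, (1 + h p * c p) := by
    rw [prod_one_add, mul_sum]
    calc _ ≤ ∑ t ∈ P.powerset with ¬ ((∏ p ∈ t, p : ℕ) : ℝ) ^ 2 ≤ D,
          Real.exp (- (α * Real.log D / 2)) * ∏ p ∈ t, h p * c p := by
          apply sum_le_sum
          intro t ht
          rw [mem_filter, mem_powerset] at ht
          have hpos : 0 < ∏ p ∈ t, h p := prod_pos fun p hp => hhpos p (ht.1 hp)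
          have hprod : ∏ p ∈ t, c p = Real.exp (α * Real.log ((∏ p ∈ t, p : ℕ) : ℝ)) := by
            rw [hc, ← Real.exp_sum, ← mul_sum, Nat.cast_prod, Real.log_prod]
            intro p hp
            exact_mod_cast (hP p (ht.1 hp)).1.ne_zero
          rw [prod_mul_distrib, hprod, mul_left_comm, ← Real.exp_add]
          apply le_mul_of_one_le_right hpos.le
          rw [← Real.exp_zero]
          apply Real.exp_le_exp.mpr
          have h5 : Real.log D ≤ Real.log (((∏ p ∈ t, p : ℕ) : ℝ) ^ 2) :=
            Real.log_le_log (by linarith) (not_le.mp ht.2).le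
          rw [Real.log_pow] at h5
          push_cast at h5 ⊢
          nlinarith
      _ ≤ _ := by
          apply sum_le_sum_of_subset_of_nonneg (filter_subset _ _)
          intro t ht _
          have : 0 < ∏ p ∈ t, h p * c p :=
            prod_pos fun p hp => mul_pos (hhpos p (mem_powerset.mp ht hp)) (Real.exp_pos _)
          positivity
  have hprod : ∏ p ∈ P, (1 + h p * c p) ≤ (∏ p ∈ P, (1 - g p))⁻¹ * Real.exp 40 := by
    have h6 : ∀ p ∈ P, 1 + h p * c p ≤
        (1 - g p)⁻¹ * Real.exp (4 * (Real.log p / p / Real.log w)) := by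
      intro p hp
      have hg' := hg p hp
      have hpp := (hP p hp).1
      have hp0 : (0 : ℝ) < p := by exact_mod_cast hpp.pos
      have hlp : 0 ≤ Real.log p := Real.log_natCast_nonneg p
      have e : 1 + h p * c p = (1 - g p)⁻¹ * (1 + g p * (c p - 1)) := by
        have h3 : 1 - g p ≠ 0 := by linarith
        rw [hh, selbergH]; field_simp; ring
      rw [e]
      apply mul_le_mul_of_nonneg_left _ (inv_nonneg.mpr (by linarith))
      have hx0 : 0 ≤ α * Real.log p := by positivity
      have hx1 : α * Real.log p ≤ 1 := by
        rw [hα, inv_mul_le_iff₀ hlw, mul_one]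
        exact Real.log_le_log hp0 (by exact_mod_cast (hP p hp).2.le)
      have hcb : c p - 1 ≤ 2 * (α * Real.log p) := by
        have := Real.abs_exp_sub_one_sub_id_le (x := α * Real.log p) (by rwa [abs_of_nonneg hx0])
        have := (abs_le.mp this).2
        simp only [hc]
        nlinarith
      have hc0 : 0 ≤ c p - 1 := by
        have := Real.add_one_le_exp (α * Real.log p)
        simp only [hc]; linarith
      have : g p * (c p - 1) ≤ 2 / p * (2 * (α * Real.log p)) :=
        mul_le_mul (hg2 p hp) hcb hc0 (by positivity)
      have h8 : 2 / p * (2 * (α * Real.log p)) = 4 * (Real.log p / p / Real.log w) := by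
        rw [hα]; field_simp; ring
      have := Real.add_one_le_exp (4 * (Real.log p / p / Real.log w))
      linarith
    calc ∏ p ∈ P, (1 + h p * c p)
        ≤ ∏ p ∈ P, ((1 - g p)⁻¹ * Real.exp (4 * (Real.log p / p / Real.log w))) := by
          apply prod_le_prod _ h6
          intro p hp
          have := hhpos p hp
          have : 0 < c p := Real.exp_pos _
          positivity
      _ = (∏ p ∈ P, (1 - g p))⁻¹ * Real.exp (4 * ∑ p ∈ P, (Real.log p / p / Real.log w)) := by
          rw [prod_mul_distrib, ← Real.exp_sum, mul_sum, prod_inv_distrib]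
      _ ≤ _ := by
          apply mul_le_mul_of_nonneg_left
          · apply Real.exp_le_exp.mpr
            have := sum_log_div_prime_div_log_le hw hP
            linarith
          · rw [htot]
            exact sum_nonneg fun t ht =>
              (prod_pos fun p hp => hhpos p (mem_powerset.mp ht hp)).le
  have hfin : Real.exp (- (α * Real.log D / 2)) * ((∏ p ∈ P, (1 - g p))⁻¹ * Real.exp 40) =
      (∏ p ∈ P, (1 - g p))⁻¹ * Real.exp (40 - Real.log D / (2 * Real.log w)) := by
    rw [mul_left_comm, ← Real.exp_add]
    congr 2
    rw [hα]; field_simp; ring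
  have hb := mul_le_mul_of_nonneg_left hprod (Real.exp_pos (- (α * Real.log D / 2))).le
  rw [hfin] at hb
  linarith

theorem prod_primes_injOn {P : Finset ℕ} (hP : ∀ p ∈ P, p.Prime) :
    Set.InjOn (fun s : Finset ℕ => ∏ p ∈ s, p) {s | s ⊆ P} := by
  intro s hs t ht hst
  simp only at hst
  rw [← Nat.primeFactors_prod (s := s) (fun p hp => hP p (hs hp)), hst,
    Nat.primeFactors_prod (fun p hp => hP p (ht hp))]

theorem sum_abs_selbergWeight_le {P : Finset ℕ} {g : ℕ → ℝ}
    (hP : ∀ p ∈ P, p.Prime) (hg : ∀ p ∈ P, 0 < g p ∧ g p < 1)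
    (hg2 : ∀ p ∈ P, 1 / (p : ℝ) ^ 2 ≤ g p) {D : ℝ} (hD : 1 ≤ D) :
    (∑ s ∈ levelSets P D, |selbergWeight g (levelSets P D) s|) ^ 2 ≤ D ^ 3 := by
  have hF : ∀ s ∈ levelSets P D, s ⊆ P := fun s hs => mem_powerset.mp (mem_filter.mp hs).1
  have hF0 : ∅ ∈ levelSets P D := by simp [levelSets, hD]
  have h1 : ∀ s ∈ levelSets P D, |selbergWeight g (levelSets P D) s| ≤ D := by
    intro s hs
    refine (abs_selbergWeight_le hg hF hF0 (hF s hs)).trans ?_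
    refine le_trans ?_ (mem_filter.mp hs).2
    rw [← prod_inv_distrib, Nat.cast_prod, ← prod_pow]
    apply prod_le_prod
    · intro p hp; exact (inv_pos.mpr (hg p (hF s hs hp)).1).le
    · intro p hp
      have h2 := hg2 p (hF s hs hp)
      have hp0 : (0 : ℝ) < p := by exact_mod_cast (hP p (hF s hs hp)).pos
      rw [inv_le_comm₀ (hg p (hF s hs hp)).1 (by positivity), ← one_div]
      exact h2
  have hcard : ((#(levelSets P D) : ℕ) : ℝ) ≤ Real.sqrt D := by
    have : #(levelSets P D) ≤ #(Icc 1 ⌊Real.sqrt D⌋₊) := by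
      apply card_le_card_of_injOn (fun s : Finset ℕ => ∏ p ∈ s, p)
      · intro s hs
        have hs' := mem_coe.mp hs
        simp only [coe_Icc, Set.mem_Icc]
        constructor
        · exact Nat.one_le_iff_ne_zero.mpr
            (prod_ne_zero_iff.mpr fun p hp => (hP p (hF s hs' hp)).ne_zero)
        · apply Nat.le_floor
          apply Real.le_sqrt_of_sq_le
          exact (mem_filter.mp hs').2
      · exact (prod_primes_injOn hP).mono fun s hs => hF s (mem_coe.mp hs)
    rw [Nat.card_Icc, Nat.add_sub_cancel] at this
    calc ((#(levelSets P D) : ℕ) : ℝ) ≤ (⌊Real.sqrt D⌋₊ : ℝ) := by exact_mod_cast this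
      _ ≤ _ := Nat.floor_le (Real.sqrt_nonneg _)
  have h2 : ∑ s ∈ levelSets P D, |selbergWeight g (levelSets P D) s| ≤ Real.sqrt D * D := by
    calc _ ≤ ∑ s ∈ levelSets P D, D := sum_le_sum h1
      _ = #(levelSets P D) * D := by simp
      _ ≤ _ := by gcongr
  calc _ ≤ (Real.sqrt D * D) ^ 2 := by gcongr
    _ = D ^ 3 := by rw [mul_pow, Real.sq_sqrt (by linarith)]; ring

/-- The upper bound sieve for sets of primes below `w`, at level `D`. -/
theorem selberg_upper_primes {w : ℕ} (hw : 2 ≤ w) {P : Finset ℕ} {g : ℕ → ℝ}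
    (hP : ∀ p ∈ P, p.Prime ∧ p < w) (hg : ∀ p ∈ P, 0 < g p ∧ g p < 1)
    (hg1 : ∀ p ∈ P, 1 / (p : ℝ) ^ 2 ≤ g p) (hg2 : ∀ p ∈ P, g p ≤ 2 / p) {D : ℝ} (hD : 1 ≤ D)
    (hρ : Real.exp (40 - Real.log D / (2 * Real.log w)) ≤ 1 / 2)
    (N : Finset ℕ) (a : ℕ → ℝ)
    (ha : ∀ n ∈ N, 0 ≤ a n) {X R : ℝ} (hX : 0 ≤ X) (hR : 0 ≤ R)
    (H : ∀ e ⊆ P, ((∏ p ∈ e, p : ℕ) : ℝ) ≤ D →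
      |∑ n ∈ N with ∀ p ∈ e, p ∣ n, a n - X * ∏ p ∈ e, g p| ≤ R) :
    ∑ n ∈ N with ∀ p ∈ P, ¬ p ∣ n, a n ≤
      X * (∏ p ∈ P, (1 - g p)) * (1 + 2 * Real.exp (40 - Real.log D / (2 * Real.log w))) +
        R * D ^ 3 := by
  set ρ := Real.exp (40 - Real.log D / (2 * Real.log w)) with hρdef
  have hρ0 : 0 < ρ := Real.exp_pos _
  have hF : ∀ s ∈ levelSets P D, s ⊆ P := fun s hs => mem_powerset.mp (mem_filter.mp hs).1
  have hF0 : ∅ ∈ levelSets P D := by simp [levelSets, hD]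
  have hposprod : ∀ s ⊆ P, 0 < ∏ p ∈ s, p := fun s hs => prod_pos fun p hp => (hP p (hs hp)).1.pos
  have hdown : ∀ t ∈ levelSets P D, ∀ s ⊆ t, s ∈ levelSets P D := by
    intro t ht s hst
    have ht' := mem_filter.mp ht
    refine mem_filter.mpr ⟨mem_powerset.mpr (hst.trans (hF t ht)), le_trans ?_ ht'.2⟩
    have : ∏ p ∈ s, p ≤ ∏ p ∈ t, p :=
      Nat.le_of_dvd (hposprod t (hF t ht)) (prod_dvd_prod_of_subset _ _ _ hst)
    gcongr
  have h1 := selberg_upper hg hF hF0 hdown N a ha (fun p n => p ∣ n) X R (by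
    intro s hs t ht
    apply H _ (union_subset (hF s hs) (hF t ht))
    have h2 := (mem_filter.mp hs).2
    have h3 := (mem_filter.mp ht).2
    have h4 : ∏ p ∈ s ∪ t, p ≤ (∏ p ∈ s, p) * ∏ p ∈ t, p := by
      rw [← prod_union_inter]
      apply Nat.le_mul_of_pos_right
      exact hposprod _ (inter_subset_left.trans (hF s hs))
    have h5 : ((∏ p ∈ s ∪ t, p : ℕ) : ℝ) ≤ ((∏ p ∈ s, p : ℕ) : ℝ) * ((∏ p ∈ t, p : ℕ) : ℝ) := by
      exact_mod_cast h4
    nlinarith [sq_nonneg (((∏ p ∈ s, p : ℕ) : ℝ) - ((∏ p ∈ t, p : ℕ) : ℝ))])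
  have hV : 0 < ∏ p ∈ P, (1 - g p) := prod_pos fun p hp => by linarith [(hg p hp).2]
  have h2 := selbergSum_levelSets_ge hw hP hg hg2 hD
  rw [← hρdef] at h2
  have h3 : (selbergSum g (levelSets P D))⁻¹ ≤ (∏ p ∈ P, (1 - g p)) * (1 + 2 * ρ) := by
    have hS := selbergSum_pos hg hF hF0
    rw [inv_le_iff_one_le_mul₀ hS]
    set V := ∏ p ∈ P, (1 - g p)
    calc 1 ≤ (1 + 2 * ρ) * (1 - ρ) := by nlinarith
      _ = V * (1 + 2 * ρ) * (V⁻¹ * (1 - ρ)) := by field_simp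
      _ ≤ _ := mul_le_mul_of_nonneg_left h2 (by positivity)
  have h4 := sum_abs_selbergWeight_le (fun p hp => (hP p hp).1) hg hg1 hD
  refine h1.trans ?_
  have h5 := mul_le_mul_of_nonneg_left h3 hX
  have h6 := mul_le_mul_of_nonneg_left h4 hR
  rw [mul_assoc X]
  linarith

end Linnik

namespace Linnik

open Finset

theorem sum_sifted_eq {N : Finset ℕ} {a : ℕ → ℝ} (P : Finset ℕ) :
    ∑ n ∈ N with ∀ p ∈ P, ¬ p ∣ n, a n = ∑ n ∈ N, a n -
      ∑ p ∈ P, ∑ n ∈ N.filter (p ∣ ·) with ∀ p' ∈ P.filter (· < p), ¬ p' ∣ n, a n := by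
  have key : ∀ (Q : Finset ℕ) (n : ℕ), (∏ p ∈ Q, (1 - if p ∣ n then (1 : ℝ) else 0)) =
      if ∀ p ∈ Q, ¬ p ∣ n then 1 else 0 := by
    intro Q n
    split_ifs with h
    · exact prod_eq_one fun p hp => by simp [h p hp]
    · push Not at h
      obtain ⟨p, hp, hd⟩ := h
      exact prod_eq_zero hp (by simp [hd])
  have h1 : ∀ n, (if ∀ p ∈ P, ¬ p ∣ n then a n else 0) = a n - ∑ p ∈ P,
      if p ∣ n then (if ∀ p' ∈ P.filter (· < p), ¬ p' ∣ n then a n else 0) else 0 := by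
    intro n
    have h2 := prod_one_sub_ordered P (fun p => if p ∣ n then (1 : ℝ) else 0)
    rw [key] at h2
    have h3 : (if ∀ p ∈ P, ¬ p ∣ n then a n else 0) =
        a n * (if ∀ p ∈ P, ¬ p ∣ n then 1 else 0) := by split_ifs <;> simp
    rw [h3, h2, mul_sub, mul_one, mul_sum]
    congr 1
    apply sum_congr rfl
    intro p _
    rw [key]
    split_ifs <;> simp
  rw [sum_filter, sum_congr rfl fun n _ => h1 n, sum_sub_distrib, sum_comm]
  congr 1
  apply sum_congr rfl
  intro p _
  rw [sum_filter, sum_filter]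

theorem prod_one_sub_le_of_lt {z p : ℕ} (hz : 2 ≤ z) (hp2 : 2 ≤ p) (hpz : p < z)
    {P : Finset ℕ} {g : ℕ → ℝ}
    (hP : ∀ p ∈ P, p.Prime ∧ p < z)
    (hg : ∀ p ∈ P, (1 - 1 / (p : ℝ)) ^ 2 ≤ 1 - g p) :
    ∏ p' ∈ P.filter (· < p), (1 - g p') ≤
      Real.exp 48 * (Real.log z / Real.log p) ^ 2 * ∏ p' ∈ P, (1 - g p') := by
  have hpos : ∀ p ∈ P, 0 < 1 - g p := by
    intro p hp
    refine lt_of_lt_of_le ?_ (hg p hp)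
    have := one_sub_inv_prime_pos (hP p hp).1
    rw [one_div]; positivity
  have h1 : ∏ p' ∈ P, (1 - g p') =
      (∏ p' ∈ P.filter (· < p), (1 - g p')) * ∏ p' ∈ P.filter (¬ · < p), (1 - g p') :=
    (prod_filter_mul_prod_filter_not _ _ _).symm
  have hsub : p.primesBelow ⊆ z.primesBelow := by
    intro p hp
    rw [Nat.mem_primesBelow] at hp ⊢
    exact ⟨by omega, hp.2⟩
  have h2 : (∏ q ∈ z.primesBelow \ p.primesBelow, (1 - (q : ℝ)⁻¹)) * mertensProd p =
      mertensProd z := prod_sdiff hsub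
  set U := ∏ q ∈ z.primesBelow \ p.primesBelow, (1 - (q : ℝ)⁻¹) with hU
  have hU0 : 0 < U := prod_pos fun q hq =>
    one_sub_inv_prime_pos (Nat.prime_of_mem_primesBelow (mem_sdiff.mp hq).1)
  have h3 : U ^ 2 ≤ ∏ p' ∈ P.filter (¬ · < p), (1 - g p') := by
    rw [hU, ← prod_pow]
    calc _ ≤ ∏ p' ∈ P.filter (¬ · < p), (1 - (p' : ℝ)⁻¹) ^ 2 := by
          have hsub' : P.filter (¬ · < p) ⊆ z.primesBelow \ p.primesBelow := by
            intro q hq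
            rw [mem_filter] at hq
            rw [mem_sdiff, Nat.mem_primesBelow, Nat.mem_primesBelow]
            exact ⟨⟨(hP q hq.1).2, (hP q hq.1).1⟩, fun h => hq.2 h.1⟩
          rw [← prod_sdiff hsub']
          apply mul_le_of_le_one_left (prod_nonneg fun q _ => by positivity)
          apply prod_le_one (fun q _ => by positivity)
          intro q hq
          have h5 := one_sub_inv_prime_pos
            (Nat.prime_of_mem_primesBelow (mem_sdiff.mp (mem_sdiff.mp hq).1).1)
          have : (0 : ℝ) ≤ (q : ℝ)⁻¹ := by positivity
          exact pow_le_one₀ h5.le (by linarith)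
      _ ≤ _ := by
          apply prod_le_prod
          · intros; positivity
          · intro q hq
            have := hg q (mem_filter.mp hq).1
            rwa [one_div] at this
  have h4 := mertensProd_le_mul p z hz hp2
  have hz0 := mertensProd_pos z
  have hp0 := mertensProd_pos p
  set r := Real.log z / Real.log p with hr
  have hr0 : 0 ≤ r := div_nonneg (Real.log_natCast_nonneg z) (Real.log_natCast_nonneg p)
  have h5 : 1 ≤ Real.exp 24 * r * U := by
    rw [← h2] at h4
    have : 1 * mertensProd p ≤ (Real.exp 24 * r * U) * mertensProd p := by linarith
    exact le_of_mul_le_mul_right this hp0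
  have h6 : 1 ≤ Real.exp 48 * r ^ 2 * U ^ 2 := by
    have : Real.exp 48 * r ^ 2 * U ^ 2 = (Real.exp 24 * r * U) ^ 2 := by
      rw [show (48 : ℝ) = 24 + 24 by norm_num, Real.exp_add]; ring
    rw [this]
    exact one_le_pow₀ h5
  have hVp : 0 < ∏ p' ∈ P.filter (· < p), (1 - g p') :=
    prod_pos fun q hq => hpos q (mem_filter.mp hq).1
  rw [h1]
  calc _ ≤ (∏ p' ∈ P.filter (· < p), (1 - g p')) * (Real.exp 48 * r ^ 2 * U ^ 2) :=
        le_mul_of_one_le_right hVp.le h6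
    _ ≤ (∏ p' ∈ P.filter (· < p), (1 - g p')) * (Real.exp 48 * r ^ 2 *
          ∏ p' ∈ P.filter (¬ · < p), (1 - g p')) := by gcongr
    _ = _ := by ring

/-- Two-sided sieve estimate for sets of primes below `z`, in dimension at most two. -/
theorem fundamental_lemma {s z : ℕ} (hs : 100 ≤ s) (hz : 2 ≤ z) {P : Finset ℕ} {g : ℕ → ℝ}
    (hP : ∀ p ∈ P, p.Prime ∧ p < z)
    (hg : ∀ p ∈ P, 1 / (p : ℝ) ^ 2 ≤ g p ∧ (1 - 1 / (p : ℝ)) ^ 2 ≤ 1 - g p)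
    (N : Finset ℕ) (a : ℕ → ℝ) (ha : ∀ n ∈ N, 0 ≤ a n) {X R : ℝ} (hX : 0 ≤ X) (hR : 0 ≤ R)
    (H : ∀ e ⊆ P, ∏ p ∈ e, p ≤ z ^ (s + 1) →
      |∑ n ∈ N with ∀ p ∈ e, p ∣ n, a n - X * ∏ p ∈ e, g p| ≤ R) :
    |∑ n ∈ N with ∀ p ∈ P, ¬ p ∣ n, a n - X * ∏ p ∈ P, (1 - g p)| ≤
      Real.exp (100 - s / 4) * (X * ∏ p ∈ P, (1 - g p)) + z ^ (3 * s + 2) * R := by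
  have hz0 : (0 : ℝ) < z := by exact_mod_cast (by omega : 0 < z)
  have hz1 : (1 : ℝ) ≤ z := by exact_mod_cast (by omega : 1 ≤ z)
  have hs' : (100 : ℝ) ≤ s := by exact_mod_cast hs
  have hlz : 0 < Real.log z := Real.log_pos (by exact_mod_cast hz)
  have hg01 : ∀ p ∈ P, 0 < g p ∧ g p < 1 := by
    intro p hp
    have hp0 : (0 : ℝ) < p := by exact_mod_cast (hP p hp).1.pos
    refine ⟨lt_of_lt_of_le (by positivity) (hg p hp).1, ?_⟩
    have h1 := (hg p hp).2
    have := one_sub_inv_prime_pos (hP p hp).1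
    rw [← one_div] at this
    have : 0 < (1 - 1 / (p : ℝ)) ^ 2 := by positivity
    linarith
  have hg2 : ∀ p ∈ P, g p ≤ 2 / p := by
    intro p hp
    have h1 := (hg p hp).2
    have : (1 - 1 / (p : ℝ)) ^ 2 = 1 - 2 / p + (1 / (p : ℝ)) ^ 2 := by ring
    have : 0 ≤ (1 / (p : ℝ)) ^ 2 := by positivity
    linarith
  set V := ∏ p ∈ P, (1 - g p) with hV
  have hV0 : 0 < V := prod_pos fun p hp => by linarith [(hg01 p hp).2]
  set D : ℝ := (z : ℝ) ^ s with hD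
  have hD1 : 1 ≤ D := one_le_pow₀ hz1
  have hlD : Real.log D = s * Real.log z := by rw [hD, Real.log_pow]
  have hzD : (z : ℝ) ^ (3 * s + 2) = z ^ 2 * D ^ 3 := by rw [hD]; ring
  have hDz : ∀ m : ℕ, (m : ℝ) ≤ D → m ≤ z ^ s := by
    intro m hm
    rw [hD] at hm
    exact_mod_cast hm
  have hrho : ∀ w : ℕ, 2 ≤ w → w ≤ z →
      Real.exp (40 - Real.log D / (2 * Real.log w)) ≤ Real.exp (40 - s / 2) := by
    intro w hw hwz
    apply Real.exp_le_exp.mpr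
    have hlw : 0 < Real.log w := Real.log_pos (by exact_mod_cast hw)
    have : Real.log w ≤ Real.log z :=
      Real.log_le_log (by exact_mod_cast (by omega : 0 < w)) (by exact_mod_cast hwz)
    have : (s : ℝ) / 2 ≤ Real.log D / (2 * Real.log w) := by
      rw [hlD, le_div_iff₀ (by positivity)]
      nlinarith
    linarith
  have hhalf : Real.exp (40 - s / 2) ≤ 1 / 2 := by
    have h1 : Real.exp (40 - (s : ℝ) / 2) ≤ Real.exp (-1) := Real.exp_le_exp.mpr (by linarith)
    have h2 := Real.exp_one_gt_d9
    rw [Real.exp_neg] at h1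
    refine h1.trans ?_
    rw [inv_le_comm₀ (Real.exp_pos 1) (by norm_num)]
    norm_num; linarith
  have hE : 2 * Real.exp (40 - s / 2) ≤ Real.exp (100 - s / 4) := by
    have h1 : (2 : ℝ) ≤ Real.exp 1 := by linarith [Real.exp_one_gt_d9]
    calc _ ≤ Real.exp 1 * Real.exp (40 - s / 2) := by gcongr
      _ = Real.exp (1 + (40 - s / 2)) := by rw [Real.exp_add]
      _ ≤ _ := Real.exp_le_exp.mpr (by linarith)
  have hRR : 0 ≤ R * D ^ 3 := by positivity
  rw [abs_le]
  constructor
  · have hterm : ∀ p ∈ P,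
        ∑ n ∈ N.filter (p ∣ ·) with ∀ p' ∈ P.filter (· < p), ¬ p' ∣ n, a n ≤
        X * (g p * ∏ p' ∈ P.filter (· < p), (1 - g p')) +
        X * V * Real.exp (95 - s / 4) * (Real.log p / p / Real.log z) + R * D ^ 3 := by
      intro p hp
      have hpp := (hP p hp).1
      have hpz := (hP p hp).2
      have hp0 : (0 : ℝ) < p := by exact_mod_cast hpp.pos
      have hlp : 0 < Real.log p := Real.log_pos (by exact_mod_cast hpp.one_lt)
      have hgp := hg01 p hp
      have hsubP : P.filter (· < p) ⊆ P := filter_subset _ _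
      have h1 := selberg_upper_primes (w := p) hpp.two_le (P := P.filter (· < p)) (g := g)
        (fun q hq => ⟨(hP q (hsubP hq)).1, (mem_filter.mp hq).2⟩)
        (fun q hq => hg01 q (hsubP hq)) (fun q hq => (hg q (hsubP hq)).1)
        (fun q hq => hg2 q (hsubP hq)) hD1 ((hrho p hpp.two_le hpz.le).trans hhalf)
        (N.filter (p ∣ ·)) a (fun n hn => ha n (mem_filter.mp hn).1)
        (X := X * g p) (mul_nonneg hX hgp.1.le) hR (by
          intro e he heD
          have hpe : p ∉ e := fun h => lt_irrefl _ (mem_filter.mp (he h)).2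
          have h2 := H (insert p e) (insert_subset hp (he.trans hsubP)) (by
            rw [prod_insert hpe, pow_succ, mul_comm]
            exact Nat.mul_le_mul (hDz _ heD) hpz.le)
          rw [prod_insert hpe] at h2
          rw [filter_filter]
          have : N.filter (fun n => p ∣ n ∧ ∀ p' ∈ e, p' ∣ n) =
              N.filter (fun n => ∀ p' ∈ insert p e, p' ∣ n) := by
            apply filter_congr
            intro n _
            rw [forall_mem_insert]
          rw [this, mul_assoc]
          exact h2)
      refine h1.trans ?_
      have hVp := prod_one_sub_le_of_lt hz hpp.two_le hpz hP (fun q hq => (hg q hq).2)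
      rw [← hV] at hVp
      set Vp := ∏ p' ∈ P.filter (· < p), (1 - g p') with hVpdef
      set r := Real.log z / Real.log p with hr
      have hr1 : 1 ≤ r := by
        rw [hr, one_le_div hlp]
        exact Real.log_le_log hp0 (by exact_mod_cast hpz.le)
      have hlDp : Real.log D / (2 * Real.log p) = s * r / 2 := by
        rw [hlD, hr]; field_simp
      rw [hlDp]
      have hr3 : r ^ 2 * Real.exp (40 - s * r / 2) ≤ r⁻¹ * (6 * Real.exp (40 - s / 4)) := by
        have h3 := Real.pow_div_factorial_le_exp r (by linarith) 3
        have h4 : r ^ 3 ≤ 6 * Real.exp r := by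
          have : ((Nat.factorial 3 : ℕ) : ℝ) = 6 := by norm_num [Nat.factorial]
          rw [this, div_le_iff₀ (by norm_num)] at h3
          linarith
        rw [inv_mul_eq_div, le_div_iff₀ (by linarith)]
        calc r ^ 2 * Real.exp (40 - s * r / 2) * r = r ^ 3 * Real.exp (40 - s * r / 2) := by ring
          _ ≤ 6 * Real.exp r * Real.exp (40 - s * r / 2) := by gcongr
          _ = 6 * Real.exp (r + (40 - s * r / 2)) := by rw [Real.exp_add]; ring
          _ ≤ _ := by
              gcongr 6 * Real.exp ?_
              nlinarith
      have hmain : g p * (Vp * (2 * Real.exp (40 - s * r / 2))) ≤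
          V * Real.exp (95 - s / 4) * (Real.log p / p / Real.log z) := by
        calc g p * (Vp * (2 * Real.exp (40 - s * r / 2)))
            ≤ 2 / p * ((Real.exp 48 * r ^ 2 * V) * (2 * Real.exp (40 - s * r / 2))) := by
              have hVp0 : 0 ≤ Vp :=
                prod_nonneg fun q hq => by linarith [(hg01 q (hsubP hq)).2]
              have := hg2 p hp
              gcongr
          _ = 4 / p * Real.exp 48 * V * (r ^ 2 * Real.exp (40 - s * r / 2)) := by ring
          _ ≤ 4 / p * Real.exp 48 * V * (r⁻¹ * (6 * Real.exp (40 - s / 4))) := by gcongr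
          _ = V * (24 * (Real.exp 48 * Real.exp (40 - s / 4))) *
                (Real.log p / p / Real.log z) := by
              rw [hr]; field_simp; ring
          _ ≤ V * Real.exp (95 - s / 4) * (Real.log p / p / Real.log z) := by
              have h24 : (24 : ℝ) ≤ Real.exp 7 := by
                have := Real.add_one_le_exp (7 : ℝ)
                have h2 : Real.exp 7 = Real.exp 1 ^ 7 := by rw [← Real.exp_nat_mul]; norm_num
                have h3 : (2 : ℝ) ≤ Real.exp 1 := by linarith [Real.exp_one_gt_d9]
                calc (24 : ℝ) ≤ 2 ^ 7 := by norm_num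
                  _ ≤ Real.exp 1 ^ 7 := by gcongr
                  _ = _ := h2.symm
              have : 24 * (Real.exp 48 * Real.exp (40 - s / 4)) ≤ Real.exp (95 - s / 4) := by
                calc _ ≤ Real.exp 7 * (Real.exp 48 * Real.exp (40 - s / 4)) := by gcongr
                  _ = _ := by rw [← Real.exp_add, ← Real.exp_add]; ring_nf
              gcongr
      have := mul_le_mul_of_nonneg_left hmain hX
      nlinarith
    have hsum := sum_le_sum hterm
    rw [sum_add_distrib, sum_add_distrib, ← mul_sum, ← mul_sum, sum_const, nsmul_eq_mul] at hsum
    have hVid : V = 1 - ∑ p ∈ P, g p * ∏ p' ∈ P.filter (· < p), (1 - g p') :=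
      prod_one_sub_ordered P g
    have h0 := H ∅ (empty_subset _) (by simpa using Nat.one_le_pow _ _ (by omega))
    simp only [notMem_empty, false_implies, implies_true, filter_true, prod_empty, mul_one] at h0
    have h0' := (abs_le.mp h0).1
    have h10 := sum_log_div_prime_div_log_le hz hP
    rw [sum_sifted_eq]
    have hcard : ((#P : ℕ) : ℝ) ≤ z := by
      have : #P ≤ #(range z) := card_le_card fun p hp => mem_range.mpr (hP p hp).2
      rw [card_range] at this
      exact_mod_cast this
    have h11 : X * V * Real.exp (95 - s / 4) * ∑ p ∈ P, (Real.log p / p / Real.log z) ≤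
        Real.exp (100 - s / 4) * (X * V) := by
      have : Real.exp (95 - s / 4) * 10 ≤ Real.exp (100 - (s : ℝ) / 4) := by
        have h2 : Real.exp (100 - (s : ℝ) / 4) = Real.exp (95 - s / 4) * Real.exp 5 := by
          rw [← Real.exp_add]; ring_nf
        have h10 : (10 : ℝ) ≤ Real.exp 5 := by
          have h2 : Real.exp 5 = Real.exp 1 ^ 5 := by rw [← Real.exp_nat_mul]; norm_num
          have h3 : (2 : ℝ) ≤ Real.exp 1 := by linarith [Real.exp_one_gt_d9]
          calc (10 : ℝ) ≤ 2 ^ 5 := by norm_num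
            _ ≤ Real.exp 1 ^ 5 := by gcongr
            _ = _ := h2.symm
        rw [h2]
        gcongr
      calc _ ≤ X * V * Real.exp (95 - s / 4) * 10 := by gcongr
        _ = X * V * (Real.exp (95 - s / 4) * 10) := by ring
        _ ≤ X * V * Real.exp (100 - s / 4) := by gcongr
        _ = _ := by ring
    have h12 : #P * (R * D ^ 3) + R ≤ z ^ (3 * s + 2) * R := by
      rw [hzD]
      have hD3 : 1 ≤ D ^ 3 := one_le_pow₀ hD1
      have hz2 : (2 : ℝ) ≤ z := by exact_mod_cast hz
      calc #P * (R * D ^ 3) + R ≤ z * (R * D ^ 3) + R * D ^ 3 := by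
            have : R ≤ R * D ^ 3 := le_mul_of_one_le_right hR hD3
            gcongr
        _ = (z + 1) * (R * D ^ 3) := by ring
        _ ≤ z ^ 2 * (R * D ^ 3) := by
            have : (z : ℝ) + 1 ≤ z ^ 2 := by nlinarith
            gcongr
        _ = _ := by ring
    have h13 : X * V = X - X * ∑ p ∈ P, g p * ∏ p' ∈ P.filter (· < p), (1 - g p') := by
      nth_rewrite 1 [hVid]; ring
    linarith
  · have h1 := selberg_upper_primes hz hP hg01 (fun q hq => (hg q hq).1) hg2 hD1
      ((hrho z hz le_rfl).trans hhalf) N a ha hX hR (by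
        intro e he heD
        apply H e he
        calc _ ≤ z ^ s := hDz _ heD
          _ ≤ _ := Nat.pow_le_pow_right (by omega) (by omega))
    rw [← hV] at h1
    have h2 := hrho z hz le_rfl
    have h3 : R * D ^ 3 ≤ z ^ (3 * s + 2) * R := by
      rw [hzD]
      have : (1 : ℝ) ≤ z ^ 2 := one_le_pow₀ hz1
      nlinarith
    have h4 : X * V * (2 * Real.exp (40 - Real.log D / (2 * Real.log z))) ≤
        X * V * Real.exp (100 - s / 4) := by
      gcongr
      linarith
    nlinarith

end Linnik

namespace Linnik

open Finset

section Weighted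

variable {G : Type*} [CommGroup G] [Fintype G] [DecidableEq G]

/-- A weighted family of points in the unit interval, labelled by elements of `G`, which satisfies
an approximate form of Selberg's symmetry formula. -/
structure SelbergSystem (N : Finset ℕ) (w t : ℕ → ℝ) (cls : ℕ → G) (δ : ℝ) : Prop where
  w_nonneg : ∀ n ∈ N, 0 ≤ w n
  t_nonneg : ∀ n ∈ N, 0 ≤ t n
  mass : ∀ u : ℝ, 0 ≤ u → u ≤ 1 → |∑ n ∈ N with t n ≤ u, w n - u| ≤ δ
  symm : ∀ u : ℝ, 0 ≤ u → u ≤ 1 → ∀ b : G,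
    |Fintype.card G * (∑ n ∈ N with t n ≤ u ∧ cls n = b, w n * t n +
      ∑ x ∈ N ×ˢ N with t x.1 + t x.2 ≤ u ∧ cls x.1 * cls x.2 = b, w x.1 * w x.2) - u ^ 2| ≤ δ

/-- The normalised mass of the points with label `b` in the interval `(l, u]`. -/
noncomputable def classMass (N : Finset ℕ) (w t : ℕ → ℝ) (cls : ℕ → G) (l u : ℝ) (b : G) : ℝ :=
  Fintype.card G * ∑ n ∈ N with l < t n ∧ t n ≤ u ∧ cls n = b, w n

theorem sum_interval_split (N : Finset ℕ) (f t : ℕ → ℝ) (P : ℕ → Prop) [DecidablePred P]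
    {l v u : ℝ} (h1 : l ≤ v) (h2 : v ≤ u) :
    ∑ n ∈ N with l < t n ∧ t n ≤ u ∧ P n, f n =
      ∑ n ∈ N with l < t n ∧ t n ≤ v ∧ P n, f n + ∑ n ∈ N with v < t n ∧ t n ≤ u ∧ P n, f n := by
  rw [sum_filter, sum_filter, sum_filter, ← sum_add_distrib]
  apply sum_congr rfl
  intro n _
  by_cases hP : P n
  · simp only [hP, and_true]
    by_cases ha : t n ≤ v
    · have e1 : t n ≤ u := ha.trans h2
      have e2 : ¬ v < t n := not_lt.mpr ha
      simp [ha, e1, e2]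
    · have e1 : l < t n := by linarith [not_le.mp ha]
      have e2 : v < t n := not_le.mp ha
      simp [ha, e1, e2]
  · simp [hP]

/-- Discrete integration of a bound on masses of intervals. -/
theorem sum_mul_sub_le (N : Finset ℕ) (f t : ℕ → ℝ) (P : ℕ → Prop) [DecidablePred P]
    (hf : ∀ n ∈ N, 0 ≤ f n) {v V c e : ℝ} (hv : v ≤ V) (K : ℕ) (hK : 0 < K)
    (h : ∀ u, v ≤ u → u ≤ V → ∑ n ∈ N with v < t n ∧ t n ≤ u ∧ P n, f n ≤ c * (u - v) + e) :
    ∑ n ∈ N with v < t n ∧ t n ≤ V ∧ P n, f n * (V - t n) ≤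
      c * (V - v) ^ 2 / 2 * (1 + 1 / K) + e * (V - v) := by
  set s : ℝ := (V - v) / K with hs
  have hK0 : (0 : ℝ) < K := by exact_mod_cast hK
  have hs0 : 0 ≤ s := div_nonneg (by linarith) hK0.le
  have hKs : K * s = V - v := by rw [hs]; field_simp
  have hlayer : ∀ x : ℝ, v < x → ∀ k : ℕ, v + k * s - x ≤
      ∑ i ∈ range k, if x ≤ v + (i + 1 : ℕ) * s then s else 0 := by
    intro x hx k
    induction k with
    | zero => simp; exact hx.le
    | succ k ih =>
      rw [sum_range_succ]
      split_ifs with hc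
      · have e1 : ((k + 1 : ℕ) : ℝ) * s = k * s + s := by push_cast; ring
        rw [e1]; linarith
      · have : 0 ≤ ∑ i ∈ range k, if x ≤ v + (i + 1 : ℕ) * s then s else 0 :=
          sum_nonneg fun i _ => by split_ifs <;> simp [hs0]
        linarith
  have h1 : ∑ n ∈ N with v < t n ∧ t n ≤ V ∧ P n, f n * (V - t n) ≤
      ∑ n ∈ N with v < t n ∧ t n ≤ V ∧ P n,
        ∑ i ∈ range K, if t n ≤ v + (i + 1 : ℕ) * s then f n * s else 0 := by
    apply sum_le_sum
    intro n hn
    rw [mem_filter] at hn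
    have h2 := hlayer (t n) hn.2.1 K
    have h3 := mul_le_mul_of_nonneg_left h2 (hf n hn.1)
    rw [mul_sum] at h3
    simp only [mul_ite, mul_zero] at h3
    have h4 : V = v + K * s := by linarith
    rw [h4]
    exact h3
  rw [sum_comm] at h1
  have h2 : ∀ i ∈ range K, ∑ n ∈ N with v < t n ∧ t n ≤ V ∧ P n,
      (if t n ≤ v + (i + 1 : ℕ) * s then f n * s else 0) ≤ (c * ((i + 1 : ℕ) * s) + e) * s := by
    intro i hi
    have hiK : ((i + 1 : ℕ) : ℝ) ≤ K := by exact_mod_cast mem_range.mp hi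
    have hle : v + (i + 1 : ℕ) * s ≤ V := by
      have := mul_le_mul_of_nonneg_right hiK hs0
      linarith
    have h3 := h (v + (i + 1 : ℕ) * s) (by
      have : 0 ≤ ((i + 1 : ℕ) : ℝ) * s := by positivity
      linarith) hle
    rw [← sum_filter, filter_filter, ← sum_mul]
    apply mul_le_mul_of_nonneg_right _ hs0
    rw [add_sub_cancel_left] at h3
    refine le_trans (le_of_eq ?_) h3
    apply sum_congr _ (fun _ _ => rfl)
    apply filter_congr
    intro n _
    exact ⟨fun h => ⟨h.1.1, h.2, h.1.2.2⟩, fun h => ⟨⟨h.1, h.2.1.trans hle, h.2.2⟩, h.2.1⟩⟩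
  refine h1.trans ((sum_le_sum h2).trans (le_of_eq ?_))
  have h3 : ∀ k : ℕ, ∑ i ∈ range k, (c * ((i + 1 : ℕ) * s) + e) * s =
      c * s ^ 2 * (k * (k + 1)) / 2 + e * s * k := by
    intro k
    induction k with
    | zero => simp
    | succ k ih => rw [sum_range_succ, ih]; push_cast; ring
  rw [h3, ← hKs]
  field_simp

variable {N : Finset ℕ} {w t : ℕ → ℝ} {cls : ℕ → G} {δ : ℝ}

theorem classMass_nonneg (hw : ∀ n ∈ N, 0 ≤ w n) (l u : ℝ) (b : G) :
    0 ≤ classMass N w t cls l u b :=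
  mul_nonneg (by positivity) (sum_nonneg fun n hn => hw n (mem_filter.mp hn).1)

theorem classMass_split {l v u : ℝ} (h1 : l ≤ v) (h2 : v ≤ u) (b : G) :
    classMass N w t cls l u b = classMass N w t cls l v b + classMass N w t cls v u b := by
  rw [classMass, classMass, classMass, ← mul_add]
  congr 1
  exact sum_interval_split N w t (fun n => cls n = b) h1 h2

namespace SelbergSystem

theorem classMass_short (hS : SelbergSystem N w t cls δ) {v u : ℝ} (hv : 0 < v) (hvu : v ≤ u)
    (hu : u ≤ 1) (b : G) :
    classMass N w t cls v u b ≤ 2 * (u - v) + ((u - v) ^ 2 + 2 * δ) / v := by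
  have h1 := (abs_le.mp (hS.symm u (by linarith) hu b)).2
  have h2 := (abs_le.mp (hS.symm v hv.le (by linarith) b)).1
  set Q : ℝ := ((Fintype.card G : ℕ) : ℝ) with hQ
  have hQ0 : 0 ≤ Q := by positivity
  have h3 : ∑ x ∈ N ×ˢ N with t x.1 + t x.2 ≤ v ∧ cls x.1 * cls x.2 = b, w x.1 * w x.2 ≤
      ∑ x ∈ N ×ˢ N with t x.1 + t x.2 ≤ u ∧ cls x.1 * cls x.2 = b, w x.1 * w x.2 := by
    apply sum_le_sum_of_subset_of_nonneg
    · intro x hx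
      rw [mem_filter] at hx ⊢
      exact ⟨hx.1, hx.2.1.trans hvu, hx.2.2⟩
    · intro x hx _
      have := mem_product.mp (mem_filter.mp hx).1
      exact mul_nonneg (hS.w_nonneg _ this.1) (hS.w_nonneg _ this.2)
  have h4 : ∑ n ∈ N with t n ≤ u ∧ cls n = b, w n * t n =
      ∑ n ∈ N with t n ≤ v ∧ cls n = b, w n * t n +
      ∑ n ∈ N with v < t n ∧ t n ≤ u ∧ cls n = b, w n * t n := by
    have := sum_interval_split N (fun n => w n * t n) t (fun n => cls n = b)
      (l := -1) (v := v) (u := u) (by linarith) hvu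
    have e : ∀ u', N.filter (fun n => -1 < t n ∧ t n ≤ u' ∧ cls n = b) =
        N.filter (fun n => t n ≤ u' ∧ cls n = b) := by
      intro u'
      apply filter_congr
      intro n hn
      have := hS.t_nonneg n hn
      exact ⟨fun h => h.2, fun h => ⟨by linarith, h⟩⟩
    rwa [e, e] at this
  have h5 : v * classMass N w t cls v u b ≤
      Q * ∑ n ∈ N with v < t n ∧ t n ≤ u ∧ cls n = b, w n * t n := by
    rw [classMass, mul_left_comm, mul_sum]
    apply mul_le_mul_of_nonneg_left _ hQ0
    apply sum_le_sum
    intro n hn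
    rw [mem_filter] at hn
    rw [mul_comm]
    exact mul_le_mul_of_nonneg_left hn.2.1.le (hS.w_nonneg n hn.1)
  rw [h4] at h1
  have h6 := mul_le_mul_of_nonneg_left h3 hQ0
  have h7 : v * classMass N w t cls v u b ≤ u ^ 2 - v ^ 2 + 2 * δ := by nlinarith
  rw [mul_comm, ← le_div_iff₀ hv] at h7
  refine h7.trans (le_of_eq ?_)
  field_simp
  ring

theorem classMass_le (hS : SelbergSystem N w t cls δ) {m : ℕ} (hm : 0 < m)
    (hδ : δ ≤ 1 / (m : ℝ) ^ 4) {v u : ℝ} (hv : 1 / (m : ℝ) ≤ v) (hvu : v ≤ u)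
    (hu : u ≤ 1) (b : G) :
    classMass N w t cls v u b ≤ 2 * (u - v) + 3 / m := by
  have hm0 : (0 : ℝ) < m := by exact_mod_cast hm
  have hv0 : 0 < v := lt_of_lt_of_le (by positivity) hv
  set s : ℝ := (u - v) / (m : ℝ) ^ 2 with hs
  have hs0 : 0 ≤ s := div_nonneg (by linarith) (by positivity)
  have hss : (m : ℝ) ^ 2 * s = u - v := by rw [hs]; field_simp
  have hs1 : s ≤ 1 / (m : ℝ) ^ 2 := by
    rw [hs]; gcongr; linarith [hv0.le]
  have key : ∀ k : ℕ, k ≤ m ^ 2 → classMass N w t cls v (v + k * s) b ≤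
      k * (2 * s + 3 / (m : ℝ) ^ 3) := by
    intro k
    induction k with
    | zero =>
      intro _
      rw [classMass, filter_false_of_mem]
      · simp
      · intro n _ h
        simp only [CharP.cast_eq_zero, zero_mul, add_zero] at h
        linarith [h.1, h.2.1]
    | succ k ih =>
      intro hk
      have hk' : ((k + 1 : ℕ) : ℝ) ≤ (m : ℝ) ^ 2 := by exact_mod_cast hk
      have hks : 0 ≤ (k : ℝ) * s := by positivity
      have hle : v + ((k + 1 : ℕ) : ℝ) * s ≤ 1 := by
        have := mul_le_mul_of_nonneg_right hk' hs0
        linarith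
      have hle2 : v + (k : ℝ) * s ≤ v + ((k + 1 : ℕ) : ℝ) * s := by push_cast; linarith
      rw [classMass_split (v := v + k * s) (by linarith) hle2]
      have h1 := hS.classMass_short (v := v + k * s) (by linarith) hle2 hle b
      have h2 := ih (by omega)
      have e : v + ((k + 1 : ℕ) : ℝ) * s - (v + k * s) = s := by push_cast; ring
      rw [e] at h1
      have h3 : (s ^ 2 + 2 * δ) / (v + k * s) ≤ 3 / (m : ℝ) ^ 3 := by
        rw [div_le_div_iff₀ (by linarith) (by positivity)]
        have h4 : s ^ 2 + 2 * δ ≤ 3 / (m : ℝ) ^ 4 := by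
          have : s ^ 2 ≤ (1 / (m : ℝ) ^ 2) ^ 2 := by gcongr
          have e2 : (1 / (m : ℝ) ^ 2) ^ 2 = 1 / (m : ℝ) ^ 4 := by field_simp
          have e3 : 3 / (m : ℝ) ^ 4 = 1 / (m : ℝ) ^ 4 + 2 * (1 / (m : ℝ) ^ 4) := by ring
          linarith
        calc (s ^ 2 + 2 * δ) * (m : ℝ) ^ 3 ≤ 3 / (m : ℝ) ^ 4 * (m : ℝ) ^ 3 := by gcongr
          _ = 3 * (1 / (m : ℝ)) := by field_simp
          _ ≤ 3 * (v + k * s) := by linarith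
      have e1 : ((k + 1 : ℕ) : ℝ) * (2 * s + 3 / (m : ℝ) ^ 3) =
          k * (2 * s + 3 / (m : ℝ) ^ 3) + (2 * s + 3 / (m : ℝ) ^ 3) := by push_cast; ring
      rw [e1]
      linarith
  have h1 := key (m ^ 2) le_rfl
  push_cast at h1
  rw [hss] at h1
  have e : v + (u - v) = u := by ring
  rw [e] at h1
  refine h1.trans (le_of_eq ?_)
  rw [mul_add, mul_left_comm, hss]
  field_simp

theorem sum_mass (hS : SelbergSystem N w t cls δ) {v u : ℝ} (hv : 0 ≤ v) (hvu : v ≤ u)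
    (hu : u ≤ 1) : |∑ n ∈ N with v < t n ∧ t n ≤ u, w n - (u - v)| ≤ 2 * δ := by
  have h1 := hS.mass v hv (hvu.trans hu)
  have h2 := hS.mass u (hv.trans hvu) hu
  have h3 : ∑ n ∈ N with t n ≤ u, w n = ∑ n ∈ N with t n ≤ v, w n +
      ∑ n ∈ N with v < t n ∧ t n ≤ u, w n := by
    have := sum_interval_split N w t (fun _ => True)
      (l := -1) (v := v) (u := u) (by linarith) hvu
    simp only [and_true] at this
    have e : ∀ u', N.filter (fun n => -1 < t n ∧ t n ≤ u') =
        N.filter (fun n => t n ≤ u') := by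
      intro u'
      apply filter_congr
      intro n hn
      have := hS.t_nonneg n hn
      exact ⟨fun h => h.2, fun h => ⟨by linarith, h⟩⟩
    rwa [e, e] at this
  rw [abs_le] at *
  constructor <;> linarith [h1.1, h1.2, h2.1, h2.2]

theorem _root_.Linnik.sum_classMass (l u : ℝ) :
    ∑ b : G, classMass N w t cls l u b =
      Fintype.card G * ∑ n ∈ N with l < t n ∧ t n ≤ u, w n := by
  simp only [classMass]
  rw [← mul_sum]
  congr 1
  rw [← sum_fiberwise (N.filter fun n => l < t n ∧ t n ≤ u) cls]
  apply sum_congr rfl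
  intro b _
  rw [filter_filter]
  apply sum_congr _ (fun _ _ => rfl)
  apply filter_congr
  intro n _
  tauto

theorem sum_classMass_near (hS : SelbergSystem N w t cls δ) {v u : ℝ} (hv : 0 ≤ v) (hvu : v ≤ u)
    (hu : u ≤ 1) : |(∑ b : G, classMass N w t cls v u b) / Fintype.card G - (u - v)| ≤ 2 * δ := by
  rw [sum_classMass]
  have : (Fintype.card G : ℝ) ≠ 0 := by exact_mod_cast Fintype.card_ne_zero
  rw [mul_div_cancel_left₀ _ this]
  exact hS.sum_mass hv hvu hu

end SelbergSystem

end Weighted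

end Linnik

namespace Linnik

open Finset
open scoped BigOperators ComplexConjugate

section Fourier

variable {G : Type*} [CommGroup G] [Fintype G] [DecidableEq G]

theorem norm_hom_eq_one (ψ : G →* ℂ) (g : G) : ‖ψ g‖ = 1 := by
  apply Complex.norm_eq_one_of_pow_eq_one (n := Fintype.card G) _ Fintype.card_ne_zero
  rw [← map_pow, pow_card_eq_one, map_one]

theorem hom_inv_eq_conj (ψ : G →* ℂ) (g : G) : ψ g⁻¹ = conj (ψ g) := by
  have h1 : ψ g⁻¹ * ψ g = 1 := by rw [← map_mul, inv_mul_cancel, map_one]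
  have h2 : conj (ψ g) * ψ g = 1 := by
    rw [mul_comm, Complex.mul_conj, Complex.normSq_eq_norm_sq, norm_hom_eq_one]; simp
  have h3 : ψ g ≠ 0 := by
    intro h; rw [h, mul_zero] at h1; exact zero_ne_one h1
  exact mul_right_cancel₀ h3 (h1.trans h2.symm)

variable {ι : Type*} [Fintype ι] (ψ : ι → G →* ℂ)

theorem sum_norm_sq_transform
    (orth : ∀ g, ∑ i, ψ i g = if g = 1 then (Fintype.card G : ℂ) else 0) (h : G → ℝ) :
    ∑ i, ‖∑ g, (h g : ℂ) * ψ i g‖ ^ 2 = Fintype.card G * ∑ g, h g ^ 2 := by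
  have key : ∑ i, (∑ g, (h g : ℂ) * ψ i g) * conj (∑ g, (h g : ℂ) * ψ i g) =
      Fintype.card G * ∑ g, (h g : ℂ) ^ 2 := by
    simp only [map_sum, map_mul, Complex.conj_ofReal, ← hom_inv_eq_conj, sum_mul_sum]
    rw [sum_comm, mul_sum]
    apply sum_congr rfl
    intro g _
    rw [sum_comm]
    have : ∀ k ∈ (univ : Finset G), ∑ i, (h g : ℂ) * ψ i g * (h k * ψ i k⁻¹) =
        if k = g then (Fintype.card G : ℂ) * h g ^ 2 else 0 := by
      intro k _
      have e : ∀ i, (h g : ℂ) * ψ i g * (h k * ψ i k⁻¹) = h g * h k * ψ i (g * k⁻¹) := by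
        intro i; rw [map_mul]; ring
      simp only [e]
      rw [← mul_sum, orth]
      by_cases hk : k = g
      · simp [hk]; ring
      · have : ¬ g * k⁻¹ = 1 := fun h => hk (mul_inv_eq_one.mp h).symm
        simp [hk, this]
    rw [sum_congr rfl this]
    simp
  have h2 : ((∑ i, ‖∑ g, (h g : ℂ) * ψ i g‖ ^ 2 : ℝ) : ℂ) =
      ((Fintype.card G * ∑ g, h g ^ 2 : ℝ) : ℂ) := by
    push_cast
    rw [← key]
    apply sum_congr rfl
    intro i _
    rw [Complex.mul_conj, Complex.normSq_eq_norm_sq]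
    push_cast
    rfl
  exact_mod_cast h2

theorem sum_cube_transform
    (orth : ∀ g, ∑ i, ψ i g = if g = 1 then (Fintype.card G : ℂ) else 0) (h : G → ℝ) :
    ∑ i, ‖∑ g, (h g : ℂ) * ψ i g‖ ^ 2 * (∑ g, (h g : ℂ) * ψ i g).re =
      Fintype.card G * ∑ g, ∑ k, h g * h k * h (g * k) := by
  have key : ∑ i, conj (∑ g, (h g : ℂ) * ψ i g) * ((∑ g, (h g : ℂ) * ψ i g) *
      (∑ g, (h g : ℂ) * ψ i g)) =
      Fintype.card G * ∑ g, ∑ k, (h g : ℂ) * h k * h (g * k) := by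
    simp only [map_sum, map_mul, Complex.conj_ofReal, ← hom_inv_eq_conj, sum_mul_sum]
    have e : ∀ i, ∑ l, ∑ g, (h l : ℂ) * ψ i l⁻¹ * ∑ k, (h g : ℂ) * ψ i g * (h k * ψ i k) =
        ∑ g, ∑ k, ∑ l, (h g : ℂ) * h k * h l * ψ i (g * k * l⁻¹) := by
      intro i
      simp only [mul_sum]
      rw [sum_comm]
      apply sum_congr rfl
      intro g _
      rw [sum_comm]
      apply sum_congr rfl
      intro k _
      apply sum_congr rfl
      intro l _
      rw [map_mul, map_mul]; ring
    simp only [e]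
    rw [sum_comm, mul_sum]
    apply sum_congr rfl
    intro g _
    rw [sum_comm, mul_sum]
    apply sum_congr rfl
    intro k _
    rw [sum_comm]
    have : ∀ l ∈ (univ : Finset G), ∑ i, (h g : ℂ) * h k * h l * ψ i (g * k * l⁻¹) =
        if l = g * k then (Fintype.card G : ℂ) * (h g * h k * h (g * k)) else 0 := by
      intro l _
      rw [← mul_sum, orth]
      by_cases hk : l = g * k
      · simp [hk]; ring
      · have : ¬ g * k * l⁻¹ = 1 := fun h => hk (mul_inv_eq_one.mp h).symm
        simp [hk, this]
    rw [sum_congr rfl this]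
    simp
  have h3 := congrArg Complex.re key
  have h4 : ((Fintype.card G : ℂ) * ∑ g, ∑ k, (h g : ℂ) * h k * h (g * k)) =
      ((Fintype.card G * ∑ g, ∑ k, h g * h k * h (g * k) : ℝ) : ℂ) := by push_cast; rfl
  rw [h4, Complex.ofReal_re, Complex.re_sum] at h3
  rw [← h3]
  apply sum_congr rfl
  intro i _
  rw [← mul_assoc, mul_comm (conj _), Complex.mul_conj, Complex.re_ofReal_mul,
    Complex.normSq_eq_norm_sq]

/-- If the cubic correlation of `h` is nearly as large as possible then `h` correlates with a
character. -/
theorem exists_large_transform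
    (orth : ∀ g, ∑ i, ψ i g = if g = 1 then (Fintype.card G : ℂ) else 0) (h : G → ℝ) {A c : ℝ}
    (hA : 0 < A) (hc : 0 < c) (h2 : 𝔼 g, h g ^ 2 ≤ A)
    (h3 : c * A ≤ 𝔼 g, 𝔼 k, h g * h k * h (g * k)) :
    ∃ i, c ≤ 𝔼 g, h g * (ψ i g).re := by
  have hQ : (0 : ℝ) < Fintype.card G := by exact_mod_cast Fintype.card_pos
  simp only [Fintype.expect_eq_sum_div_card] at h2 h3 ⊢
  rw [← sum_div, div_div, le_div_iff₀ (by positivity)] at h3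
  rw [div_le_iff₀ hQ] at h2
  have e2 := sum_norm_sq_transform ψ orth h
  have e3 := sum_cube_transform ψ orth h
  by_contra hcon
  push Not at hcon
  have hre : ∀ i, (∑ g, (h g : ℂ) * ψ i g).re = ∑ g, h g * (ψ i g).re := by
    intro i
    rw [Complex.re_sum]
    exact sum_congr rfl fun g _ => Complex.re_ofReal_mul _ _
  set Q : ℝ := ((Fintype.card G : ℕ) : ℝ)
  have hlt : ∀ i, (∑ g, (h g : ℂ) * ψ i g).re < c * Q := by
    intro i
    rw [hre, ← div_lt_iff₀ hQ]
    exact hcon i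
  have h5 : ∑ i, ‖∑ g, (h g : ℂ) * ψ i g‖ ^ 2 * (∑ g, (h g : ℂ) * ψ i g).re <
      ∑ i, ‖∑ g, (h g : ℂ) * ψ i g‖ ^ 2 * (c * Q) := by
    apply sum_lt_sum
    · intro i _
      exact mul_le_mul_of_nonneg_left (hlt i).le (by positivity)
    · by_contra hall
      push Not at hall
      have hz : ∀ i ∈ (univ : Finset ι),
          ‖∑ g, (h g : ℂ) * ψ i g‖ ^ 2 * (∑ g, (h g : ℂ) * ψ i g).re = 0 := by
        intro i hi
        have h6 := hall i hi
        by_cases h0 : ‖∑ g, (h g : ℂ) * ψ i g‖ = 0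
        · simp [h0]
        · have : 0 < ‖∑ g, (h g : ℂ) * ψ i g‖ ^ 2 := by positivity
          exact absurd (mul_lt_mul_of_pos_left (hlt i) this) (not_lt.mpr h6)
      rw [sum_eq_zero hz] at e3
      have : 0 < c * A * (Q * Q) := by positivity
      have h7 : 0 < ∑ g, ∑ k, h g * h k * h (g * k) := by linarith
      have := mul_pos hQ h7
      linarith
  rw [← sum_mul, e2, e3] at h5
  have h6 : Q * (∑ g, h g ^ 2) * (c * Q) ≤ Q * (A * Q) * (c * Q) := by gcongr
  have h7 := mul_le_mul_of_nonneg_left h3 hQ.le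
  nlinarith

/-- A function whose cubic correlation is nearly maximal and whose mean is small is close to a
real nontrivial character. -/
theorem exists_close_real_character
    (orth : ∀ g, ∑ i, ψ i g = if g = 1 then (Fintype.card G : ℂ) else 0) (h : G → ℝ) {κ : ℝ}
    (hκ0 : 0 < κ) (hκ : κ ≤ 1 / 10) (h1 : 𝔼 g, h g < 1 - κ) (h2 : 𝔼 g, h g ^ 2 ≤ 1 + κ / 2)
    (h3 : 1 - κ / 2 ≤ 𝔼 g, 𝔼 k, h g * h k * h (g * k)) :
    ∃ i, (∀ g, ψ i g = 1 ∨ ψ i g = -1) ∧ (∃ g, ψ i g ≠ 1) ∧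
      𝔼 g, (h g - (ψ i g).re) ^ 2 ≤ 3 * κ := by
  obtain ⟨i, hi⟩ := exists_large_transform ψ orth h (A := 1 + κ / 2) (c := 1 - κ)
    (by linarith) (by linarith) h2 (by nlinarith)
  have hunit : ∀ g, (ψ i g).re ^ 2 + (ψ i g).im ^ 2 = 1 := by
    intro g
    have h1 := norm_hom_eq_one (ψ i) g
    have h2 := Complex.sq_norm (ψ i g)
    rw [h1, Complex.normSq_apply] at h2
    linarith
  have hexp : 𝔼 g, ((h g - (ψ i g).re) ^ 2 + (ψ i g).im ^ 2) =
      𝔼 g, h g ^ 2 - 2 * 𝔼 g, h g * (ψ i g).re + 1 := by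
    have e : ∀ g, (h g - (ψ i g).re) ^ 2 + (ψ i g).im ^ 2 =
        h g ^ 2 - 2 * (h g * (ψ i g).re) + 1 := by
      intro g; linear_combination hunit g
    simp only [e]
    rw [expect_add_distrib, expect_sub_distrib, ← mul_expect, Fintype.expect_const]
  have hsmall : 𝔼 g, ((h g - (ψ i g).re) ^ 2 + (ψ i g).im ^ 2) ≤ 3 * κ := by
    rw [hexp]; linarith
  rw [expect_add_distrib] at hsmall
  have hp1 : 0 ≤ 𝔼 g, (h g - (ψ i g).re) ^ 2 := expect_nonneg fun g _ => sq_nonneg _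
  have hp2 : 0 ≤ 𝔼 g, (ψ i g).im ^ 2 := expect_nonneg fun g _ => sq_nonneg _
  have hsq : ψ i ^ 2 = 1 := by
    by_contra hne
    have hs := sum_hom_units_eq_zero (ψ i ^ 2) hne
    have hs2 := congrArg Complex.re hs
    rw [Complex.re_sum, Complex.zero_re] at hs2
    have e : ∀ g, ((ψ i ^ 2) g).re = 1 - 2 * (ψ i g).im ^ 2 := by
      intro g
      rw [MonoidHom.pow_apply, sq, Complex.mul_re]
      linear_combination hunit g
    simp only [e] at hs2
    have : 𝔼 g, (1 - 2 * (ψ i g).im ^ 2) = 0 := by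
      rw [Fintype.expect_eq_sum_div_card, hs2, zero_div]
    rw [expect_sub_distrib, ← mul_expect, Fintype.expect_const] at this
    linarith
  refine ⟨i, ?_, ?_, by linarith⟩
  · intro g
    have : (ψ i g) ^ 2 = 1 := by
      rw [← MonoidHom.pow_apply, hsq, MonoidHom.one_apply]
    exact sq_eq_one_iff.mp this
  · by_contra hall
    push Not at hall
    simp only [hall, Complex.one_re, mul_one] at hi
    linarith

end Fourier

end Linnik

namespace Linnik

open Finset
open scoped BigOperators

section Functional

variable {G : Type*} [CommGroup G] [Fintype G] [DecidableEq G]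

theorem expect_div_left (a : G) (f : G → ℝ) : 𝔼 g, f (a / g) = 𝔼 g, f g :=
  Fintype.expect_equiv (Equiv.divLeft a) _ _ fun _ => rfl

variable {ι : Type*} [Fintype ι] (ψ : ι → G →* ℂ)

theorem cubic_correlation_le {F J : G → ℝ} {η : ℝ} {a : G} (hη0 : 0 < η)
    (hF0 : ∀ g, 0 ≤ F g)
    (hJ0 : ∀ g, 0 ≤ J g) (hEF : 𝔼 g, F g ≤ 1 / 2) (hEJ' : 𝔼 g, J g ≤ 1 / 4)
    (hFF : 1 / 2 - 8 * η ≤ 𝔼 g, F g * F (a / g)) (hFJ : ∀ g, F g ≤ J g + 1 / 2 + 3 * η)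
    (hJJ : ∀ g, 𝔼 h, J h * J (g / h) ≤ 1 / 2 - F g / 2 + 3 * η) :
    1 / 2 - 8 * η ≤ 𝔼 g, F g ^ 2 ∧ 𝔼 g, 𝔼 h, J g * J h * J (g * h) ≤ 7 * η := by
  have hsq : 1 / 2 - 8 * η ≤ 𝔼 g, F g ^ 2 := by
    have h1 : 𝔼 g, F g * F (a / g) ≤ 𝔼 g, (F g ^ 2 / 2 + F (a / g) ^ 2 / 2) :=
      expect_le_expect fun g _ => by nlinarith [sq_nonneg (F g - F (a / g))]
    rw [expect_add_distrib, ← expect_div, ← expect_div,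
      expect_div_left a (fun g => F g ^ 2)] at h1
    linarith
  refine ⟨hsq, ?_⟩
  have hreindex : 𝔼 g, 𝔼 h, J g * J h * J (g * h) = 𝔼 g, J g * 𝔼 h, J h * J (g / h) := by
    simp only [mul_expect]
    rw [expect_comm, expect_comm (f := fun g h => J g * (J h * J (g / h)))]
    apply expect_congr rfl
    intro h _
    refine Fintype.expect_equiv (Equiv.mulRight h) _ _ fun g => ?_
    simp only [Equiv.coe_mulRight, mul_div_cancel_right]
    ring
  have h1 : 𝔼 g, J g * 𝔼 h, J h * J (g / h) ≤ 𝔼 g, ((1 / 2 + 3 * η) * J g - J g * F g / 2) :=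
    expect_le_expect fun g _ => by
      have := mul_le_mul_of_nonneg_left (hJJ g) (hJ0 g)
      linarith
  rw [expect_sub_distrib, ← mul_expect, ← expect_div] at h1
  have h2 : 𝔼 g, (F g ^ 2 - (1 / 2 + 3 * η) * F g) ≤ 𝔼 g, J g * F g :=
    expect_le_expect fun g _ => by
      have := mul_le_mul_of_nonneg_right (hFJ g) (hF0 g)
      linarith
  rw [expect_sub_distrib, ← mul_expect] at h2
  rw [hreindex]
  have h3 : (1 / 2 + 3 * η) * 𝔼 g, F g ≤ (1 / 2 + 3 * η) * (1 / 2) := by gcongr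
  have h4 : (1 / 2 + 3 * η) * 𝔼 g, J g ≤ (1 / 2 + 3 * η) * (1 / 4) := by gcongr
  linarith

/-- The extraction of a real character from the limiting inequalities. -/
theorem exists_real_character_of_functions
    (orth : ∀ g, ∑ i, ψ i g = if g = 1 then (Fintype.card G : ℂ) else 0)
    {F J : G → ℝ} {r : ℝ} {a : G} (hr0 : 0 < r) (hr : r ≤ 1 / 1000) (hF0 : ∀ g, 0 ≤ F g)
    (hF : ∀ g, F g ≤ 1 + r ^ 2) (hJ0 : ∀ g, 0 ≤ J g) (hJ : ∀ g, J g ≤ 1 / 2 + r ^ 2)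
    (hEF : 𝔼 g, F g ≤ 1 / 2) (hEJ : 1 / 4 - 2 * r ^ 2 ≤ 𝔼 g, J g) (hEJ' : 𝔼 g, J g ≤ 1 / 4)
    (hFF : 1 / 2 - 8 * r ^ 2 ≤ 𝔼 g, F g * F (a / g)) (hFJ : ∀ g, F g ≤ J g + 1 / 2 + 3 * r ^ 2)
    (hJJ : ∀ g, 𝔼 h, J h * J (g / h) ≤ 1 / 2 - F g / 2 + 3 * r ^ 2) :
    ∃ i, (∀ g, ψ i g = 1 ∨ ψ i g = -1) ∧ (∃ g, ψ i g ≠ 1) ∧ ψ i a = 1 ∧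
      𝔼 g, (if ψ i g = 1 then J g else 0) ≤ 14 * r := by
  have hη : r ^ 2 ≤ 1 / 1000000 := by nlinarith
  have hη0 : 0 < r ^ 2 := by positivity
  obtain ⟨hsq, hT⟩ := cubic_correlation_le hη0 hF0 hJ0 hEF hEJ' hFF hFJ hJJ
  set E : ℝ := 𝔼 g, J g with hE
  have h1 : 𝔼 g, (1 - 4 * J g) = 1 - 4 * E := by
    rw [expect_sub_distrib, ← mul_expect, Fintype.expect_const]
  have h2 : 𝔼 g, (1 - 4 * J g) ^ 2 ≤ 1 + 16 * r ^ 2 := by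
    have h3 : 𝔼 g, (1 - 4 * J g) ^ 2 ≤ 𝔼 g, (1 + 16 * r ^ 2 * J g) :=
      expect_le_expect fun g _ => by
        have := mul_le_mul_of_nonneg_left (hJ g) (hJ0 g)
        linarith
    rw [expect_add_distrib, ← mul_expect, Fintype.expect_const] at h3
    nlinarith
  have h3 : 𝔼 g, 𝔼 k, (1 - 4 * J g) * (1 - 4 * J k) * (1 - 4 * J (g * k)) =
      1 - 12 * E + 48 * E ^ 2 - 64 * 𝔼 g, 𝔼 k, J g * J k * J (g * k) := by
    have e : ∀ g k, (1 - 4 * J g) * (1 - 4 * J k) * (1 - 4 * J (g * k)) =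
        1 - 4 * J g - 4 * J k - 4 * J (g * k) + 16 * (J g * J k) + 16 * (J g * J (g * k)) +
        16 * (J k * J (g * k)) - 64 * (J g * J k * J (g * k)) := by intros; ring
    have t1 : 𝔼 g, 𝔼 k, J (g * k) = E := by
      have : ∀ g, 𝔼 k, J (g * k) = E := fun g =>
        Fintype.expect_equiv (Equiv.mulLeft g) _ _ fun _ => rfl
      simp only [this, Fintype.expect_const]
    have t2 : 𝔼 g, 𝔼 k, J g * J k = E ^ 2 := by
      simp only [← mul_expect, ← expect_mul]; rw [sq]
    have t3 : 𝔼 g, 𝔼 k, J g * J (g * k) = E ^ 2 := by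
      have : ∀ g, 𝔼 k, J (g * k) = E := fun g =>
        Fintype.expect_equiv (Equiv.mulLeft g) _ _ fun _ => rfl
      simp only [← mul_expect, this, ← expect_mul]; rw [sq]
    have t4 : 𝔼 g, 𝔼 k, J k * J (g * k) = E ^ 2 := by
      have : ∀ k, 𝔼 g, J (g * k) = E := fun k =>
        Fintype.expect_equiv (Equiv.mulRight k) _ _ fun _ => rfl
      rw [expect_comm]
      simp only [← mul_expect, this, ← expect_mul]; rw [sq]
    have t5 : 𝔼 g, 𝔼 _k : G, 4 * J g = 4 * E := by
      simp only [Fintype.expect_const, ← mul_expect]; rw [hE]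
    have t6 : 𝔼 _g : G, 𝔼 k, 4 * J k = 4 * E := by
      simp only [Fintype.expect_const, ← mul_expect]; rw [hE]
    have l1 : 𝔼 g, 𝔼 k, 4 * J (g * k) = 4 * E := by rw [← t1]; simp only [mul_expect]
    have l2 : 𝔼 g, 𝔼 k, 16 * (J g * J k) = 16 * E ^ 2 := by rw [← t2]; simp only [mul_expect]
    have l3 : 𝔼 g, 𝔼 k, 16 * (J g * J (g * k)) = 16 * E ^ 2 := by
      rw [← t3]; simp only [mul_expect]
    have l4 : 𝔼 g, 𝔼 k, 16 * (J k * J (g * k)) = 16 * E ^ 2 := by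
      rw [← t4]; simp only [mul_expect]
    have l5 : 𝔼 g, 𝔼 k, 64 * (J g * J k * J (g * k)) =
        64 * 𝔼 g, 𝔼 k, J g * J k * J (g * k) := by simp only [mul_expect]
    simp only [e, expect_add_distrib, expect_sub_distrib]
    rw [t5, t6, l1, l2, l3, l4, l5]
    simp only [Fintype.expect_const]
    ring
  obtain ⟨i, hi1, hi2, hi3⟩ := exists_close_real_character ψ orth (fun g => 1 - 4 * J g)
    (κ := 1000 * r ^ 2) (by positivity) (by linarith) (by rw [h1]; linarith) (by linarith) (by
      rw [h3]
      have e1 : 0 ≤ 1 - 4 * E := by linarith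
      have e2 : 1 - 4 * E ≤ 8 * r ^ 2 := by linarith
      have e3 : 1 - 12 * E + 48 * E ^ 2 - 64 * E ^ 3 = (1 - 4 * E) ^ 3 := by ring
      have e4 : 0 ≤ (1 - 4 * E) ^ 3 := by positivity
      have e5 : (1 - 8 * r ^ 2) ^ 3 ≤ (4 * E) ^ 3 := by gcongr <;> linarith
      nlinarith)
  have hone : ∀ g, (ψ i g).re = if ψ i g = 1 then 1 else -1 := by
    intro g
    rcases hi1 g with h | h <;> simp [h]
    norm_num
  set D : ℝ := 𝔼 g, (if ψ i g = 1 then J g else 0) with hD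
  have hD0 : 0 ≤ D := expect_nonneg fun g _ => by split_ifs <;> simp [hJ0]
  have hDle : D ≤ 14 * r := by
    have h4 : (𝔼 g, (if ψ i g = 1 then J g else 0) * 1) ^ 2 ≤
        (𝔼 g, (if ψ i g = 1 then J g else 0) ^ 2) * 𝔼 g : G, (1 : ℝ) ^ 2 :=
      expect_mul_sq_le_sq_mul_sq _ _ _
    simp only [mul_one, one_pow, Fintype.expect_const] at h4
    have h5 : 𝔼 g, (if ψ i g = 1 then J g else 0) ^ 2 ≤
        𝔼 g, (1 - 4 * J g - (ψ i g).re) ^ 2 / 16 := expect_le_expect fun g _ => by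
      rw [hone]
      split_ifs
      · linarith
      · rw [zero_pow two_ne_zero]; positivity
    rw [← expect_div] at h5
    rw [← hD] at h4
    nlinarith
  refine ⟨i, hi1, hi2, ?_, hDle⟩
  by_contra ha
  have ha' : ψ i a = -1 := (hi1 a).resolve_left ha
  set A : ℝ := 𝔼 g, (if ψ i g = 1 then F g else 0) with hA
  have hA0 : 0 ≤ A := expect_nonneg fun g _ => by split_ifs <;> simp [hF0]
  have h6 : (1 / 2 - 2 * r ^ 2) * A - (1 + r ^ 2) * D ≤ 𝔼 g, ((1 + r ^ 2) * F g - F g ^ 2) := by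
    rw [hA, hD, mul_expect, mul_expect, ← expect_sub_distrib]
    refine expect_le_expect fun g _ => ?_
    have e1 := mul_nonneg (hF0 g) (sub_nonneg.mpr (hF g))
    split_ifs
    · have e2 := mul_le_mul_of_nonneg_left (hFJ g) (hF0 g)
      have e3 := mul_le_mul_of_nonneg_right (hF g) (hJ0 g)
      nlinarith
    · linarith
  rw [expect_sub_distrib, ← mul_expect] at h6
  have h7 : (1 + r ^ 2) * 𝔼 g, F g ≤ (1 + r ^ 2) * (1 / 2) := by gcongr
  have h8 : (1 + r ^ 2) * D ≤ 15 * r := by nlinarith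
  have h9 : A ≤ 40 * r := by nlinarith
  have h10 : 𝔼 g, F g * F (a / g) ≤ 𝔼 g, (1 + r ^ 2) * ((if ψ i g = 1 then F g else 0) +
      (if ψ i (a / g) = 1 then F (a / g) else 0)) := expect_le_expect fun g _ => by
    have h11 : ψ i (a / g) * ψ i g = -1 := by rw [← map_mul, div_mul_cancel, ha']
    have e0 := hF0 g
    have e1 := hF g
    have e2 := hF0 (a / g)
    have e3 := hF (a / g)
    rcases hi1 g with h | h
    · have h12 : ¬ ψ i (a / g) = 1 := by
        intro h'; rw [h, h'] at h11; norm_num at h11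
      rw [if_pos h, if_neg h12]
      nlinarith
    · have h12 : ψ i (a / g) = 1 := by
        rw [h] at h11; linear_combination -h11
      have h13 : ¬ ψ i g = 1 := by rw [h]; norm_num
      rw [if_neg h13, if_pos h12]
      nlinarith
  rw [← mul_expect, expect_add_distrib,
    expect_div_left a (fun g => if ψ i g = 1 then F g else 0), ← hA] at h10
  nlinarith

end Functional

end Linnik

namespace Linnik

open Finset
open scoped BigOperators

section Pairs

variable {G : Type*} [CommGroup G] [Fintype G] [DecidableEq G]

theorem sum_filter_le_add {α : Type*} (s : Finset α) (f : α → ℝ) (hf : ∀ x ∈ s, 0 ≤ f x)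
    (p q r : α → Prop) [DecidablePred p] [DecidablePred q] [DecidablePred r]
    (h : ∀ x ∈ s, p x → q x ∨ r x) :
    ∑ x ∈ s with p x, f x ≤ ∑ x ∈ s with q x, f x + ∑ x ∈ s with r x, f x := by
  rw [sum_filter, sum_filter, sum_filter, ← sum_add_distrib]
  apply sum_le_sum
  intro x hx
  have h1 := h x hx
  have h2 := hf x hx
  by_cases hp : p x
  · rcases h1 hp with hq | hq
    · simp only [hp, hq, if_true]; split_ifs <;> linarith
    · simp only [hp, hq, if_true]; split_ifs <;> linarith
  · simp only [hp, if_false]; split_ifs <;> linarith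

variable {N : Finset ℕ} {w t : ℕ → ℝ} {cls : ℕ → G} {δ : ℝ}

theorem pair_sum (P : ℕ → Prop) [DecidablePred P] (l u : ℕ → ℝ) (b : G) :
    Fintype.card G * ∑ x ∈ N ×ˢ N with P x.1 ∧ (l x.1 < t x.2 ∧ t x.2 ≤ u x.1) ∧
      cls x.1 * cls x.2 = b, w x.1 * w x.2 =
    ∑ n ∈ N with P n, w n * classMass N w t cls (l n) (u n) (b / cls n) := by
  rw [sum_filter, sum_product, mul_sum, sum_filter]
  apply sum_congr rfl
  intro n _
  by_cases hP : P n
  · simp only [hP, true_and, if_true]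
    rw [classMass, ← sum_filter, mul_left_comm, mul_sum (a := w n)]
    congr 1
    apply sum_congr _ (fun _ _ => rfl)
    apply filter_congr
    intro k _
    rw [and_assoc, eq_div_iff_mul_eq', mul_comm]
  · simp [hP]

theorem pair_sum_swap (P : ℕ → Prop) [DecidablePred P] (l u : ℕ → ℝ) (b : G) :
    Fintype.card G * ∑ x ∈ N ×ˢ N with P x.2 ∧ (l x.2 < t x.1 ∧ t x.1 ≤ u x.2) ∧
      cls x.1 * cls x.2 = b, w x.1 * w x.2 =
    ∑ n ∈ N with P n, w n * classMass N w t cls (l n) (u n) (b / cls n) := by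
  rw [← pair_sum P l u b]
  congr 1
  apply sum_nbij' Prod.swap Prod.swap
  · intro x hx
    simp only [mem_filter, mem_product, Prod.fst_swap, Prod.snd_swap] at hx ⊢
    exact ⟨⟨hx.1.2, hx.1.1⟩, hx.2.1, hx.2.2.1, by rw [mul_comm]; exact hx.2.2.2⟩
  · intro x hx
    simp only [mem_filter, mem_product, Prod.fst_swap, Prod.snd_swap] at hx ⊢
    exact ⟨⟨hx.1.2, hx.1.1⟩, hx.2.1, hx.2.2.1, by rw [mul_comm]; exact hx.2.2.2⟩
  · intro x _; rfl
  · intro x _; rfl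
  · intro x _; exact mul_comm _ _

theorem pair_sum_box (l u : ℝ) (b : G) :
    Fintype.card G * ∑ x ∈ N ×ˢ N with (l < t x.1 ∧ t x.1 ≤ u) ∧ (l < t x.2 ∧ t x.2 ≤ u) ∧
      cls x.1 * cls x.2 = b, w x.1 * w x.2 =
    𝔼 g, classMass N w t cls l u g * classMass N w t cls l u (b / g) := by
  rw [pair_sum (fun n => l < t n ∧ t n ≤ u) (fun _ => l) (fun _ => u) b,
    Fintype.expect_eq_sum_div_card, ← sum_fiberwise _ cls, sum_div]
  apply sum_congr rfl
  intro g _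
  have hQ : (Fintype.card G : ℝ) ≠ 0 := by exact_mod_cast Fintype.card_ne_zero
  rw [classMass, mul_assoc, mul_div_assoc, mul_comm, div_mul_cancel₀ _ hQ, sum_mul, filter_filter]
  apply sum_congr
  · apply filter_congr
    intro n _
    exact and_assoc
  · intro n hn
    rw [(mem_filter.mp hn).2.2.2]

namespace SelbergSystem

theorem pair_nonneg (hS : SelbergSystem N w t cls δ) : ∀ x ∈ N ×ˢ N, 0 ≤ w x.1 * w x.2 := by
  intro x hx
  rw [mem_product] at hx
  exact mul_nonneg (hS.w_nonneg _ hx.1) (hS.w_nonneg _ hx.2)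

variable {m : ℕ} (hS : SelbergSystem N w t cls δ) (hm : 0 < m) (hδ : δ ≤ 1 / (m : ℝ) ^ 4)

include hS in
theorem delta_nonneg : 0 ≤ δ := (abs_nonneg _).trans (hS.mass 0 le_rfl zero_le_one)

include hS hm hδ

theorem short_pairs_le (h2 : 2 ≤ m) (a : G) :
    ∑ n ∈ N with t n ≤ 1 / (m : ℝ), w n * classMass N w t cls (1 / m) 1 (a / cls n) ≤
      (1 / (m : ℝ) + δ) * (2 + 1 / m) := by
  have hm2 : (2 : ℝ) ≤ m := by exact_mod_cast h2
  have hη1 : 1 / (m : ℝ) ≤ 1 := by rw [div_le_one (by linarith)]; linarith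
  have h0 : (0 : ℝ) ≤ 1 / m := by positivity
  have h1 := (abs_le.mp (hS.mass (1 / m) h0 hη1)).2
  calc ∑ n ∈ N with t n ≤ 1 / (m : ℝ), w n * classMass N w t cls (1 / m) 1 (a / cls n) ≤
      ∑ n ∈ N with t n ≤ 1 / (m : ℝ), w n * (2 + 1 / m) := by
        apply sum_le_sum
        intro n hn
        apply mul_le_mul_of_nonneg_left _ (hS.w_nonneg n (mem_filter.mp hn).1)
        refine (hS.classMass_le hm hδ le_rfl hη1 le_rfl _).trans (le_of_eq ?_)
        ring
    _ ≤ _ := by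
        rw [← sum_mul]
        apply mul_le_mul_of_nonneg_right _ (by positivity)
        linarith

theorem long_pairs_le (h2 : 2 ≤ m) (a : G) :
    ∑ n ∈ N with 1 / 2 < t n ∧ t n ≤ 1,
      w n * classMass N w t cls (1 / m) (1 - t n) (a / cls n) ≤
      2 * (1 / 8 * (1 + 1 / m) + δ) + 1 / m * (1 / 2 + 2 * δ) := by
  have hm2 : (2 : ℝ) ≤ m := by exact_mod_cast h2
  have h0 : (0 : ℝ) ≤ 1 / m := by positivity
  have h1 := sum_mul_sub_le N w t (fun _ => True) hS.w_nonneg (v := 1 / 2) (V := 1) (c := 1)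
    (e := 2 * δ) (by norm_num) m hm (by
      intro u hu hu1
      have := (abs_le.mp (hS.sum_mass (v := 1 / 2) (by norm_num) hu hu1)).2
      simp only [and_true]
      linarith)
  simp only [and_true] at h1
  have h3 := (abs_le.mp (hS.sum_mass (v := 1 / 2) (u := 1) (by norm_num) (by norm_num) le_rfl)).2
  calc ∑ n ∈ N with 1 / 2 < t n ∧ t n ≤ 1,
      w n * classMass N w t cls (1 / m) (1 - t n) (a / cls n) ≤
      ∑ n ∈ N with 1 / 2 < t n ∧ t n ≤ 1, (2 * (w n * (1 - t n)) + 1 / m * w n) := by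
        apply sum_le_sum
        intro n hn
        rw [mem_filter] at hn
        have hw := hS.w_nonneg n hn.1
        have : classMass N w t cls (1 / m) (1 - t n) (a / cls n) ≤ 2 * (1 - t n) + 1 / m := by
          rcases le_total (1 / (m : ℝ)) (1 - t n) with h | h
          · refine (hS.classMass_le hm hδ le_rfl h (by linarith) _).trans (le_of_eq ?_)
            ring
          · rw [classMass, filter_false_of_mem]
            · simp only [sum_empty, mul_zero]; linarith
            · intro k _ hk
              linarith [hk.1, hk.2.1]
        have := mul_le_mul_of_nonneg_left this hw
        linarith
    _ = 2 * ∑ n ∈ N with 1 / 2 < t n ∧ t n ≤ 1, w n * (1 - t n) +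
        1 / m * ∑ n ∈ N with 1 / 2 < t n ∧ t n ≤ 1, w n := by
        rw [sum_add_distrib, ← mul_sum, ← mul_sum]
    _ ≤ _ := by
        gcongr
        · linarith
        · linarith

theorem box_lower (h8 : 8 ≤ m) {a : G}
    (hN : Fintype.card G * ∑ n ∈ N with t n ≤ 1 ∧ cls n = a, w n * t n ≤ δ) :
    1 / 2 - 8 * (1 / (m : ℝ)) ≤ 𝔼 g, classMass N w t cls (1 / m) (1 / 2) g *
      classMass N w t cls (1 / m) (1 / 2) (a / g) := by
  have hm8 : (8 : ℝ) ≤ m := by exact_mod_cast h8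
  set η : ℝ := 1 / (m : ℝ) with hη
  have hη0 : 0 < η := by positivity
  have hη8 : η ≤ 1 / 8 := by rw [hη]; gcongr
  have hδ' : δ ≤ η ^ 4 := by rw [hη, one_div_pow]; exact hδ
  have hδ0 := hS.delta_nonneg
  have hδη : δ ≤ η / 512 := by
    have : η ^ 4 ≤ η * (1 / 8) ^ 3 := by
      rw [show η ^ 4 = η * η ^ 3 by ring]; gcongr
    linarith
  have hQ : (0 : ℝ) ≤ Fintype.card G := by positivity
  have hpn := hS.pair_nonneg
  have h1 := (abs_le.mp (hS.symm 1 zero_le_one le_rfl a)).1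
  have hA := (abs_le.mp (hS.symm (2 * η) (by positivity) (by linarith) a)).2
  have hB := pair_sum (N := N) (w := w) (t := t) (cls := cls)
    (fun n => t n ≤ η) (fun _ => η) (fun _ => 1) a
  have hB' := pair_sum_swap (N := N) (w := w) (t := t) (cls := cls)
    (fun n => t n ≤ η) (fun _ => η) (fun _ => 1) a
  have hB2 := hS.short_pairs_le hm hδ (by omega) a
  have hD := pair_sum (N := N) (w := w) (t := t) (cls := cls)
    (fun n => 1 / 2 < t n ∧ t n ≤ 1) (fun _ => η) (fun n => 1 - t n) a
  have hD' := pair_sum_swap (N := N) (w := w) (t := t) (cls := cls)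
    (fun n => 1 / 2 < t n ∧ t n ≤ 1) (fun _ => η) (fun n => 1 - t n) a
  have hD2 := hS.long_pairs_le hm hδ (by omega) a
  rw [← hη] at hB2 hD2
  have hC := pair_sum_box (N := N) (w := w) (t := t) (cls := cls) η (1 / 2) a
  have hnn : 0 ≤ ∑ n ∈ N with t n ≤ 2 * η ∧ cls n = a, w n * t n :=
    sum_nonneg fun n hn => mul_nonneg (hS.w_nonneg n (mem_filter.mp hn).1)
      (hS.t_nonneg n (mem_filter.mp hn).1)
  have s1 := sum_filter_le_add (N ×ˢ N) (fun x => w x.1 * w x.2) hpn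
    (fun x => t x.1 + t x.2 ≤ 1 ∧ cls x.1 * cls x.2 = a)
    (fun x => t x.1 + t x.2 ≤ 2 * η ∧ cls x.1 * cls x.2 = a)
    (fun x => t x.1 + t x.2 ≤ 1 ∧ cls x.1 * cls x.2 = a ∧ (η < t x.1 ∨ η < t x.2)) (by
      intro x _ hx
      by_cases hc : η < t x.1 ∨ η < t x.2
      · exact Or.inr ⟨hx.1, hx.2, hc⟩
      · push Not at hc
        exact Or.inl ⟨by linarith [hc.1, hc.2], hx.2⟩)
  have s2 := sum_filter_le_add (N ×ˢ N) (fun x => w x.1 * w x.2) hpn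
    (fun x => t x.1 + t x.2 ≤ 1 ∧ cls x.1 * cls x.2 = a ∧ (η < t x.1 ∨ η < t x.2))
    (fun x => t x.1 ≤ η ∧ (η < t x.2 ∧ t x.2 ≤ 1) ∧ cls x.1 * cls x.2 = a)
    (fun x => t x.1 + t x.2 ≤ 1 ∧ cls x.1 * cls x.2 = a ∧ η < t x.1) (by
      intro x hx hx2
      have := hS.t_nonneg _ (mem_product.mp hx).1
      by_cases hc : η < t x.1
      · exact Or.inr ⟨hx2.1, hx2.2.1, hc⟩
      · exact Or.inl ⟨not_lt.mp hc, ⟨hx2.2.2.resolve_left hc, by linarith [hx2.1]⟩, hx2.2.1⟩)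
  have s3 := sum_filter_le_add (N ×ˢ N) (fun x => w x.1 * w x.2) hpn
    (fun x => t x.1 + t x.2 ≤ 1 ∧ cls x.1 * cls x.2 = a ∧ η < t x.1)
    (fun x => t x.2 ≤ η ∧ (η < t x.1 ∧ t x.1 ≤ 1) ∧ cls x.1 * cls x.2 = a)
    (fun x => t x.1 + t x.2 ≤ 1 ∧ cls x.1 * cls x.2 = a ∧ η < t x.1 ∧ η < t x.2) (by
      intro x hx hx2
      have := hS.t_nonneg _ (mem_product.mp hx).2
      by_cases hc : η < t x.2
      · exact Or.inr ⟨hx2.1, hx2.2.1, hx2.2.2, hc⟩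
      · exact Or.inl ⟨not_lt.mp hc, ⟨hx2.2.2, by linarith [hx2.1]⟩, hx2.2.1⟩)
  have s4 := sum_filter_le_add (N ×ˢ N) (fun x => w x.1 * w x.2) hpn
    (fun x => t x.1 + t x.2 ≤ 1 ∧ cls x.1 * cls x.2 = a ∧ η < t x.1 ∧ η < t x.2)
    (fun x => (1 / 2 < t x.1 ∧ t x.1 ≤ 1) ∧ (η < t x.2 ∧ t x.2 ≤ 1 - t x.1) ∧
      cls x.1 * cls x.2 = a)
    (fun x => t x.1 + t x.2 ≤ 1 ∧ cls x.1 * cls x.2 = a ∧ (η < t x.1 ∧ t x.1 ≤ 1 / 2) ∧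
      η < t x.2) (by
      intro x hx hx2
      have := hS.t_nonneg _ (mem_product.mp hx).2
      by_cases hc : t x.1 ≤ 1 / 2
      · exact Or.inr ⟨hx2.1, hx2.2.1, ⟨hx2.2.2.1, hc⟩, hx2.2.2.2⟩
      · exact Or.inl ⟨⟨not_le.mp hc, by linarith [hx2.1]⟩, ⟨hx2.2.2.2, by linarith [hx2.1]⟩,
          hx2.2.1⟩)
  have s5 := sum_filter_le_add (N ×ˢ N) (fun x => w x.1 * w x.2) hpn
    (fun x => t x.1 + t x.2 ≤ 1 ∧ cls x.1 * cls x.2 = a ∧ (η < t x.1 ∧ t x.1 ≤ 1 / 2) ∧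
      η < t x.2)
    (fun x => (1 / 2 < t x.2 ∧ t x.2 ≤ 1) ∧ (η < t x.1 ∧ t x.1 ≤ 1 - t x.2) ∧
      cls x.1 * cls x.2 = a)
    (fun x => (η < t x.1 ∧ t x.1 ≤ 1 / 2) ∧ (η < t x.2 ∧ t x.2 ≤ 1 / 2) ∧
      cls x.1 * cls x.2 = a) (by
      intro x hx hx2
      have := hS.t_nonneg _ (mem_product.mp hx).1
      by_cases hc : t x.2 ≤ 1 / 2
      · exact Or.inr ⟨hx2.2.2.1, ⟨hx2.2.2.2, hc⟩, hx2.2.1⟩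
      · exact Or.inl ⟨⟨not_le.mp hc, by linarith [hx2.1]⟩, ⟨hx2.2.2.1.1, by linarith [hx2.1]⟩,
          hx2.2.1⟩)
  have s6 := mul_le_mul_of_nonneg_left (((((s1.trans (add_le_add_right s2 _)).trans
    (add_le_add_right (add_le_add_right s3 _) _)).trans
    (add_le_add_right (add_le_add_right (add_le_add_right s4 _) _) _)).trans
    (add_le_add_right (add_le_add_right (add_le_add_right (add_le_add_right s5 _) _) _) _))) hQ
  simp only [mul_add] at s6 h1 hA
  rw [hB, hB', hD, hD', hC] at s6
  have hnn2 := mul_nonneg hQ hnn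
  have e1 : η * δ ≤ η / 512 := by nlinarith
  have e2 : δ * η = η * δ := mul_comm _ _
  have e3 : η * η ≤ η / 8 := by nlinarith
  nlinarith

end SelbergSystem

end Pairs

end Linnik

namespace Linnik

open Finset
open scoped BigOperators

section Conclusion

variable {G : Type*} [CommGroup G] [Fintype G] [DecidableEq G]
variable {N : Finset ℕ} {w t : ℕ → ℝ} {cls : ℕ → G} {δ : ℝ}

namespace SelbergSystem

theorem convolution_le (hS : SelbergSystem N w t cls δ) {m : ℕ} (hm : 8 ≤ m)
    (hδ : δ ≤ 1 / (m : ℝ) ^ 4) (g : G) :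
    𝔼 h, classMass N w t cls (1 / m) (1 / 4) h * classMass N w t cls (1 / m) (1 / 4) (g / h) ≤
      1 / 2 - classMass N w t cls (1 / m) (1 / 2) g / 2 + 3 * (1 / m) := by
  have hm8 : (8 : ℝ) ≤ m := by exact_mod_cast hm
  set η : ℝ := 1 / (m : ℝ) with hη
  have hη0 : 0 < η := by positivity
  have hη8 : η ≤ 1 / 8 := by rw [hη]; gcongr
  have hδ' : δ ≤ η ^ 4 := by rw [hη, one_div_pow]; exact hδ
  have hδη : δ ≤ η / 512 := by
    have : η ^ 4 ≤ η * (1 / 8) ^ 3 := by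
      rw [show η ^ 4 = η * η ^ 3 by ring]; gcongr
    linarith
  have hQ : (0 : ℝ) ≤ Fintype.card G := by positivity
  have h1 := (abs_le.mp (hS.symm (1 / 2) (by norm_num) (by norm_num) g)).2
  rw [← pair_sum_box]
  have h2 : ∑ x ∈ N ×ˢ N with (η < t x.1 ∧ t x.1 ≤ 1 / 4) ∧ (η < t x.2 ∧ t x.2 ≤ 1 / 4) ∧
      cls x.1 * cls x.2 = g, w x.1 * w x.2 ≤
      ∑ x ∈ N ×ˢ N with t x.1 + t x.2 ≤ 1 / 2 ∧ cls x.1 * cls x.2 = g, w x.1 * w x.2 := by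
    apply sum_le_sum_of_subset_of_nonneg
    · intro x hx
      rw [mem_filter] at hx ⊢
      exact ⟨hx.1, by linarith [hx.2.1.2, hx.2.2.1.2], hx.2.2.2⟩
    · intro x hx _
      exact hS.pair_nonneg x (mem_filter.mp hx).1
  have h3 : ∑ n ∈ N with η < t n ∧ t n ≤ 1 / 2 ∧ cls n = g, w n * t n ≤
      ∑ n ∈ N with t n ≤ 1 / 2 ∧ cls n = g, w n * t n := by
    apply sum_le_sum_of_subset_of_nonneg
    · intro x hx
      rw [mem_filter] at hx ⊢
      exact ⟨hx.1, hx.2.2⟩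
    · intro x hx _
      exact mul_nonneg (hS.w_nonneg x (mem_filter.mp hx).1) (hS.t_nonneg x (mem_filter.mp hx).1)
  have h4 := sum_mul_sub_le N (fun n => Fintype.card G * w n) t (fun n => cls n = g)
    (fun n hn => mul_nonneg hQ (hS.w_nonneg n hn)) (v := η) (V := 1 / 2) (c := 2) (e := 3 * η)
    (by linarith) m (by omega) (by
      intro u hu hu1
      have := hS.classMass_le (by omega) hδ (v := η) le_rfl hu (by linarith) g
      rw [← mul_sum]
      refine this.trans (le_of_eq ?_)
      rw [hη]; ring)
  have h5 : ∑ n ∈ N with η < t n ∧ t n ≤ 1 / 2 ∧ cls n = g, Fintype.card G * w n * (1 / 2 - t n) =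
      classMass N w t cls η (1 / 2) g / 2 -
      Fintype.card G * ∑ n ∈ N with η < t n ∧ t n ≤ 1 / 2 ∧ cls n = g, w n * t n := by
    rw [classMass, mul_div_assoc, ← mul_sub, sum_div, ← sum_sub_distrib, mul_sum]
    exact sum_congr rfl fun n _ => by ring
  rw [h5, ← hη] at h4
  have h6 := mul_le_mul_of_nonneg_left h2 hQ
  have h7 := mul_le_mul_of_nonneg_left h3 hQ
  rw [mul_add] at h1
  have e3 : η * η ≤ η / 8 := by nlinarith
  have e4 : 0 ≤ η ^ 3 := by positivity
  have e5 : η ^ 3 ≤ η / 64 := by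
    have : η ^ 3 ≤ η * (1 / 8) ^ 2 := by
      rw [show η ^ 3 = η * η ^ 2 by ring]; gcongr
    linarith
  nlinarith

/-- An approximate Selberg system with no mass at a class `a` is governed by a real character. -/
theorem exists_real_character (hS : SelbergSystem N w t cls δ) {ι : Type*} [Fintype ι]
    (ψ : ι → G →* ℂ) (orth : ∀ g, ∑ i, ψ i g = if g = 1 then (Fintype.card G : ℂ) else 0)
    {n : ℕ} (hn : 1000 ≤ n) (hδ : δ ≤ 1 / (n : ℝ) ^ 8) {a : G}
    (hN : Fintype.card G * ∑ n ∈ N with t n ≤ 1 ∧ cls n = a, w n * t n ≤ δ) :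
    ∃ i, (∀ g, ψ i g = 1 ∨ ψ i g = -1) ∧ (∃ g, ψ i g ≠ 1) ∧ ψ i a = 1 ∧
      ∑ k ∈ N with t k ≤ 1 / 4 ∧ ψ i (cls k) = 1, w k ≤ 16 / (n : ℝ) := by
  have hn0 : (1000 : ℝ) ≤ n := by exact_mod_cast hn
  have hm : 8 ≤ n ^ 2 := by nlinarith
  have hm0 : 0 < n ^ 2 := by omega
  have hm' : (8 : ℝ) ≤ ((n ^ 2 : ℕ) : ℝ) := by exact_mod_cast hm
  have hδm : δ ≤ 1 / ((n ^ 2 : ℕ) : ℝ) ^ 4 := by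
    push_cast
    rw [← pow_mul]
    exact hδ
  have hη : 1 / ((n ^ 2 : ℕ) : ℝ) = (1 / (n : ℝ)) ^ 2 := by push_cast; rw [one_div_pow]
  set r : ℝ := 1 / (n : ℝ) with hr
  have hr0 : 0 < r := by positivity
  have hr1 : r ≤ 1 / 1000 := by rw [hr]; gcongr
  have hδ0 := hS.delta_nonneg
  have hδr : δ ≤ r ^ 2 / 512 := by
    have h1 : δ ≤ r ^ 8 := by rw [hr, one_div_pow]; exact hδ
    have h2 : r ^ 8 ≤ r ^ 2 * (1 / 1000) ^ 6 := by
      rw [show r ^ 8 = r ^ 2 * r ^ 6 by ring]; gcongr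
    nlinarith
  have hr2 : r ^ 2 ≤ 1 / 1000000 := by nlinarith
  set F : G → ℝ := classMass N w t cls (r ^ 2) (1 / 2) with hF
  set J : G → ℝ := classMass N w t cls (r ^ 2) (1 / 4) with hJ
  have hle : ∀ v u b, r ^ 2 ≤ v → v ≤ u → u ≤ 1 →
      classMass N w t cls v u b ≤ 2 * (u - v) + 3 * r ^ 2 := by
    intro v u b h1 h2 h3
    have := hS.classMass_le hm0 hδm (by rw [hη]; exact h1) h2 h3 b
    have e : (3 : ℝ) / ((n ^ 2 : ℕ) : ℝ) = 3 * r ^ 2 := by rw [← hη]; ring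
    rwa [e] at this
  have hEF := abs_le.mp (hS.sum_classMass_near (v := r ^ 2) (u := 1 / 2) (by positivity)
    (by linarith) (by norm_num))
  have hEJ := abs_le.mp (hS.sum_classMass_near (v := r ^ 2) (u := 1 / 4) (by positivity)
    (by linarith) (by norm_num))
  rw [← Fintype.expect_eq_sum_div_card] at hEF hEJ
  have hbox := hS.box_lower hm0 hδm hm hN
  rw [hη] at hbox
  obtain ⟨i, hi1, hi2, hi3, hi4⟩ := exists_real_character_of_functions ψ orth (F := F) (J := J)
    (r := r) (a := a) hr0 hr1 (classMass_nonneg hS.w_nonneg _ _)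
    (fun g => (hle _ _ g le_rfl (by linarith) (by norm_num)).trans (by linarith))
    (classMass_nonneg hS.w_nonneg _ _)
    (fun g => (hle _ _ g le_rfl (by linarith) (by norm_num)).trans (by linarith))
    (by linarith [hEF.2]) (by linarith [hEJ.1]) (by linarith [hEJ.2]) hbox
    (fun g => by
      have h1 := classMass_split (N := N) (w := w) (t := t) (cls := cls) (l := r ^ 2)
        (v := 1 / 4) (u := 1 / 2) (by linarith) (by norm_num) g
      have h2 := hle (1 / 4) (1 / 2) g (by linarith) (by norm_num) (by norm_num)
      rw [hF, hJ]
      linarith)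
    (fun g => by
      have := hS.convolution_le hm hδm g
      rw [hη] at this
      exact this)
  refine ⟨i, hi1, hi2, hi3, ?_⟩
  have hQ : (Fintype.card G : ℝ) ≠ 0 := by exact_mod_cast Fintype.card_ne_zero
  have hsum : 𝔼 g, (if ψ i g = 1 then J g else 0) =
      ∑ k ∈ N with r ^ 2 < t k ∧ t k ≤ 1 / 4 ∧ ψ i (cls k) = 1, w k := by
    rw [Fintype.expect_eq_sum_div_card, ← sum_fiberwise _ cls, sum_div]
    apply sum_congr rfl
    intro g _
    by_cases hg : ψ i g = 1
    · rw [if_pos hg, hJ, classMass, mul_div_cancel_left₀ _ hQ, filter_filter]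
      apply sum_congr _ (fun _ _ => rfl)
      apply filter_congr
      intro k _
      exact ⟨fun h => ⟨⟨h.1, h.2.1, by rw [h.2.2]; exact hg⟩, h.2.2⟩,
        fun h => ⟨h.1.1, h.1.2.1, h.2⟩⟩
    · rw [if_neg hg, zero_div, filter_filter, filter_false_of_mem, sum_empty]
      intro k _ h
      exact hg (by rw [← h.2]; exact h.1.2.2)
  rw [hsum] at hi4
  have hmass := (abs_le.mp (hS.mass (r ^ 2) (by positivity) (by linarith))).2
  have hcover := sum_filter_le_add N w hS.w_nonneg (fun k => t k ≤ 1 / 4 ∧ ψ i (cls k) = 1)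
    (fun k => t k ≤ r ^ 2) (fun k => r ^ 2 < t k ∧ t k ≤ 1 / 4 ∧ ψ i (cls k) = 1) (by
      intro k _ hk
      by_cases h : t k ≤ r ^ 2
      · exact Or.inl h
      · exact Or.inr ⟨not_le.mp h, hk⟩)
  have e16 : 16 / (n : ℝ) = 16 * r := by rw [hr]; ring
  rw [e16]
  nlinarith

end SelbergSystem

end Conclusion

end Linnik

namespace Linnik

open Finset

/-- Partial summation against a nonnegative antitone weight. -/
theorem abs_sum_mul_antitone_le {φ e : ℕ → ℝ} {M Y : ℕ} {B : ℝ} (h0 : ∀ m, M < m → 0 ≤ φ m)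
    (hφ : ∀ m, M < m → φ (m + 1) ≤ φ m) (hMY : M ≤ Y)
    (hB : ∀ y, M ≤ y → y ≤ Y → |∑ m ∈ Ioc M y, e m| ≤ B) :
    |∑ m ∈ Ioc M Y, φ m * e m| ≤ B * φ (M + 1) := by
  have hB0 : 0 ≤ B := (abs_nonneg _).trans (hB M le_rfl hMY)
  rcases hMY.eq_or_lt with rfl | hlt
  · simp only [Ioc_self, sum_empty, abs_zero]
    exact mul_nonneg hB0 (h0 _ (Nat.lt_succ_self _))
  have key : ∀ y, M + 1 ≤ y → y ≤ Y →
      |∑ m ∈ Ioc M y, φ m * e m - φ y * ∑ m ∈ Ioc M y, e m| ≤ B * (φ (M + 1) - φ y) := by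
    intro y hy
    induction y, hy using Nat.le_induction with
    | base => intro _; simp
    | succ y hy ih =>
      intro hyY
      have h1 := ih (by omega)
      have h2 := hB y (by omega) (by omega)
      have h3 := hφ y (by omega)
      rw [sum_Ioc_succ_top (by omega), sum_Ioc_succ_top (by omega)]
      have e1 : ∑ m ∈ Ioc M y, φ m * e m + φ (y + 1) * e (y + 1) -
          φ (y + 1) * (∑ m ∈ Ioc M y, e m + e (y + 1)) =
          (∑ m ∈ Ioc M y, φ m * e m - φ y * ∑ m ∈ Ioc M y, e m) +
          (φ y - φ (y + 1)) * ∑ m ∈ Ioc M y, e m := by ring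
      rw [e1]
      refine (abs_add_le _ _).trans ?_
      rw [abs_mul, abs_of_nonneg (sub_nonneg.mpr h3)]
      have := mul_le_mul_of_nonneg_left h2 (sub_nonneg.mpr h3)
      linarith
  have h1 := key Y hlt le_rfl
  have h2 := hB Y hMY le_rfl
  have h3 := h0 Y hlt
  have e1 : ∑ m ∈ Ioc M Y, φ m * e m = (∑ m ∈ Ioc M Y, φ m * e m - φ Y * ∑ m ∈ Ioc M Y, e m) +
      φ Y * ∑ m ∈ Ioc M Y, e m := by ring
  rw [e1]
  refine (abs_add_le _ _).trans ?_
  rw [abs_mul, abs_of_nonneg h3]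
  have := mul_le_mul_of_nonneg_left h2 h3
  linarith

theorem card_modEq_near {M Y r : ℕ} (hr : 0 < r) (hMY : M ≤ Y) (v : ℕ) :
    |(#{m ∈ Ioc M Y | m ≡ v [MOD r]} : ℝ) - ((Y : ℝ) - M) / r| ≤ 1 := by
  have h1 := Nat.Ioc_filter_modEq_card M Y hr v
  have hr0 : (0 : ℚ) < r := by exact_mod_cast hr
  have hle : ((M : ℚ) - v) / r ≤ (Y - v) / r := by
    have : (M : ℚ) ≤ Y := by exact_mod_cast hMY
    gcongr
  have h2 : (0 : ℤ) ≤ ⌊((Y : ℚ) - v) / r⌋ - ⌊((M : ℚ) - v) / r⌋ :=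
    sub_nonneg.mpr (Int.floor_le_floor hle)
  rw [max_eq_left h2] at h1
  have h3 : (#{m ∈ Ioc M Y | m ≡ v [MOD r]} : ℚ) =
      (⌊((Y : ℚ) - v) / r⌋ : ℚ) - ⌊((M : ℚ) - v) / r⌋ := by exact_mod_cast h1
  have h4 : |(#{m ∈ Ioc M Y | m ≡ v [MOD r]} : ℚ) - ((Y : ℚ) - M) / r| ≤ 1 := by
    rw [h3]
    have a1 := Int.floor_le (((Y : ℚ) - v) / r)
    have a2 := Int.lt_floor_add_one (((Y : ℚ) - v) / r)
    have a3 := Int.floor_le (((M : ℚ) - v) / r)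
    have a4 := Int.lt_floor_add_one (((M : ℚ) - v) / r)
    have e : ((Y : ℚ) - M) / r = (Y - v) / r - (M - v) / r := by ring
    rw [e, abs_le]
    constructor <;> linarith
  have h5 := (Rat.cast_le (K := ℝ)).mpr h4
  push_cast at h5
  exact h5

theorem sum_modEq_near {φ : ℕ → ℝ} {M Y r : ℕ} (h0 : ∀ m, M < m → 0 ≤ φ m)
    (hφ : ∀ m, M < m → φ (m + 1) ≤ φ m) (hr : 0 < r) (hMY : M ≤ Y) (v : ℕ) :
    |∑ m ∈ Ioc M Y with m ≡ v [MOD r], φ m - (∑ m ∈ Ioc M Y, φ m) / r| ≤ φ (M + 1) := by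
  have h1 := abs_sum_mul_antitone_le (e := fun m => (if m ≡ v [MOD r] then 1 else 0) - 1 / (r : ℝ))
    (B := 1) h0 hφ hMY (by
      intro y hy _
      have := card_modEq_near hr hy v
      rw [sum_sub_distrib, sum_boole, sum_const, Nat.card_Ioc, nsmul_eq_mul, Nat.cast_sub hy,
        mul_one_div]
      exact this)
  rw [one_mul] at h1
  refine le_trans (le_of_eq ?_) h1
  congr 1
  simp only [mul_sub, sum_sub_distrib, mul_ite, mul_one, mul_zero]
  rw [sum_filter, sum_div]
  simp only [mul_one_div]

/-- The primes below `z` not dividing `q`. -/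
def sievePrimes (q z : ℕ) : Finset ℕ := z.primesBelow.filter fun p => ¬ p ∣ q

theorem mem_sievePrimes {q z p : ℕ} : p ∈ sievePrimes q z ↔ (p < z ∧ p.Prime) ∧ ¬ p ∣ q := by
  rw [sievePrimes, mem_filter, Nat.mem_primesBelow]

theorem prod_dvd_iff {e : Finset ℕ} (he : ∀ p ∈ e, p.Prime) (n : ℕ) :
    ∏ p ∈ e, p ∣ n ↔ ∀ p ∈ e, p ∣ n :=
  ⟨fun h p hp => (dvd_prod_of_mem _ hp).trans h,
    fun h => prod_primes_dvd n (fun _ hp => (he _ hp).prime) h⟩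

theorem prod_coprime_of_sievePrimes {q z : ℕ} {e : Finset ℕ} (he : e ⊆ sievePrimes q z) :
    Nat.Coprime (∏ p ∈ e, p) q := by
  apply Nat.Coprime.prod_left
  intro p hp
  have := mem_sievePrimes.mp (he hp)
  exact (Nat.Prime.coprime_iff_not_dvd this.1.2).mpr this.2

/-- A sieve estimate in arithmetic progressions with smooth weights. -/
theorem sieve_progression {q s z M Y : ℕ} [NeZero q] (hs : 100 ≤ s) (hz : 2 ≤ z) {φ : ℕ → ℝ}
    (h0 : ∀ m, M < m → 0 ≤ φ m) (hφ : ∀ m, M < m → φ (m + 1) ≤ φ m) (hMY : M ≤ Y) (c : ZMod q) :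
    |∑ n ∈ Ioc M Y with ((n : ℕ) : ZMod q) = c ∧ ∀ p ∈ sievePrimes q z, ¬ p ∣ n, φ n -
      (∑ n ∈ Ioc M Y, φ n) / q * ∏ p ∈ sievePrimes q z, (1 - (p : ℝ)⁻¹)| ≤
    Real.exp (100 - s / 4) *
      ((∑ n ∈ Ioc M Y, φ n) / q * ∏ p ∈ sievePrimes q z, (1 - (p : ℝ)⁻¹)) +
      z ^ (3 * s + 2) * φ (M + 1) := by
  have hnn : ∀ n ∈ Ioc M Y, 0 ≤ φ n := fun n hn => h0 n (mem_Ioc.mp hn).1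
  have := fundamental_lemma hs hz (P := sievePrimes q z) (g := fun p => (p : ℝ)⁻¹)
    (fun p hp => ⟨(mem_sievePrimes.mp hp).1.2, (mem_sievePrimes.mp hp).1.1⟩)
    (fun p hp => by
      have hp1 : (1 : ℝ) ≤ p := by exact_mod_cast (mem_sievePrimes.mp hp).1.2.one_lt.le
      have h1 : (p : ℝ)⁻¹ ≤ 1 := inv_le_one_of_one_le₀ hp1
      have h2 : 0 ≤ (p : ℝ)⁻¹ := by positivity
      rw [one_div, one_div, ← inv_pow]
      constructor <;> nlinarith)
    (Ioc M Y |>.filter fun n => (n : ZMod q) = c) φ (fun n hn => hnn n (mem_filter.mp hn).1)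
    (X := (∑ n ∈ Ioc M Y, φ n) / q) (R := φ (M + 1))
    (div_nonneg (sum_nonneg hnn) (by positivity)) (h0 _ (Nat.lt_succ_self _)) (by
      intro e he _
      have hcop := prod_coprime_of_sievePrimes he
      have hpr : ∀ p ∈ e, p.Prime := fun p hp => (mem_sievePrimes.mp (he hp)).1.2
      have hpos : 0 < ∏ p ∈ e, p := prod_pos fun p hp => (hpr p hp).pos
      obtain ⟨v, hv1, hv2⟩ := Nat.chineseRemainder hcop 0 c.val
      have h1 := sum_modEq_near h0 hφ (r := (∏ p ∈ e, p) * q)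
        (Nat.mul_pos hpos (NeZero.pos q)) hMY v
      refine le_trans (le_of_eq ?_) h1
      congr 2
      · rw [filter_filter]
        apply sum_congr _ (fun _ _ => rfl)
        apply filter_congr
        intro n _
        rw [← prod_dvd_iff hpr, ← Nat.modEq_and_modEq_iff_modEq_mul hcop, and_comm]
        have e1 : ((n : ZMod q) = c) ↔ n ≡ v [MOD q] := by
          rw [← ZMod.natCast_eq_natCast_iff, (ZMod.natCast_eq_natCast_iff _ _ _).mpr hv2,
            ZMod.natCast_zmod_val]
        have e2 : (∏ p ∈ e, p) ∣ n ↔ n ≡ v [MOD ∏ p ∈ e, p] := by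
          rw [← Nat.modEq_zero_iff_dvd]
          exact ⟨fun h => h.trans hv1.symm, fun h => h.trans hv1⟩
        rw [e1, e2]
      · rw [prod_inv_distrib]
        push_cast
        rw [div_mul_eq_div_div_swap, div_eq_mul_inv _ (∏ p ∈ e, (p : ℝ))])
  rw [filter_filter] at this
  exact this

theorem coprime_of_cast_isUnit {q n : ℕ} (h : IsUnit (n : ZMod q)) : n.Coprime q :=
  (ZMod.isUnit_iff_coprime n q).mp h

theorem isRough_iff_of_isUnit {q z n : ℕ} (h : IsUnit (n : ZMod q)) :
    IsRough z n ↔ ∀ p ∈ sievePrimes q z, ¬ p ∣ n := by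
  constructor
  · intro h1 p hp
    exact h1 p (mem_filter.mp hp).1
  · intro h1 p hp hpn
    by_cases hpq : p ∣ q
    · have := Nat.dvd_gcd hpn hpq
      rw [coprime_of_cast_isUnit h] at this
      exact (Nat.mem_primesBelow.mp hp).2.one_lt.ne' (Nat.dvd_one.mp this)
    · exact h1 p (mem_filter.mpr ⟨hp, hpq⟩) hpn

theorem sieveProd_mul_totient {q z : ℕ} (hq : 0 < q) (hqz : q < z) :
    (∏ p ∈ sievePrimes q z, (1 - (p : ℝ)⁻¹)) * q.totient = mertensProd z * q := by
  have h1 : (q.totient : ℝ) = q * ∏ p ∈ q.primeFactors, (1 - (p : ℝ)⁻¹) := by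
    have := Nat.totient_eq_mul_prod_factors q
    have h2 : ((q.totient : ℚ) : ℝ) = ((q * ∏ p ∈ q.primeFactors, (1 - (p : ℚ)⁻¹) : ℚ) : ℝ) := by
      rw [this]
    push_cast at h2
    exact h2
  have h2 : z.primesBelow.filter (fun p => p ∣ q) = q.primeFactors := by
    ext p
    rw [mem_filter, Nat.mem_primesBelow, Nat.mem_primeFactors]
    constructor
    · intro h; exact ⟨h.1.2, h.2, hq.ne'⟩
    · intro h; exact ⟨⟨(Nat.le_of_dvd hq h.2.1).trans_lt hqz, h.1⟩, h.2.1⟩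
  rw [h1, mertensProd, ← prod_filter_mul_prod_filter_not z.primesBelow (fun p => p ∣ q), h2,
    sievePrimes]
  ring

theorem sieveProd_le {q z : ℕ} (hq : 0 < q) (hqz : q < z) (hz : 2 ≤ z) :
    (∏ p ∈ sievePrimes q z, (1 - (p : ℝ)⁻¹)) / q ≤ 1 / (q.totient * Real.log z) := by
  have hlog : 0 < Real.log z := Real.log_pos (by exact_mod_cast hz)
  have hφ : (0 : ℝ) < q.totient := by exact_mod_cast Nat.totient_pos.mpr hq
  have hq0 : (0 : ℝ) < q := by exact_mod_cast hq
  rw [div_le_div_iff₀ hq0 (by positivity), one_mul, ← mul_assoc, sieveProd_mul_totient hq hqz]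
  have := mertensProd_mul_log_le z
  nlinarith

theorem sieveProd_nonneg (q z : ℕ) : 0 ≤ ∏ p ∈ sievePrimes q z, (1 - (p : ℝ)⁻¹) :=
  prod_nonneg fun p hp => by
    have : (1 : ℝ) ≤ p := by exact_mod_cast (mem_sievePrimes.mp hp).1.2.one_lt.le
    linarith [inv_le_one_of_one_le₀ this]

end Linnik

namespace Linnik

open Finset

theorem sum_inv_Ioc_le (M Y : ℕ) : ∑ n ∈ Ioc M Y, (n : ℝ)⁻¹ ≤ 1 + Real.log Y := by
  have h1 := harmonic_le_one_add_log Y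
  rw [harmonic_eq_sum_Icc] at h1
  push_cast at h1
  refine le_trans ?_ h1
  apply sum_le_sum_of_subset_of_nonneg
  · intro n hn
    rw [mem_Ioc] at hn
    rw [mem_Icc]
    omega
  · intro n _ _
    positivity

/-- A Brun-Titchmarsh type bound for the reciprocals of rough numbers in a progression. -/
theorem sum_rough_inv_progression_le {q z₁ z Y : ℕ} [NeZero q] (hq : q < z₁) (hz₁ : 2 ≤ z₁)
    (hz : z = z₁ ^ 1300) (c : ZMod q) :
    ∑ d ∈ Ioc 1 Y with ((d : ℕ) : ZMod q) = c ∧ IsRough z d, (d : ℝ)⁻¹ ≤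
      (2600 * (1 + Real.log Y) / Real.log z + 1) / q.totient := by
  have hq0 : 0 < q := NeZero.pos q
  have hz₁0 : (0 : ℝ) < z₁ := by exact_mod_cast (by omega : 0 < z₁)
  have hz₁1 : (1 : ℝ) ≤ z₁ := by exact_mod_cast (by omega : 1 ≤ z₁)
  have hz1z : z₁ ≤ z := by rw [hz]; exact Nat.le_self_pow (by norm_num) _
  have hlog₁ : 0 < Real.log z₁ := Real.log_pos (by exact_mod_cast hz₁)
  have hlogz : Real.log z = 1300 * Real.log z₁ := by
    rw [hz]; push_cast; rw [Real.log_pow]; norm_num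
  have hφ : (0 : ℝ) < q.totient := by exact_mod_cast Nat.totient_pos.mpr hq0
  have hlY : 0 ≤ Real.log Y := Real.log_natCast_nonneg Y
  have hsub : (Ioc 1 Y).filter (fun d => ((d : ℕ) : ZMod q) = c ∧ IsRough z d) ⊆
      (Ioc (z - 1) Y).filter
        (fun d => ((d : ℕ) : ZMod q) = c ∧ ∀ p ∈ sievePrimes q z₁, ¬ p ∣ d) := by
    intro d hd
    rw [mem_filter, mem_Ioc] at hd ⊢
    have h1 : z ≤ d := by
      rcases hd.2.2.eq_one_or_le (by omega) with h | h
      · omega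
      · exact h
    refine ⟨⟨by omega, hd.1.2⟩, hd.2.1, fun p hp => ?_⟩
    have := mem_sievePrimes.mp hp
    exact hd.2.2 p (Nat.mem_primesBelow.mpr ⟨this.1.1.trans_le hz1z, this.1.2⟩)
  have h1 := sum_le_sum_of_subset_of_nonneg (f := fun d : ℕ => (d : ℝ)⁻¹) hsub
    (fun d _ _ => by positivity)
  refine h1.trans ?_
  have hnn : 0 ≤ (2600 * (1 + Real.log Y) / Real.log z + 1) / q.totient := by
    rw [hlogz]; positivity
  rcases lt_or_ge Y (z - 1) with hYz | hYz
  · rw [Ioc_eq_empty (by omega)]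
    simpa using hnn
  have h2 := (abs_le.mp (sieve_progression (q := q) (s := 400) (z := z₁) (M := z - 1) (Y := Y)
    (by norm_num) hz₁ (φ := fun d => (d : ℝ)⁻¹) (fun m _ => by positivity)
    (fun m hm => by
      have : (0 : ℝ) < m := by exact_mod_cast (by omega : 0 < m)
      push_cast
      gcongr
      linarith) hYz c)).2
  have e0 : (100 : ℝ) - ((400 : ℕ) : ℝ) / 4 = 0 := by norm_num
  rw [e0, Real.exp_zero, one_mul, Nat.sub_add_cancel (by omega)] at h2
  have h3 : (∑ n ∈ Ioc (z - 1) Y, (n : ℝ)⁻¹) / q * ∏ p ∈ sievePrimes q z₁, (1 - (p : ℝ)⁻¹) ≤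
      (1 + Real.log Y) * (1 / (q.totient * Real.log z₁)) := by
    rw [div_mul_eq_mul_div, mul_div_assoc]
    exact mul_le_mul (sum_inv_Ioc_le _ _) (sieveProd_le hq0 hq hz₁)
      (div_nonneg (sieveProd_nonneg _ _) (by positivity)) (by linarith)
  have h4 : (z₁ : ℝ) ^ (3 * 400 + 2) * (z : ℝ)⁻¹ ≤ 1 / q.totient := by
    have e1 : (z : ℝ) = (z₁ : ℝ) ^ (3 * 400 + 2) * (z₁ : ℝ) ^ 98 := by
      rw [hz, ← pow_add]; push_cast; rfl
    rw [e1, mul_inv, mul_inv_cancel_left₀ (by positivity), ← one_div]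
    apply one_div_le_one_div_of_le hφ
    have h5 : (q.totient : ℝ) ≤ z₁ := by
      exact_mod_cast (Nat.totient_le q).trans hq.le
    exact h5.trans (le_self_pow₀ hz₁1 (by norm_num))
  have e2 : (2600 * (1 + Real.log Y) / Real.log z + 1) / q.totient =
      2 * ((1 + Real.log Y) * (1 / (q.totient * Real.log z₁))) + 1 / q.totient := by
    rw [hlogz]; field_simp; ring
  rw [e2]
  linarith

theorem log_sq_div_antitone {m : ℕ} (hm : 8 ≤ m) :
    Real.log (m + 1 : ℕ) ^ 2 / (m + 1 : ℕ) ≤ Real.log m ^ 2 / m := by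
  have hm0 : (8 : ℝ) ≤ m := by exact_mod_cast hm
  have he : Real.exp 2 ≤ 8 := by
    have h1 := Real.exp_one_lt_d9
    have h2 : Real.exp 2 = Real.exp 1 ^ 2 := by rw [← Real.exp_nat_mul]; norm_num
    rw [h2]
    have := Real.exp_pos 1
    nlinarith
  have h1 := Real.log_div_sqrt_antitoneOn (a := (m : ℝ)) (b := ((m + 1 : ℕ) : ℝ))
    (he.trans hm0) (by show Real.exp 2 ≤ _; push_cast; linarith) (by push_cast; linarith)
  have e : ∀ t : ℝ, 0 ≤ t → Real.log t ^ 2 / t = (Real.log t / √t) ^ 2 := by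
    intro t ht; rw [div_pow, Real.sq_sqrt ht]
  rw [e _ (by positivity), e _ (by positivity)]
  have h2 : 0 ≤ Real.log ((m + 1 : ℕ) : ℝ) / √((m + 1 : ℕ) : ℝ) :=
    div_nonneg (Real.log_natCast_nonneg _) (Real.sqrt_nonneg _)
  exact pow_le_pow_left₀ h2 h1 2

/-- The logarithmic weights over rough numbers are equidistributed among reduced classes. -/
theorem rough_log_sq_equidistributed {q z s M Y : ℕ} [NeZero q] (hq : q < z) (hz : 2 ≤ z)
    (hs : 100 ≤ s) (hM : 8 ≤ M) {c c' : ZMod q} (hc : IsUnit c) (hc' : IsUnit c') :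
    |∑ m ∈ Ioc M Y with ((m : ℕ) : ZMod q) = c ∧ IsRough z m, Real.log m ^ 2 / m -
      ∑ m ∈ Ioc M Y with ((m : ℕ) : ZMod q) = c' ∧ IsRough z m, Real.log m ^ 2 / m| ≤
    2 * (Real.exp (100 - s / 4) * ((∑ m ∈ Ioc M Y, Real.log m ^ 2 / m) /
      (q.totient * Real.log z)) +
      z ^ (3 * s + 2) * (Real.log (M + 1 : ℕ) ^ 2 / (M + 1 : ℕ))) := by
  have hlogz : 0 < Real.log z := Real.log_pos (by exact_mod_cast hz)
  have hsum0 : 0 ≤ ∑ m ∈ Ioc M Y, Real.log m ^ 2 / m := sum_nonneg fun m _ => by positivity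
  rcases lt_or_ge Y M with h | h
  · rw [Ioc_eq_empty (by omega)]
    simp only [filter_empty, sum_empty, sub_zero, abs_zero]
    positivity
  have key : ∀ {c : ZMod q}, IsUnit c →
      (Ioc M Y).filter (fun m => ((m : ℕ) : ZMod q) = c ∧ IsRough z m) =
      (Ioc M Y).filter (fun m => ((m : ℕ) : ZMod q) = c ∧ ∀ p ∈ sievePrimes q z, ¬ p ∣ m) := by
    intro c hc
    apply filter_congr
    intro m _
    constructor
    · intro h; exact ⟨h.1, (isRough_iff_of_isUnit (h.1 ▸ hc)).mp h.2⟩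
    · intro h; exact ⟨h.1, (isRough_iff_of_isUnit (h.1 ▸ hc)).mpr h.2⟩
  rw [key hc, key hc']
  have h1 := fun c : ZMod q => sieve_progression (q := q) (s := s) (z := z) (M := M) (Y := Y)
    hs hz (φ := fun m : ℕ => Real.log m ^ 2 / m) (fun m _ => by positivity)
    (fun m hm => log_sq_div_antitone (by omega)) h c
  have h2 : (∑ m ∈ Ioc M Y, Real.log m ^ 2 / m) / q *
      ∏ p ∈ sievePrimes q z, (1 - (p : ℝ)⁻¹) ≤
      (∑ m ∈ Ioc M Y, Real.log m ^ 2 / m) / (q.totient * Real.log z) := by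
    rw [div_mul_eq_mul_div, mul_div_assoc, div_eq_mul_one_div _ ((q.totient : ℝ) * _)]
    exact mul_le_mul_of_nonneg_left (sieveProd_le (NeZero.pos q) hq hz) hsum0
  have h3 := mul_le_mul_of_nonneg_left h2 (Real.exp_pos (100 - s / 4)).le
  have h4 := abs_le.mp (h1 c)
  have h5 := abs_le.mp (h1 c')
  rw [abs_le]
  constructor <;> linarith [h4.1, h4.2, h5.1, h5.2]

end Linnik

namespace Linnik

open Finset ArithmeticFunction

open scoped ArithmeticFunction.zeta ArithmeticFunction.Moebius

theorem sum_Ioc_divisorsAntidiagonal (y : ℕ) (P : ℕ → Prop) [DecidablePred P] (f : ℕ → ℕ → ℝ) :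
    ∑ n ∈ Ioc 0 y with P n, ∑ x ∈ n.divisorsAntidiagonal, f x.1 x.2 =
      ∑ x ∈ Ioc 0 y ×ˢ Ioc 0 y with x.1 * x.2 ≤ y ∧ P (x.1 * x.2), f x.1 x.2 := by
  have hm : ∀ x ∈ (Ioc 0 y ×ˢ Ioc 0 y).filter (fun x : ℕ × ℕ => x.1 * x.2 ≤ y ∧ P (x.1 * x.2)),
      x.1 * x.2 ∈ (Ioc 0 y).filter P := by
    intro x hx
    rw [mem_filter, mem_product, mem_Ioc, mem_Ioc] at hx
    rw [mem_filter, mem_Ioc]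
    exact ⟨⟨Nat.mul_pos hx.1.1.1 hx.1.2.1, hx.2.1⟩, hx.2.2⟩
  rw [← sum_fiberwise_of_maps_to hm]
  apply sum_congr rfl
  intro n hn
  rw [mem_filter, mem_Ioc] at hn
  apply sum_congr _ (fun _ _ => rfl)
  ext ⟨a, b⟩
  rw [mem_filter, mem_filter, mem_product, mem_Ioc, mem_Ioc, Nat.mem_divisorsAntidiagonal]
  constructor
  · rintro ⟨h, h0⟩
    simp only at h ⊢
    have ha : a ≠ 0 := by rintro rfl; simp at h; omega
    have hb : b ≠ 0 := by rintro rfl; simp at h; omega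
    have h1 : a ≤ a * b := Nat.le_mul_of_pos_right a (Nat.pos_of_ne_zero hb)
    have h2 : b ≤ a * b := Nat.le_mul_of_pos_left b (Nat.pos_of_ne_zero ha)
    rw [h] at h1 h2 ⊢
    exact ⟨⟨⟨⟨by omega, by omega⟩, ⟨by omega, by omega⟩⟩, hn.1.2, hn.2⟩, rfl⟩
  · rintro ⟨_, h⟩
    exact ⟨h, by omega⟩

/-- Selberg's weight `Λ(n) log n + (Λ * Λ)(n)`. -/
noncomputable def logPairWeight (n : ℕ) : ℝ :=
  Λ n * Real.log n + ∑ x ∈ n.divisorsAntidiagonal, Λ x.1 * Λ x.2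

theorem logPairWeight_eq (n : ℕ) :
    logPairWeight n = ∑ x ∈ n.divisorsAntidiagonal, (μ x.1 : ℝ) * Real.log x.2 ^ 2 := by
  have leib : ∀ f g : ArithmeticFunction ℝ,
      pmul (f * g) log = pmul f log * g + f * pmul g log := by
    intro f g
    ext n
    simp only [pmul_apply, mul_apply, ArithmeticFunction.add_apply, sum_mul, log_apply]
    rw [← sum_add_distrib]
    apply sum_congr rfl
    intro x hx
    have h := Nat.mem_divisorsAntidiagonal.mp hx
    have h1 : (x.1 : ℝ) ≠ 0 := by
      have : x.1 ≠ 0 := by intro h'; rw [h'] at h; simp at h; omega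
      exact_mod_cast this
    have h2 : (x.2 : ℝ) ≠ 0 := by
      have : x.2 ≠ 0 := by intro h'; rw [h'] at h; simp at h; omega
      exact_mod_cast this
    rw [← h.1]
    push_cast
    rw [Real.log_mul h1 h2]
    ring
  have e1 : pmul (log : ArithmeticFunction ℝ) log =
      (pmul Λ log + Λ * Λ) * (ζ : ArithmeticFunction ℝ) := by
    have h1 := leib Λ (ζ : ArithmeticFunction ℝ)
    have h2 : pmul (ζ : ArithmeticFunction ℝ) log = log := by
      ext n
      by_cases hn : n = 0
      · simp [hn]
      · simp
    rw [vonMangoldt_mul_zeta, h2] at h1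
    rw [h1, add_mul, mul_assoc, vonMangoldt_mul_zeta]
  have e2 : pmul Λ log + Λ * Λ =
      ((μ : ArithmeticFunction ℤ) : ArithmeticFunction ℝ) * pmul (log : ArithmeticFunction ℝ) log := by
    rw [e1, mul_comm _ (_ * _), mul_assoc, coe_zeta_mul_coe_moebius, mul_one]
  have e3 := congrArg (fun f : ArithmeticFunction ℝ => f n) e2
  simp only [ArithmeticFunction.add_apply, pmul_apply, mul_apply, log_apply, intCoe_apply] at e3
  rw [logPairWeight, e3]
  simp only [sq]

theorem sum_logPairWeight_eq (y : ℕ) (P : ℕ → Prop) [DecidablePred P] :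
    ∑ n ∈ Ioc 0 y with P n, logPairWeight n / n =
      ∑ x ∈ Ioc 0 y ×ˢ Ioc 0 y with x.1 * x.2 ≤ y ∧ P (x.1 * x.2),
        (μ x.1 : ℝ) / x.1 * (Real.log x.2 ^ 2 / x.2) := by
  rw [← sum_Ioc_divisorsAntidiagonal y P fun a b => (μ a : ℝ) / a * (Real.log b ^ 2 / b)]
  apply sum_congr rfl
  intro n _
  rw [logPairWeight_eq, sum_div]
  apply sum_congr rfl
  intro x hx
  rw [← (Nat.mem_divisorsAntidiagonal.mp hx).1]
  push_cast
  rw [div_mul_div_comm]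

theorem IsRough.coprime {q z n : ℕ} (h : IsRough z n) (hq : 0 < q) (hqz : q < z) : n.Coprime q := by
  rw [Nat.coprime_iff_gcd_eq_one]
  by_contra hne
  obtain ⟨p, hp, hpd⟩ := Nat.exists_prime_and_dvd hne
  have h1 := h.le_prime hp (hpd.trans (Nat.gcd_dvd_left _ _))
  have h2 := Nat.le_of_dvd hq (hpd.trans (Nat.gcd_dvd_right _ _))
  omega

theorem IsRough.isUnit {q z n : ℕ} (h : IsRough z n) (hq : 0 < q) (hqz : q < z) :
    IsUnit (n : ZMod q) :=
  (ZMod.isUnit_iff_coprime n q).mpr (h.coprime hq hqz)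

end Linnik

namespace Linnik

open Finset ArithmeticFunction

open scoped ArithmeticFunction.zeta ArithmeticFunction.Moebius

theorem log_sq_le_of_le {m M : ℕ} (hm : 1 ≤ m) (hmM : m ≤ M) :
    Real.log m ^ 2 ≤ Real.log M ^ 2 := by
  have h0 : (0 : ℝ) < m := by exact_mod_cast hm
  exact pow_le_pow_left₀ (Real.log_natCast_nonneg m)
    (Real.log_le_log h0 (by exact_mod_cast hmM)) 2

theorem abs_moebius_div_le (d : ℕ) : |(μ d : ℝ) / d| ≤ (d : ℝ)⁻¹ := by
  rw [abs_div, Nat.abs_cast, ← one_div]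
  have : |(μ d : ℝ)| ≤ 1 := by exact_mod_cast abs_moebius_le_one
  gcongr

/-- The contribution of pairs with a small second entry. -/
theorem sum_pairs_small_le {q z₁ z M y : ℕ} [NeZero q] (hq : q < z₁) (hz₁ : 2 ≤ z₁)
    (hz : z = z₁ ^ 1300) (hzM : z ≤ M) (c : ZMod q) {K : ℝ}
    (hK : ∀ (c : ZMod q) (Y : ℕ), Y ≤ M ∨ Y ≤ y →
      ∑ d ∈ Ioc 1 Y with ((d : ℕ) : ZMod q) = c ∧ IsRough z d, (d : ℝ)⁻¹ ≤ K) :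
    ∑ x ∈ Ioc 0 y ×ˢ Ioc 1 M with ((x.1 * x.2 : ℕ) : ZMod q) = c ∧ IsRough z (x.1 * x.2),
      (x.1 : ℝ)⁻¹ * (Real.log x.2 ^ 2 / x.2) ≤
      Real.log M ^ 2 * K * (1 + Real.exp 24 * Real.log (M + 1) / Real.log z) := by
  have hq0 : 0 < q := NeZero.pos q
  have hz1z : z₁ ≤ z := by rw [hz]; exact Nat.le_self_pow (by norm_num) _
  have hqz : q < z := hq.trans_le hz1z
  have hK0 : 0 ≤ K := le_trans (sum_nonneg fun _ _ => by positivity) (hK c 0 (Or.inl (Nat.zero_le _)))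
  rw [sum_finset_product_right' _ ((Ioc 1 M).filter (IsRough z))
    (fun m => (Ioc 0 y).filter fun d => ((d * m : ℕ) : ZMod q) = c ∧ IsRough z d)
    (by
      intro x
      simp only [mem_filter, mem_product, isRough_mul]
      tauto) (f := fun a b => (a : ℝ)⁻¹ * (Real.log b ^ 2 / b))]
  have h1 : ∀ m ∈ (Ioc 1 M).filter (IsRough z),
      ∑ d ∈ Ioc 0 y with ((d * m : ℕ) : ZMod q) = c ∧ IsRough z d,
        (d : ℝ)⁻¹ * (Real.log m ^ 2 / m) ≤
      Real.log M ^ 2 * ((if ((m : ℕ) : ZMod q) = c then (m : ℝ)⁻¹ else 0) + K * (m : ℝ)⁻¹) := by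
    intro m hm
    rw [mem_filter, mem_Ioc] at hm
    have hu : IsUnit (m : ZMod q) := hm.2.isUnit hq0 hqz
    have h2 : ∑ d ∈ Ioc 0 y with ((d * m : ℕ) : ZMod q) = c ∧ IsRough z d, (d : ℝ)⁻¹ ≤
        (if ((m : ℕ) : ZMod q) = c then 1 else 0) + K := by
      have h3 : (Ioc 0 y).filter (fun d => ((d * m : ℕ) : ZMod q) = c ∧ IsRough z d) ⊆
          (({1} : Finset ℕ).filter fun _ => ((m : ℕ) : ZMod q) = c) ∪
          (Ioc 1 y).filter
            (fun d => ((d : ℕ) : ZMod q) = c * ((m : ℕ) : ZMod q)⁻¹ ∧ IsRough z d) := by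
        intro d hd
        rw [mem_filter, mem_Ioc] at hd
        rw [mem_union, mem_filter, mem_filter, mem_singleton, mem_Ioc]
        by_cases hd1 : d = 1
        · left
          refine ⟨hd1, ?_⟩
          rw [← hd.2.1, hd1, one_mul]
        · right
          refine ⟨⟨by omega, hd.1.2⟩, ?_, hd.2.2⟩
          rw [← hd.2.1, Nat.cast_mul, mul_assoc, ZMod.mul_inv_of_unit _ hu, mul_one]
      refine (sum_le_sum_of_subset_of_nonneg h3 fun _ _ _ => by positivity).trans ?_
      refine (sum_union_inter (f := fun d : ℕ => (d : ℝ)⁻¹) ▸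
        le_add_of_nonneg_right (sum_nonneg fun _ _ => by positivity)).trans ?_
      refine add_le_add ?_ (hK _ y (Or.inr le_rfl))
      rw [sum_filter, sum_singleton]
      norm_num
    rw [← sum_mul]
    have h4 : Real.log m ^ 2 / m ≤ Real.log M ^ 2 * (m : ℝ)⁻¹ := by
      rw [div_eq_mul_inv]
      exact mul_le_mul_of_nonneg_right (log_sq_le_of_le (by omega) hm.1.2) (by positivity)
    have h5 : (0 : ℝ) ≤ (if ((m : ℕ) : ZMod q) = c then 1 else 0) + K := by
      split_ifs <;> linarith
    refine (mul_le_mul h2 h4 (by positivity) h5).trans (le_of_eq ?_)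
    split_ifs <;> ring
  refine (sum_le_sum h1).trans ?_
  rw [← mul_sum, sum_add_distrib, ← mul_sum, ← sum_filter, filter_filter]
  have h6 : ∑ m ∈ Ioc 1 M with IsRough z m ∧ ((m : ℕ) : ZMod q) = c, (m : ℝ)⁻¹ ≤ K := by
    refine le_trans (le_of_eq ?_) (hK c M (Or.inl le_rfl))
    exact sum_congr (filter_congr fun _ _ => and_comm) fun _ _ => rfl
  have h7 : ∑ m ∈ Ioc 1 M with IsRough z m, (m : ℝ)⁻¹ ≤
      Real.exp 24 * Real.log (M + 1) / Real.log z := by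
    refine le_trans (sum_le_sum_of_subset_of_nonneg ?_ fun _ _ _ => by positivity)
      (sum_rough_inv_le z M (hz₁.trans hz1z) (by omega))
    exact filter_subset_filter _ (Ioc_subset_Ioc_left (by norm_num))
  have h8 := mul_le_mul_of_nonneg_left h7 hK0
  have h9 : 0 ≤ Real.log M ^ 2 := sq_nonneg _
  calc _ ≤ Real.log M ^ 2 * (K + K * (Real.exp 24 * Real.log (M + 1) / Real.log z)) := by gcongr
    _ = _ := by ring

theorem sum_log_sq_div_le (M Y x : ℕ) (h : Y ≤ x) :
    ∑ m ∈ Ioc M Y, Real.log m ^ 2 / m ≤ Real.log x ^ 2 * (1 + Real.log x) := by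
  have h1 : ∀ m ∈ Ioc M Y, Real.log m ^ 2 / m ≤ Real.log x ^ 2 * (m : ℝ)⁻¹ := by
    intro m hm
    rw [mem_Ioc] at hm
    rw [div_eq_mul_inv]
    exact mul_le_mul_of_nonneg_right (log_sq_le_of_le (by omega) (by omega)) (by positivity)
  refine (sum_le_sum h1).trans ?_
  rw [← mul_sum]
  refine mul_le_mul_of_nonneg_left ?_ (sq_nonneg _)
  refine le_trans (sum_le_sum_of_subset_of_nonneg (Ioc_subset_Ioc_right h)
    fun _ _ _ => by positivity) (sum_inv_Ioc_le M x)

theorem logPair_class_diff {q z₁ z s M x y : ℕ} [NeZero q] (hq : q < z₁) (hz₁ : 2 ≤ z₁)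
    (hz : z = z₁ ^ 1300) (hs : 100 ≤ s) (hzM : z ≤ M) (hMx : M ≤ x) (hyx : y ≤ x)
    {b b' : ZMod q} (hb : IsUnit b) (hb' : IsUnit b') :
    |∑ n ∈ Ioc 0 y with ((n : ℕ) : ZMod q) = b ∧ IsRough z n, logPairWeight n / n -
      ∑ n ∈ Ioc 0 y with ((n : ℕ) : ZMod q) = b' ∧ IsRough z n, logPairWeight n / n| ≤
    2 * (Real.log M ^ 2 * ((2600 * (1 + Real.log x) / Real.log z + 1) / q.totient) *
      (1 + Real.exp 24 * Real.log (M + 1) / Real.log z)) +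
    Real.exp 24 * Real.log (x + 1) / Real.log z *
      (2 * (Real.exp (100 - s / 4) * (Real.log x ^ 2 * (1 + Real.log x) /
        (q.totient * Real.log z)) +
      z ^ (3 * s + 2) * (Real.log (M + 1 : ℕ) ^ 2 / (M + 1 : ℕ)))) := by
  have hq0 : 0 < q := NeZero.pos q
  have hφ : (0 : ℝ) < q.totient := by exact_mod_cast Nat.totient_pos.mpr hq0
  have hz1z : z₁ ≤ z := by rw [hz]; exact Nat.le_self_pow (by norm_num) _
  have hqz : q < z := hq.trans_le hz1z
  have h8z : 8 ≤ z := by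
    rw [hz]
    calc 8 = 2 ^ 3 := by norm_num
      _ ≤ z₁ ^ 3 := Nat.pow_le_pow_left hz₁ 3
      _ ≤ _ := Nat.pow_le_pow_right (by omega) (by norm_num)
  have hlogz : 0 < Real.log z := Real.log_pos (by exact_mod_cast (by omega : 1 < z))
  set K : ℝ := (2600 * (1 + Real.log x) / Real.log z + 1) / q.totient with hKdef
  set E : ℝ := 2 * (Real.exp (100 - s / 4) * (Real.log x ^ 2 * (1 + Real.log x) /
        (q.totient * Real.log z)) +
      z ^ (3 * s + 2) * (Real.log (M + 1 : ℕ) ^ 2 / (M + 1 : ℕ))) with hE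
  have hE0 : 0 ≤ E := by
    have := Real.log_natCast_nonneg x
    positivity
  have hK : ∀ (c : ZMod q) (Y : ℕ), Y ≤ M ∨ Y ≤ y →
      ∑ d ∈ Ioc 1 Y with ((d : ℕ) : ZMod q) = c ∧ IsRough z d, (d : ℝ)⁻¹ ≤ K := by
    intro c Y hY
    have hYx : Y ≤ x := by omega
    refine le_trans (sum_le_sum_of_subset_of_nonneg ?_ fun _ _ _ => by positivity)
      (sum_rough_inv_progression_le (Y := x) hq hz₁ hz c)
    exact filter_subset_filter _ (Ioc_subset_Ioc_right hYx)
  have hsplit : ∀ {c : ZMod q}, IsUnit c →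
      |∑ n ∈ Ioc 0 y with ((n : ℕ) : ZMod q) = c ∧ IsRough z n, logPairWeight n / n -
        ∑ d ∈ Ioc 0 y with IsRough z d, (μ d : ℝ) / d *
          ∑ m ∈ Ioc M (y / d) with ((m : ℕ) : ZMod q) = c * ((d : ℕ) : ZMod q)⁻¹ ∧ IsRough z m,
            Real.log m ^ 2 / m| ≤
      Real.log M ^ 2 * K * (1 + Real.exp 24 * Real.log (M + 1) / Real.log z) := by
    intro c hc
    have e0 : ∑ d ∈ Ioc 0 y with IsRough z d, (μ d : ℝ) / d *
          ∑ m ∈ Ioc M (y / d) with ((m : ℕ) : ZMod q) = c * ((d : ℕ) : ZMod q)⁻¹ ∧ IsRough z m,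
            Real.log m ^ 2 / m =
        ∑ x ∈ Ioc 0 y ×ˢ Ioc 0 y with (x.1 * x.2 ≤ y ∧ (((x.1 * x.2 : ℕ) : ZMod q) = c ∧
          IsRough z (x.1 * x.2))) ∧ M < x.2, (μ x.1 : ℝ) / x.1 * (Real.log x.2 ^ 2 / x.2) := by
      simp only [mul_sum]
      symm
      apply sum_finset_product' (f := fun a b : ℕ => (μ a : ℝ) / a * (Real.log b ^ 2 / b))
      rintro ⟨d, m⟩
      simp only [mem_filter, mem_product, mem_Ioc, isRough_mul]
      constructor
      · rintro ⟨⟨⟨hd0, hdy⟩, hm0, hmy⟩, ⟨h1, h2, h3, h4⟩, h5⟩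
        refine ⟨⟨⟨hd0, hdy⟩, h3⟩, ⟨h5, (Nat.le_div_iff_mul_le hd0).mpr (by linarith)⟩, ?_, h4⟩
        rw [← h2, Nat.cast_mul, mul_comm (d : ZMod q), mul_assoc,
          ZMod.mul_inv_of_unit _ (h3.isUnit hq0 hqz), mul_one]
      · rintro ⟨⟨⟨hd0, hdy⟩, h3⟩, ⟨h5, h6⟩, h7, h4⟩
        have h8 := (Nat.le_div_iff_mul_le hd0).mp h6
        refine ⟨⟨⟨hd0, hdy⟩, by omega, h6.trans (Nat.div_le_self _ _)⟩,
          ⟨by linarith, ?_, h3, h4⟩, h5⟩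
        rw [Nat.cast_mul, h7, mul_comm, mul_assoc, ZMod.inv_mul_of_unit _ (h3.isUnit hq0 hqz),
          mul_one]
    rw [sum_logPairWeight_eq, e0, ← filter_filter _ (fun x : ℕ × ℕ => M < x.2),
      ← sum_filter_add_sum_filter_not _ (fun x : ℕ × ℕ => M < x.2), add_sub_cancel_left]
    refine le_trans ?_ (sum_pairs_small_le hq hz₁ hz hzM c hK)
    refine (abs_sum_le_sum_abs _ _).trans ?_
    have h1 : ∀ x : ℕ × ℕ, |(μ x.1 : ℝ) / x.1 * (Real.log x.2 ^ 2 / x.2)| ≤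
        (x.1 : ℝ)⁻¹ * (Real.log x.2 ^ 2 / x.2) := by
      intro x
      have h2 : 0 ≤ Real.log x.2 ^ 2 / (x.2 : ℝ) := by positivity
      rw [abs_mul, abs_of_nonneg h2]
      exact mul_le_mul_of_nonneg_right (abs_moebius_div_le _) h2
    refine (sum_le_sum fun x _ => h1 x).trans ?_
    rw [← sum_filter_of_ne (p := fun x : ℕ × ℕ => 1 < x.2)]
    · refine sum_le_sum_of_subset_of_nonneg ?_ fun _ _ _ => by positivity
      intro x hx
      simp only [mem_filter, mem_product, mem_Ioc] at hx ⊢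
      obtain ⟨⟨⟨⟨h1, h2⟩, h3, h4⟩, h5⟩, h6⟩ := hx
      exact ⟨⟨h1, h6, by omega⟩, h4⟩
    · intro x hx hne
      by_contra h3
      apply hne
      rw [mem_filter, mem_filter, mem_product, mem_Ioc, mem_Ioc] at hx
      have : x.2 = 1 := by omega
      rw [this]; simp
  have hmain : |∑ d ∈ Ioc 0 y with IsRough z d, (μ d : ℝ) / d *
          ∑ m ∈ Ioc M (y / d) with ((m : ℕ) : ZMod q) = b * ((d : ℕ) : ZMod q)⁻¹ ∧ IsRough z m,
            Real.log m ^ 2 / m -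
        ∑ d ∈ Ioc 0 y with IsRough z d, (μ d : ℝ) / d *
          ∑ m ∈ Ioc M (y / d) with ((m : ℕ) : ZMod q) = b' * ((d : ℕ) : ZMod q)⁻¹ ∧ IsRough z m,
            Real.log m ^ 2 / m| ≤ Real.exp 24 * Real.log (x + 1) / Real.log z * E := by
    rw [← sum_sub_distrib]
    refine (abs_sum_le_sum_abs _ _).trans ?_
    have h1 : ∑ d ∈ Ioc 0 y with IsRough z d, (d : ℝ)⁻¹ ≤
        Real.exp 24 * Real.log (x + 1) / Real.log z := by
      refine le_trans (sum_le_sum_of_subset_of_nonneg ?_ fun _ _ _ => by positivity)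
        (sum_rough_inv_le z x (by omega) (by omega))
      exact filter_subset_filter _ (Ioc_subset_Ioc_right hyx)
    refine le_trans ?_ (mul_le_mul_of_nonneg_right h1 hE0)
    rw [sum_mul]
    apply sum_le_sum
    intro d hd
    rw [mem_filter, mem_Ioc] at hd
    rw [← mul_sub, abs_mul]
    refine mul_le_mul (abs_moebius_div_le d) ?_ (abs_nonneg _) (by positivity)
    have hu : IsUnit (((d : ℕ) : ZMod q)⁻¹) := by
      have h2 := hd.2.isUnit hq0 hqz
      exact IsUnit.of_mul_eq_one _ (ZMod.inv_mul_of_unit _ h2)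
    refine (rough_log_sq_equidistributed (s := s) hqz (by omega) hs (by omega) (hb.mul hu)
      (hb'.mul hu)).trans ?_
    rw [hE]
    have h3 := sum_log_sq_div_le M (y / d) x ((Nat.div_le_self _ _).trans hyx)
    gcongr
  have h1 := abs_le.mp (hsplit hb)
  have h2 := abs_le.mp (hsplit hb')
  have h3 := abs_le.mp hmain
  rw [abs_le]
  constructor <;> linarith [h1.1, h1.2, h2.1, h2.2, h3.1, h3.2]

end Linnik

namespace Linnik

open Finset Filter Topology

theorem exists_sieve_level (δ : ℝ) (hδ : 0 < δ) (j k₀ : ℕ) :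
    ∃ s : ℕ, 100 ≤ s ∧ k₀ ≤ s ∧ 832160 * Real.exp 24 / s ≤ δ / 3 ∧
      8 * Real.exp 24 * ((j * s ^ 4 : ℕ) : ℝ) ^ 2 * Real.exp (100 - s / 4) ≤ δ / 3 := by
  have h1 : Tendsto (fun s : ℕ => 832160 * Real.exp 24 / (s : ℝ)) atTop (𝓝 0) :=
    tendsto_const_div_atTop_nhds_zero_nat _
  have h2 : Tendsto (fun s : ℕ => 8 * Real.exp 24 * ((j * s ^ 4 : ℕ) : ℝ) ^ 2 *
      Real.exp (100 - s / 4)) atTop (𝓝 0) := by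
    have h3 := (Real.tendsto_pow_mul_exp_neg_atTop_nhds_zero 8).comp
      ((tendsto_natCast_atTop_atTop (R := ℝ)).atTop_div_const (by norm_num : (0 : ℝ) < 4))
    have h4 := h3.const_mul (8 * Real.exp 24 * (j : ℝ) ^ 2 * Real.exp 100 * 4 ^ 8)
    rw [mul_zero] at h4
    refine h4.congr fun s => ?_
    simp only [Function.comp]
    rw [sub_eq_add_neg, Real.exp_add]
    push_cast
    ring
  have e1 := h1.eventually (ge_mem_nhds (by positivity : (0 : ℝ) < δ / 3))
  have e2 := h2.eventually (ge_mem_nhds (by positivity : (0 : ℝ) < δ / 3))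
  obtain ⟨s, h⟩ := (e1.and (e2.and ((eventually_ge_atTop 100).and (eventually_ge_atTop k₀)))).exists
  exact ⟨s, h.2.2.1, h.2.2.2, h.1, h.2.1⟩

set_option maxHeartbeats 1000000 in
/-- Selberg's weights over rough numbers are nearly equidistributed in reduced classes. -/
theorem logPair_equidistributed (δ : ℝ) (hδ : 0 < δ) (j k₀ : ℕ) (hj : 1 ≤ j) :
    ∃ k : ℕ, k₀ ≤ k ∧ 1 ≤ k ∧ j ∣ k ∧ ∃ Z : ℕ, ∀ z₁ : ℕ, Z ≤ z₁ → ∀ q : ℕ, q < z₁ →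
      ∀ z : ℕ, z = z₁ ^ 1300 → ∀ _ : NeZero q, ∀ y : ℕ, y ≤ z ^ k →
      ∀ b b' : ZMod q, IsUnit b → IsUnit b' →
      |∑ n ∈ Ioc 0 y with ((n : ℕ) : ZMod q) = b ∧ IsRough z n, logPairWeight n / n -
        ∑ n ∈ Ioc 0 y with ((n : ℕ) : ZMod q) = b' ∧ IsRough z n, logPairWeight n / n| ≤
      δ * (k * Real.log z) ^ 2 / q.totient := by
  obtain ⟨s, hs, hsk, hs1, hs2⟩ := exists_sieve_level δ hδ j k₀
  set k := j * s ^ 4 with hk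
  have hsk4 : s ^ 4 ≤ k := Nat.le_mul_of_pos_left _ hj
  have hs4 : s ≤ s ^ 4 := Nat.le_self_pow (by norm_num) s
  refine ⟨k, by omega, by omega, Dvd.intro _ rfl,
    max 3 (⌈12 * Real.exp 24 * k / δ⌉₊), ?_⟩
  intro z₁ hz₁ q hq z hz _ y hy b b' hb hb'
  have hz₁3 : 3 ≤ z₁ := (le_max_left _ _).trans hz₁
  have hz₁δ : 12 * Real.exp 24 * k / δ ≤ z₁ :=
    (Nat.le_ceil _).trans (by exact_mod_cast (le_max_right _ _).trans hz₁)
  have hz1z : z₁ ≤ z := by rw [hz]; exact Nat.le_self_pow (by norm_num) _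
  have hz0 : (0 : ℝ) < z := by exact_mod_cast (by omega : 0 < z)
  have hz1 : (1 : ℝ) ≤ z := by exact_mod_cast (by omega : 1 ≤ z)
  have hφ : (0 : ℝ) < q.totient := by exact_mod_cast Nat.totient_pos.mpr (NeZero.pos q)
  have hφz : (q.totient : ℝ) ≤ z := by
    exact_mod_cast ((Nat.totient_le q).trans hq.le).trans hz1z
  have hl : 1 ≤ Real.log z := by
    rw [Real.le_log_iff_exp_le hz0]
    have h1 := Real.exp_one_lt_d9
    have h2 : (3 : ℝ) ≤ z := by exact_mod_cast hz₁3.trans hz1z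
    linarith
  have hsR : (100 : ℝ) ≤ s := by exact_mod_cast hs
  have hkR : (s : ℝ) ^ 4 ≤ k := by exact_mod_cast hsk4
  have h5k : 3 * s + 5 ≤ k := by
    have : 4 * s ≤ s ^ 4 := by
      calc 4 * s ≤ s ^ 3 * s := Nat.mul_le_mul_right s (by
            calc 4 ≤ s := by omega
              _ ≤ s ^ 3 := Nat.le_self_pow (by norm_num) s)
        _ = s ^ 4 := by ring
    omega
  have hk1 : (1 : ℝ) ≤ k := by exact_mod_cast (by omega : 1 ≤ k)
  set l := Real.log z with hldef
  have hM1 : z ^ (3 * s + 4) + 1 ≤ z ^ (3 * s + 5) := by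
    have h1 : 1 ≤ z ^ (3 * s + 4) := Nat.one_le_pow _ _ (by omega)
    calc z ^ (3 * s + 4) + 1 ≤ z ^ (3 * s + 4) * 2 := by omega
      _ ≤ z ^ (3 * s + 4) * z := Nat.mul_le_mul_left _ (by omega)
      _ = _ := by rw [← pow_succ]
  have hx1 : z ^ k + 1 ≤ z ^ (2 * k) := by
    have h1 : 2 ≤ z ^ k := (by omega : 2 ≤ z).trans (Nat.le_self_pow (by omega) z)
    calc z ^ k + 1 ≤ z ^ k * z ^ k := by nlinarith
      _ = _ := by rw [← pow_add, two_mul]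
  have hlogM : Real.log ((z ^ (3 * s + 4) : ℕ) : ℝ) = (3 * s + 4) * l := by
    push_cast; rw [Real.log_pow]; push_cast; rfl
  have hlogx : Real.log ((z ^ k : ℕ) : ℝ) = k * l := by
    push_cast; rw [Real.log_pow]
  have hlogM1 : Real.log (((z ^ (3 * s + 4) : ℕ) : ℝ) + 1) ≤ 4 * s * l := by
    have h1 : (((z ^ (3 * s + 4) : ℕ) : ℝ) + 1) ≤ (z : ℝ) ^ (3 * s + 5) := by exact_mod_cast hM1
    have h2 := Real.log_le_log (by positivity) h1
    rw [Real.log_pow] at h2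
    push_cast at h2 ⊢
    refine h2.trans ?_
    rw [← hldef]
    gcongr
    linarith
  have hlogx1 : Real.log (((z ^ k : ℕ) : ℝ) + 1) ≤ 2 * k * l := by
    have h1 : (((z ^ k : ℕ) : ℝ) + 1) ≤ (z : ℝ) ^ (2 * k) := by exact_mod_cast hx1
    have h2 := Real.log_le_log (by positivity) h1
    rw [Real.log_pow] at h2
    push_cast at h2 ⊢
    exact h2
  have h4sk : 4 * (s : ℝ) ≤ k := by
    have : (4 : ℝ) ≤ (s : ℝ) ^ 3 := by
      calc (4 : ℝ) ≤ s := by linarith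
        _ ≤ (s : ℝ) ^ 3 := le_self_pow₀ (by linarith) (by norm_num)
    nlinarith
  have hmain := logPair_class_diff (s := s) hq (by omega) hz hs
    (M := z ^ (3 * s + 4)) (x := z ^ k) (Nat.le_self_pow (by omega) z)
    (Nat.pow_le_pow_right (by omega) (by omega)) hy hb hb'
  refine hmain.trans ?_
  rw [hlogM, hlogx, ← hldef]
  have t1 : ((3 * s + 4) * l) ^ 2 * ((2600 * (1 + k * l) / l + 1) / q.totient) *
      (1 + Real.exp 24 * Real.log (((z ^ (3 * s + 4) : ℕ) : ℝ) + 1) / l) ≤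
      (4 * s * l) ^ 2 * (5201 * k / q.totient) * (Real.exp 24 * (5 * s)) := by
    have a1 : (2600 * (1 + k * l) / l + 1) ≤ 5201 * k := by
      rw [← sub_nonneg]
      have : 5201 * k - (2600 * (1 + k * l) / l + 1) = ((2601 * k - 1) * l - 2600) / l := by
        field_simp; ring
      rw [this]
      apply div_nonneg _ (by linarith)
      have : (2601 * k - 1) * 1 ≤ (2601 * k - 1) * l :=
        mul_le_mul_of_nonneg_left hl (by linarith)
      linarith
    have a2 : 1 + Real.exp 24 * Real.log (((z ^ (3 * s + 4) : ℕ) : ℝ) + 1) / l ≤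
        Real.exp 24 * (5 * s) := by
      have b1 : (1 : ℝ) ≤ Real.exp 24 := Real.one_le_exp (by norm_num)
      have b2 : Real.exp 24 * Real.log (((z ^ (3 * s + 4) : ℕ) : ℝ) + 1) / l ≤
          Real.exp 24 * (4 * s) := by
        rw [div_le_iff₀ (by linarith), mul_assoc]
        gcongr
      have b3 := mul_le_mul b1 (by linarith : (1 : ℝ) ≤ s) zero_le_one (by positivity)
      linarith
    have a3 : (3 * (s : ℝ) + 4) ≤ 4 * s := by linarith
    have a4 : 0 ≤ 1 + Real.exp 24 * Real.log (((z ^ (3 * s + 4) : ℕ) : ℝ) + 1) / l := by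
      have := Real.log_nonneg (by
        have : (0 : ℝ) ≤ ((z ^ (3 * s + 4) : ℕ) : ℝ) := Nat.cast_nonneg _
        linarith : (1 : ℝ) ≤ ((z ^ (3 * s + 4) : ℕ) : ℝ) + 1)
      positivity
    gcongr
  have t2 : Real.exp (100 - s / 4) * ((k * l) ^ 2 * (1 + k * l) / (q.totient * l)) ≤
      Real.exp (100 - s / 4) * ((k * l) ^ 2 * (2 * k) / q.totient) := by
    have a1 : (1 + k * l) / l ≤ 2 * k := by
      have : 1 ≤ k * l := one_le_mul_of_one_le_of_one_le hk1 hl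
      rw [div_le_iff₀ (by linarith)]; linarith
    have a2 : (k * l) ^ 2 * (1 + k * l) / (q.totient * l) =
        (k * l) ^ 2 * ((1 + k * l) / l) / q.totient := by field_simp
    rw [a2]
    gcongr
  have t3 : (z : ℝ) ^ (3 * s + 2) * (Real.log ((z ^ (3 * s + 4) + 1 : ℕ) : ℝ) ^ 2 /
      ((z ^ (3 * s + 4) + 1 : ℕ) : ℝ)) ≤ (k * l) ^ 2 / (z * q.totient) := by
    have a1 : Real.log ((z ^ (3 * s + 4) + 1 : ℕ) : ℝ) ^ 2 ≤ (k * l) ^ 2 := by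
      rw [← hlogx]
      exact log_sq_le_of_le (by omega) (hM1.trans (Nat.pow_le_pow_right (by omega) h5k))
    have a2 : (z : ℝ) ^ (3 * s + 2) * z ^ 2 ≤ ((z ^ (3 * s + 4) + 1 : ℕ) : ℝ) := by
      rw [← pow_add]; push_cast; simp
    have a3 : (z : ℝ) * q.totient ≤ z ^ 2 := by rw [sq]; gcongr
    rw [← mul_div_assoc, div_le_div_iff₀ (by positivity) (by positivity)]
    calc _ ≤ (z : ℝ) ^ (3 * s + 2) * (k * l) ^ 2 * z ^ 2 := by gcongr
      _ = (k * l) ^ 2 * ((z : ℝ) ^ (3 * s + 2) * z ^ 2) := by ring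
      _ ≤ _ := by gcongr
  have t4 : Real.exp 24 * Real.log (((z ^ k : ℕ) : ℝ) + 1) / l ≤ Real.exp 24 * (2 * k) := by
    rw [div_le_iff₀ (by linarith), mul_assoc]
    gcongr
  have hl0 : 0 < l := by linarith
  have u0 : 0 ≤ (z : ℝ) ^ (3 * s + 2) * (Real.log ((z ^ (3 * s + 4) + 1 : ℕ) : ℝ) ^ 2 /
      ((z ^ (3 * s + 4) + 1 : ℕ) : ℝ)) := by positivity
  have t5 : Real.exp 24 * Real.log (((z ^ k : ℕ) : ℝ) + 1) / l *
      (2 * (Real.exp (100 - s / 4) * ((k * l) ^ 2 * (1 + k * l) / (q.totient * l)) +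
      (z : ℝ) ^ (3 * s + 2) * (Real.log ((z ^ (3 * s + 4) + 1 : ℕ) : ℝ) ^ 2 /
      ((z ^ (3 * s + 4) + 1 : ℕ) : ℝ)))) ≤ Real.exp 24 * (2 * k) *
      (2 * (Real.exp (100 - s / 4) * ((k * l) ^ 2 * (2 * k) / q.totient) +
        (k * l) ^ 2 / (z * q.totient))) := by
    gcongr
  set W := (k * l) ^ 2 / (q.totient : ℝ) with hW
  have hW0 : 0 ≤ W := by positivity
  have hk0 : (0 : ℝ) < k := by linarith
  have f1 : 2 * ((4 * s * l) ^ 2 * (5201 * k / q.totient) * (Real.exp 24 * (5 * s))) ≤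
      δ / 3 * W := by
    have a1 : 2 * ((4 * s * l) ^ 2 * (5201 * k / q.totient) * (Real.exp 24 * (5 * s))) =
        832160 * Real.exp 24 * (s ^ 3 / k) * W := by
      rw [hW]; field_simp; ring
    rw [a1]
    refine mul_le_mul_of_nonneg_right ?_ hW0
    refine le_trans ?_ hs1
    rw [div_eq_mul_inv (832160 * Real.exp 24)]
    gcongr
    rw [div_le_iff₀ hk0, inv_mul_eq_div, le_div_iff₀ (by linarith)]
    linarith
  have f2 : Real.exp 24 * (2 * k) *
      (2 * (Real.exp (100 - s / 4) * ((k * l) ^ 2 * (2 * k) / q.totient))) ≤ δ / 3 * W := by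
    refine le_trans (le_of_eq ?_) (mul_le_mul_of_nonneg_right hs2 hW0)
    rw [hW]; ring
  have f3 : Real.exp 24 * (2 * k) * (2 * ((k * l) ^ 2 / (z * q.totient))) ≤ δ / 3 * W := by
    have a1 : Real.exp 24 * (2 * k) * (2 * ((k * l) ^ 2 / (z * q.totient))) =
        4 * Real.exp 24 * k / z * W := by
      rw [hW]; field_simp; ring
    rw [a1]
    refine mul_le_mul_of_nonneg_right ?_ hW0
    rw [div_le_iff₀ hδ] at hz₁δ
    have : (z₁ : ℝ) ≤ z := by exact_mod_cast hz1z
    rw [div_le_iff₀ hz0]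
    nlinarith
  have e : δ * (k * l) ^ 2 / q.totient = δ / 3 * W + δ / 3 * W + δ / 3 * W := by
    rw [hW]; ring
  rw [e]
  linarith

end Linnik

namespace Linnik

open Finset ArithmeticFunction

theorem sum_Ioc_pow_le {r : ℝ} (h0 : 0 ≤ r) (h1 : r ≤ 1 / 2) (M y : ℕ) :
    ∑ i ∈ Ioc M y, r ^ i ≤ 2 * r ^ (M + 1) := by
  rcases lt_or_ge y M with h | h
  · rw [Ioc_eq_empty (by omega), sum_empty]; positivity
  have key : ∑ i ∈ Ioc M y, r ^ i + 2 * r ^ (y + 1) ≤ 2 * r ^ (M + 1) := by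
    induction y, h using Nat.le_induction with
    | base => simp
    | succ y hy ih =>
      rw [sum_Ioc_succ_top (by omega)]
      have h2 : 0 ≤ r ^ (y + 1) := by positivity
      have h3 : r ^ (y + 1 + 1) = r ^ (y + 1) * r := pow_succ _ _
      nlinarith
  have : 0 ≤ r ^ (y + 1) := by positivity
  linarith

/-- A sum over prime powers of von Mangoldt weights is bounded by a double sum. -/
theorem sum_vonMangoldt_le_of_prime_pow {S Q : Finset ℕ} {M y : ℕ} (hQ : ∀ p ∈ Q, p.Prime)
    (h : ∀ n ∈ S, Λ n ≠ 0 → ∃ p ∈ Q, ∃ i ∈ Ioc M y, n = p ^ i) :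
    ∑ n ∈ S, Λ n / n ≤ ∑ p ∈ Q, 2 * Real.log p * ((p : ℝ)⁻¹) ^ (M + 1) := by
  classical
  rw [← sum_filter_ne_zero]
  have hsub : S.filter (fun n => Λ n / n ≠ 0) ⊆ (Q ×ˢ Ioc M y).image fun x => x.1 ^ x.2 := by
    intro n hn
    rw [mem_filter] at hn
    obtain ⟨p, hp, i, hi, rfl⟩ := h n hn.1 (fun h0 => hn.2 (by rw [h0, zero_div]))
    exact mem_image.mpr ⟨(p, i), mem_product.mpr ⟨hp, hi⟩, rfl⟩
  have hnn : ∀ n : ℕ, 0 ≤ Λ n / n := fun n => div_nonneg vonMangoldt_nonneg (by positivity)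
  refine (sum_le_sum_of_subset_of_nonneg hsub fun n _ _ => hnn n).trans ?_
  have h2 : ∑ n ∈ (Q ×ˢ Ioc M y).image (fun x => x.1 ^ x.2), Λ n / n ≤
      ∑ x ∈ Q ×ˢ Ioc M y, Λ (x.1 ^ x.2) / ((x.1 ^ x.2 : ℕ) : ℝ) :=
    sum_image_le_of_nonneg (fun n _ => hnn n)
  refine h2.trans ?_
  rw [sum_product]
  apply sum_le_sum
  intro p hp
  have hp2 : (2 : ℝ) ≤ p := by exact_mod_cast (hQ p hp).two_le
  have h3 : ∀ i ∈ Ioc M y, Λ (p ^ i) / ((p ^ i : ℕ) : ℝ) ≤ Real.log p * ((p : ℝ)⁻¹) ^ i := by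
    intro i _
    rw [Nat.cast_pow, inv_pow, ← div_eq_mul_inv]
    by_cases hi : i = 0
    · rw [hi]; simp [Real.log_nonneg (by linarith : (1 : ℝ) ≤ p)]
    · rw [vonMangoldt_apply_pow hi, vonMangoldt_apply_prime (hQ p hp)]
  refine (sum_le_sum h3).trans ?_
  rw [← mul_sum]
  have h4 := sum_Ioc_pow_le (r := (p : ℝ)⁻¹) (by positivity)
    (by rw [← one_div]; exact one_div_le_one_div_of_le (by norm_num) hp2) M y
  have h5 := mul_le_mul_of_nonneg_left h4 (Real.log_nonneg (by linarith : (1 : ℝ) ≤ p))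
  linarith

theorem exists_prime_pow_of_vonMangoldt_ne_zero {n y : ℕ} (h : Λ n ≠ 0) (hny : n ≤ y) :
    ∃ p i, p.Prime ∧ 0 < i ∧ i ≤ y ∧ n = p ^ i := by
  obtain ⟨p, i, hp, hi, rfl⟩ := (isPrimePow_nat_iff n).mp (vonMangoldt_ne_zero_iff.mp h)
  exact ⟨p, i, hp, hi, (Nat.lt_pow_self hp.one_lt).le.trans hny, rfl⟩

/-- Mertens' theorem over rough numbers. -/
theorem sum_rough_vonMangoldt (z y : ℕ) (hz : 2 ≤ z) (hy : 1 ≤ y) :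
    |∑ n ∈ Ioc 0 y with IsRough z n, Λ n / n - Real.log y| ≤ 2 * Real.log z + 18 := by
  have h1 := mertens_vonMangoldt y hy
  have h2 : ∑ n ∈ Ioc 0 y with ¬ IsRough z n, Λ n / n ≤ 2 * Real.log z + 12 := by
    have h3 := sum_vonMangoldt_le_of_prime_pow (S := (Ioc 0 y).filter fun n => ¬ IsRough z n)
      (Q := z.primesBelow) (M := 0) (y := y) (fun p hp => (Nat.mem_primesBelow.mp hp).2) (by
        intro n hn hΛ
        rw [mem_filter, mem_Ioc] at hn
        obtain ⟨p, i, hp, hi, hiy, rfl⟩ := exists_prime_pow_of_vonMangoldt_ne_zero hΛ hn.1.2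
        refine ⟨p, ?_, i, mem_Ioc.mpr ⟨hi, hiy⟩, rfl⟩
        by_contra hpz
        apply hn.2
        intro r hr hrp
        have hr' := Nat.mem_primesBelow.mp hr
        have := (Nat.prime_dvd_prime_iff_eq hr'.2 hp).mp (hr'.2.dvd_of_dvd_pow hrp)
        exact hpz (this ▸ hr))
    refine h3.trans ?_
    have h4 := sum_log_div_prime_le z (by omega)
    calc _ = 2 * ∑ p ∈ z.primesBelow, Real.log p / p := by
          rw [mul_sum]
          apply sum_congr rfl
          intro p _
          rw [zero_add, pow_one]; ring
      _ ≤ _ := by linarith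
  have h3 : 0 ≤ ∑ n ∈ Ioc 0 y with ¬ IsRough z n, Λ n / n :=
    sum_nonneg fun n _ => div_nonneg vonMangoldt_nonneg (by positivity)
  have h4 := sum_filter_add_sum_filter_not (Ioc 0 y) (IsRough z) fun n => Λ n / (n : ℝ)
  have hlz := Real.log_natCast_nonneg z
  rw [abs_le] at h1 ⊢
  constructor <;> linarith [h1.1, h1.2]

theorem abs_log_div_sub_le {a y : ℕ} (ha : 1 ≤ a) (hay : a ≤ y) :
    |Real.log ((y / a : ℕ) : ℝ) - (Real.log y - Real.log a)| ≤ 1 := by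
  have hq : 1 ≤ y / a := (Nat.one_le_div_iff ha).mpr hay
  have ha0 : (0 : ℝ) < a := by exact_mod_cast ha
  have hy0 : (0 : ℝ) < y := by exact_mod_cast ha.trans hay
  have hq0 : (0 : ℝ) < ((y / a : ℕ) : ℝ) := by exact_mod_cast hq
  have h1 : a * (y / a) ≤ y := Nat.mul_div_le y a
  have h2 : y ≤ 2 * (a * (y / a)) := by
    have := Nat.lt_mul_div_succ y ha
    nlinarith
  have h1' : Real.log a + Real.log ((y / a : ℕ) : ℝ) ≤ Real.log y := by
    rw [← Real.log_mul ha0.ne' hq0.ne']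
    exact Real.log_le_log (by positivity) (by exact_mod_cast h1)
  have h2' : Real.log y ≤ Real.log 2 + (Real.log a + Real.log ((y / a : ℕ) : ℝ)) := by
    rw [← Real.log_mul ha0.ne' hq0.ne', ← Real.log_mul (by norm_num) (by positivity)]
    exact Real.log_le_log hy0 (by exact_mod_cast h2)
  have h3 : Real.log 2 ≤ 1 := by linarith [Real.log_two_lt_d9]
  rw [abs_le]
  constructor <;> linarith

theorem sum_rough_logPairWeight (z y : ℕ) (hz : 2 ≤ z) (hy : 1 ≤ y) {T : ℝ}
    (hyT : Real.log y ≤ T) (hzT : 2 * Real.log z + 18 ≤ T) :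
    |∑ n ∈ Ioc 0 y with IsRough z n, logPairWeight n / n - Real.log y ^ 2| ≤
      3 * (2 * Real.log z + 19) * T := by
  set E := 2 * Real.log z + 18 with hE
  have hE0 : 0 ≤ E := by have := Real.log_natCast_nonneg z; positivity
  have hG := sum_rough_vonMangoldt z y hz hy
  set G := ∑ n ∈ Ioc 0 y with IsRough z n, Λ n / n with hGdef
  have hly := Real.log_natCast_nonneg y
  have e1 : ∑ n ∈ Ioc 0 y with IsRough z n, logPairWeight n / n =
      ∑ a ∈ Ioc 0 y with IsRough z a, Λ a / a *
        (Real.log a + ∑ b ∈ Ioc 0 (y / a) with IsRough z b, Λ b / b) := by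
    have e2 : ∑ n ∈ Ioc 0 y with IsRough z n, (∑ x ∈ n.divisorsAntidiagonal, Λ x.1 * Λ x.2) / n =
        ∑ a ∈ Ioc 0 y with IsRough z a, Λ a / a *
          ∑ b ∈ Ioc 0 (y / a) with IsRough z b, Λ b / b := by
      simp only [mul_sum]
      rw [← sum_finset_product' ((Ioc 0 y ×ˢ Ioc 0 y).filter fun x : ℕ × ℕ =>
          x.1 * x.2 ≤ y ∧ IsRough z (x.1 * x.2)) ((Ioc 0 y).filter (IsRough z))
          (fun a => (Ioc 0 (y / a)).filter (IsRough z))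
          (f := fun a b : ℕ => Λ a / a * (Λ b / b)) (by
            rintro ⟨a, b⟩
            simp only [mem_filter, mem_product, mem_Ioc, isRough_mul]
            constructor
            · rintro ⟨⟨⟨h1, h2⟩, h3, h4⟩, h5, h6, h7⟩
              exact ⟨⟨⟨h1, h2⟩, h6⟩, ⟨h3, (Nat.le_div_iff_mul_le h1).mpr (by linarith)⟩, h7⟩
            · rintro ⟨⟨⟨h1, h2⟩, h6⟩, ⟨h3, h5⟩, h7⟩
              have h8 := (Nat.le_div_iff_mul_le h1).mp h5
              exact ⟨⟨⟨h1, h2⟩, h3, h5.trans (Nat.div_le_self _ _)⟩, by linarith, h6, h7⟩),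
        ← sum_Ioc_divisorsAntidiagonal y (IsRough z) fun a b => Λ a / a * (Λ b / b)]
      apply sum_congr rfl
      intro n _
      rw [sum_div]
      apply sum_congr rfl
      intro x hx
      rw [← (Nat.mem_divisorsAntidiagonal.mp hx).1]
      push_cast
      rw [div_mul_div_comm]
    simp only [mul_add, sum_add_distrib]
    rw [← e2, ← sum_add_distrib]
    apply sum_congr rfl
    intro n _
    rw [logPairWeight]
    ring
  have h1 : |∑ n ∈ Ioc 0 y with IsRough z n, logPairWeight n / n - G * Real.log y| ≤
      G * (E + 1) := by
    rw [e1, hGdef, sum_mul, ← sum_sub_distrib, sum_mul]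
    refine (abs_sum_le_sum_abs _ _).trans (sum_le_sum fun a ha => ?_)
    rw [mem_filter, mem_Ioc] at ha
    have h0 : 0 ≤ Λ a / (a : ℝ) := div_nonneg vonMangoldt_nonneg (by positivity)
    rw [← mul_sub, abs_mul, abs_of_nonneg h0]
    refine mul_le_mul_of_nonneg_left ?_ h0
    have h2 := sum_rough_vonMangoldt z (y / a) hz ((Nat.one_le_div_iff ha.1.1).mpr ha.1.2)
    have h3 := abs_log_div_sub_le ha.1.1 ha.1.2
    rw [abs_le] at h2 h3 ⊢
    constructor <;> linarith [h2.1, h2.2, h3.1, h3.2]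
  have hG' := abs_le.mp hG
  have hG2 : G ≤ 2 * T := by linarith
  have h2 : |G * Real.log y - Real.log y ^ 2| ≤ E * T := by
    have : G * Real.log y - Real.log y ^ 2 = (G - Real.log y) * Real.log y := by ring
    rw [this, abs_mul, abs_of_nonneg hly]
    exact mul_le_mul hG hyT hly hE0
  have h3 : G * (E + 1) ≤ 2 * T * (E + 1) := mul_le_mul_of_nonneg_right hG2 (by linarith)
  rw [abs_le] at h1 h2 ⊢
  constructor <;> nlinarith [h1.1, h1.2, h2.1, h2.2]

end Linnik

namespace Linnik

open Finset ArithmeticFunction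

/-- The reduced residue class of `n`, with junk value `1` when `n` is not coprime to `q`. -/
noncomputable def unitClass (q n : ℕ) : (ZMod q)ˣ :=
  if h : n.Coprime q then ZMod.unitOfCoprime n h else 1

theorem coe_unitClass {q n : ℕ} (h : n.Coprime q) : ((unitClass q n : (ZMod q)ˣ) : ZMod q) = n := by
  rw [unitClass, dif_pos h, ZMod.coe_unitOfCoprime]

theorem unitClass_eq_iff {q n : ℕ} (h : n.Coprime q) (b : (ZMod q)ˣ) :
    unitClass q n = b ↔ ((n : ℕ) : ZMod q) = b := by
  rw [← coe_unitClass h, Units.ext_iff]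

theorem unitClass_mul {q m n : ℕ} (hm : m.Coprime q) (hn : n.Coprime q) :
    unitClass q (m * n) = unitClass q m * unitClass q n := by
  rw [unitClass_eq_iff (hm.mul_left hn), Units.val_mul, coe_unitClass hm, coe_unitClass hn,
    Nat.cast_mul]

theorem abs_totient_mul_class_sub_le {q z y : ℕ} [NeZero q] (hqz : q < z) {f : ℕ → ℝ} {D : ℝ}
    (h : ∀ b b' : ZMod q, IsUnit b → IsUnit b' →
      |∑ n ∈ Ioc 0 y with ((n : ℕ) : ZMod q) = b ∧ IsRough z n, f n -
        ∑ n ∈ Ioc 0 y with ((n : ℕ) : ZMod q) = b' ∧ IsRough z n, f n| ≤ D / q.totient)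
    (b : (ZMod q)ˣ) :
    |q.totient * ∑ n ∈ Ioc 0 y with ((n : ℕ) : ZMod q) = b ∧ IsRough z n, f n -
      ∑ n ∈ Ioc 0 y with IsRough z n, f n| ≤ D := by
  have hφ : (0 : ℝ) < q.totient := by exact_mod_cast Nat.totient_pos.mpr (NeZero.pos q)
  have e1 : ∑ n ∈ Ioc 0 y with IsRough z n, f n =
      ∑ c : (ZMod q)ˣ, ∑ n ∈ Ioc 0 y with ((n : ℕ) : ZMod q) = c ∧ IsRough z n, f n := by
    rw [← sum_fiberwise _ (unitClass q)]
    apply sum_congr rfl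
    intro c _
    rw [filter_filter]
    apply sum_congr _ fun _ _ => rfl
    apply filter_congr
    intro n _
    constructor
    · rintro ⟨h1, h2⟩
      exact ⟨(unitClass_eq_iff (h1.coprime (NeZero.pos q) hqz) c).mp h2, h1⟩
    · rintro ⟨h1, h2⟩
      exact ⟨h2, (unitClass_eq_iff (h2.coprime (NeZero.pos q) hqz) c).mpr h1⟩
  have e2 : (q.totient : ℝ) * ∑ n ∈ Ioc 0 y with ((n : ℕ) : ZMod q) = b ∧ IsRough z n, f n =
      ∑ _c : (ZMod q)ˣ, ∑ n ∈ Ioc 0 y with ((n : ℕ) : ZMod q) = b ∧ IsRough z n, f n := by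
    rw [sum_const, card_univ, ZMod.card_units_eq_totient, nsmul_eq_mul]
  rw [e1, e2, ← sum_sub_distrib]
  refine (abs_sum_le_sum_abs _ _).trans ?_
  refine (sum_le_sum fun (c : (ZMod q)ˣ) _ => h b c (Units.isUnit b) (Units.isUnit c)).trans (le_of_eq ?_)
  rw [sum_const, card_univ, ZMod.card_units_eq_totient, nsmul_eq_mul]
  field_simp

/-- The rough integers up to `z ^ k` with normalised von Mangoldt weights form a Selberg system. -/
theorem selbergSystem_of_equidistributed {q z k : ℕ} [NeZero q] (hqz : q < z) (hz : 3 ≤ z)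
    (hk : 100 ≤ k) {δ : ℝ} (hδ : 0 ≤ δ)
    (h : ∀ y : ℕ, y ≤ z ^ k → ∀ b b' : ZMod q, IsUnit b → IsUnit b' →
      |∑ n ∈ Ioc 0 y with ((n : ℕ) : ZMod q) = b ∧ IsRough z n, logPairWeight n / n -
        ∑ n ∈ Ioc 0 y with ((n : ℕ) : ZMod q) = b' ∧ IsRough z n, logPairWeight n / n| ≤
      δ * (k * Real.log z) ^ 2 / q.totient) :
    SelbergSystem ((Ioc 0 (z ^ k)).filter (IsRough z))
      (fun n => Λ n / n / (k * Real.log z)) (fun n => Real.log n / (k * Real.log z))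
      (unitClass q) (δ + 65 / k) := by
  have hq0 : 0 < q := NeZero.pos q
  have hz0 : (0 : ℝ) < z := by exact_mod_cast (by omega : 0 < z)
  have hl : 1 ≤ Real.log z := by
    rw [Real.le_log_iff_exp_le hz0]
    have h1 := Real.exp_one_lt_d9
    have h2 : (3 : ℝ) ≤ z := by exact_mod_cast hz
    linarith
  have hkR : (100 : ℝ) ≤ k := by exact_mod_cast hk
  have hk0 : (0 : ℝ) < k := by linarith
  set l := Real.log z with hldef
  set T := k * l with hT
  have hT0 : 0 < T := by positivity
  have hTk : k ≤ T := le_mul_of_one_le_right (by positivity) hl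
  have hTexp : Real.exp T = (z : ℝ) ^ k := by
    rw [hT, mul_comm, Real.exp_mul, Real.exp_log hz0, Real.rpow_natCast]
  have hcut : ∀ u : ℝ, 0 ≤ u → u ≤ 1 → ∃ y : ℕ, 1 ≤ y ∧ y ≤ z ^ k ∧ Real.log y ≤ u * T ∧
      u * T ≤ Real.log y + 1 ∧ ∀ n : ℕ, 1 ≤ n → (Real.log n / T ≤ u ↔ n ≤ y) := by
    intro u hu0 hu1
    have hexp1 : (1 : ℝ) ≤ Real.exp (u * T) := Real.one_le_exp (by positivity)
    have hy1 : 1 ≤ ⌊Real.exp (u * T)⌋₊ := (Nat.one_le_floor_iff _).mpr hexp1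
    have hyR : (1 : ℝ) ≤ (⌊Real.exp (u * T)⌋₊ : ℝ) := by exact_mod_cast hy1
    have hfl := Nat.floor_le (Real.exp_pos (u * T)).le
    have hfl2 := Nat.lt_floor_add_one (Real.exp (u * T))
    refine ⟨⌊Real.exp (u * T)⌋₊, hy1, ?_, ?_, ?_, ?_⟩
    · have : Real.exp (u * T) ≤ ((z ^ k : ℕ) : ℝ) := by
        push_cast
        rw [← hTexp]
        exact Real.exp_le_exp.mpr (mul_le_of_le_one_left hT0.le hu1)
      exact Nat.floor_le_of_le this
    · have := Real.log_le_log (by linarith) hfl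
      rwa [Real.log_exp] at this
    · have h1 : Real.exp (u * T) ≤ 2 * (⌊Real.exp (u * T)⌋₊ : ℝ) := by linarith
      have h2 := Real.log_le_log (Real.exp_pos _) h1
      rw [Real.log_exp, Real.log_mul (by norm_num) (by linarith)] at h2
      linarith [Real.log_two_lt_d9]
    · intro n hn
      have hn0 : (0 : ℝ) < n := by exact_mod_cast hn
      rw [div_le_iff₀ hT0, Real.log_le_iff_le_exp hn0, Nat.le_floor_iff (Real.exp_pos _).le]
  have hfilter : ∀ {y : ℕ} {P : ℕ → Prop} [DecidablePred P], y ≤ z ^ k → ∀ {u : ℝ},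
      (∀ n : ℕ, 1 ≤ n → (Real.log n / T ≤ u ↔ n ≤ y)) →
      ((Ioc 0 (z ^ k)).filter (IsRough z)).filter (fun n : ℕ => Real.log n / T ≤ u ∧ P n) =
        (Ioc 0 y).filter fun n => P n ∧ IsRough z n := by
    intro y P _ hy u hu
    ext n
    simp only [mem_filter, mem_Ioc]
    constructor
    · rintro ⟨⟨⟨h1, h2⟩, h3⟩, h4, h5⟩
      exact ⟨⟨h1, (hu n h1).mp h4⟩, h5, h3⟩
    · rintro ⟨⟨h1, h2⟩, h5, h3⟩
      exact ⟨⟨⟨h1, h2.trans hy⟩, h3⟩, (hu n h1).mpr h2, h5⟩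
  have hsmall : (2 * l + 19) / T ≤ 21 / k := by
    rw [hT, div_le_div_iff₀ (by positivity) hk0]
    nlinarith
  have h21 : 3 * (21 / (k : ℝ)) + 2 / k = 65 / k := by ring
  have h21' : 0 ≤ 21 / (k : ℝ) := by positivity
  have h2k : 2 / T ≤ 2 / k := div_le_div_of_nonneg_left (by norm_num) hk0 hTk
  have h2k' : 0 ≤ 2 / (k : ℝ) := by positivity
  refine ⟨?_, ?_, ?_, ?_⟩
  · intro n _
    exact div_nonneg (div_nonneg vonMangoldt_nonneg (by positivity)) hT0.le
  · intro n _
    exact div_nonneg (Real.log_natCast_nonneg n) hT0.le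
  · intro u hu0 hu1
    obtain ⟨y, hy1, hyx, hyu, huy, hiff⟩ := hcut u hu0 hu1
    have e1 : ((Ioc 0 (z ^ k)).filter (IsRough z)).filter (fun n : ℕ => Real.log n / T ≤ u) =
        (Ioc 0 y).filter (IsRough z) := by
      have := hfilter (P := fun _ => True) hyx hiff
      simpa using this
    rw [e1, ← sum_div]
    have h1 := sum_rough_vonMangoldt z y (by omega) hy1
    have e2 : (∑ n ∈ Ioc 0 y with IsRough z n, Λ n / (n : ℝ)) / T - u =
        (∑ n ∈ Ioc 0 y with IsRough z n, Λ n / (n : ℝ) - u * T) / T := by field_simp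
    rw [e2, abs_div, abs_of_pos hT0]
    have h2 : |∑ n ∈ Ioc 0 y with IsRough z n, Λ n / (n : ℝ) - u * T| ≤ 2 * l + 19 := by
      rw [abs_le] at h1 ⊢
      constructor <;> linarith [h1.1, h1.2]
    have h3 : |∑ n ∈ Ioc 0 y with IsRough z n, Λ n / (n : ℝ) - u * T| / T ≤ (2 * l + 19) / T := by
      gcongr
    linarith
  · intro u hu0 hu1 b
    obtain ⟨y, hy1, hyx, hyu, huy, hiff⟩ := hcut u hu0 hu1
    have hlogmul : ∀ x : ℕ × ℕ, 1 ≤ x.1 → 1 ≤ x.2 →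
        (Real.log x.1 / T + Real.log x.2 / T ≤ u ↔ x.1 * x.2 ≤ y) := by
      intro x h1 h2
      have h1' : (x.1 : ℝ) ≠ 0 := by exact_mod_cast (by omega : x.1 ≠ 0)
      have h2' : (x.2 : ℝ) ≠ 0 := by exact_mod_cast (by omega : x.2 ≠ 0)
      rw [← add_div, ← Real.log_mul h1' h2', ← Nat.cast_mul]
      exact hiff _ (Nat.mul_pos h1 h2)
    have e1 : ∑ n ∈ ((Ioc 0 (z ^ k)).filter (IsRough z)) with
          Real.log (n : ℕ) / T ≤ u ∧ unitClass q n = b, Λ n / n / T * (Real.log n / T) =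
        (∑ n ∈ Ioc 0 y with ((n : ℕ) : ZMod q) = b ∧ IsRough z n, Λ n * Real.log n / n) / T ^ 2 := by
      rw [hfilter hyx hiff, sum_div]
      have e3 : (Ioc 0 y).filter (fun n => unitClass q n = b ∧ IsRough z n) =
          (Ioc 0 y).filter (fun n => ((n : ℕ) : ZMod q) = b ∧ IsRough z n) := by
        apply filter_congr
        intro n _
        exact and_congr_left fun h => unitClass_eq_iff (h.coprime hq0 hqz) b
      rw [e3]
      apply sum_congr rfl
      intro n _
      field_simp
    have e2 : ∑ x ∈ ((Ioc 0 (z ^ k)).filter (IsRough z)) ×ˢ ((Ioc 0 (z ^ k)).filter (IsRough z)) with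
          Real.log x.1 / T + Real.log x.2 / T ≤ u ∧ unitClass q x.1 * unitClass q x.2 = b,
          Λ x.1 / x.1 / T * (Λ x.2 / x.2 / T) =
        (∑ n ∈ Ioc 0 y with ((n : ℕ) : ZMod q) = b ∧ IsRough z n,
          (∑ x ∈ n.divisorsAntidiagonal, Λ x.1 * Λ x.2) / n) / T ^ 2 := by
      have e4 : ∑ n ∈ Ioc 0 y with ((n : ℕ) : ZMod q) = b ∧ IsRough z n,
          (∑ x ∈ n.divisorsAntidiagonal, Λ x.1 * Λ x.2) / n =
          ∑ n ∈ Ioc 0 y with ((n : ℕ) : ZMod q) = b ∧ IsRough z n,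
          ∑ x ∈ n.divisorsAntidiagonal, Λ x.1 / x.1 * (Λ x.2 / x.2) := by
        apply sum_congr rfl
        intro n _
        rw [sum_div]
        apply sum_congr rfl
        intro x hx
        rw [← (Nat.mem_divisorsAntidiagonal.mp hx).1]
        push_cast
        rw [div_mul_div_comm]
      rw [e4, sum_Ioc_divisorsAntidiagonal y (fun n => ((n : ℕ) : ZMod q) = b ∧ IsRough z n)
        (fun a b => Λ a / a * (Λ b / b)), sum_div]
      refine sum_congr ?_ fun x _ => by field_simp
      ext x
      simp only [mem_filter, mem_product, mem_Ioc, isRough_mul]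
      constructor
      · rintro ⟨⟨⟨⟨h1, h2⟩, h3⟩, ⟨h4, h5⟩, h6⟩, h7, h8⟩
        have h9 := (hlogmul x h1 h4).mp h7
        refine ⟨⟨⟨h1, (Nat.le_mul_of_pos_right _ h4).trans h9⟩, h4,
          (Nat.le_mul_of_pos_left _ h1).trans h9⟩, h9, ?_, h3, h6⟩
        rw [← h8, Units.val_mul, coe_unitClass (h3.coprime hq0 hqz),
          coe_unitClass (h6.coprime hq0 hqz), Nat.cast_mul]
      · rintro ⟨⟨⟨h1, h2⟩, h4, h5⟩, h9, h8, h3, h6⟩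
        refine ⟨⟨⟨⟨h1, h2.trans hyx⟩, h3⟩, ⟨h4, h5.trans hyx⟩, h6⟩, (hlogmul x h1 h4).mpr h9, ?_⟩
        have c1 := h3.coprime hq0 hqz
        have c2 := h6.coprime hq0 hqz
        rw [← unitClass_mul c1 c2]
        exact (unitClass_eq_iff (c1.mul_left c2) b).mpr h8
    rw [e1, e2, ← add_div, ← sum_add_distrib, ZMod.card_units_eq_totient]
    have e5 : ∑ n ∈ Ioc 0 y with ((n : ℕ) : ZMod q) = b ∧ IsRough z n,
        (Λ n * Real.log n / n + (∑ x ∈ n.divisorsAntidiagonal, Λ x.1 * Λ x.2) / n) =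
        ∑ n ∈ Ioc 0 y with ((n : ℕ) : ZMod q) = b ∧ IsRough z n, logPairWeight n / n := by
      apply sum_congr rfl
      intro n _
      rw [logPairWeight, add_div]
    rw [e5]
    have h1 := abs_totient_mul_class_sub_le hqz (h y hyx) b
    have h2 := sum_rough_logPairWeight z y (by omega) hy1 (T := T) (by nlinarith) (by nlinarith)
    have hly := Real.log_natCast_nonneg y
    have huT : u * T ≤ T := mul_le_of_le_one_left hT0.le hu1
    have h3 : |Real.log y ^ 2 - (u * T) ^ 2| ≤ 2 * T := by
      rw [abs_le]
      constructor <;> nlinarith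
    set S := (q.totient : ℝ) *
      ∑ n ∈ Ioc 0 y with ((n : ℕ) : ZMod q) = b ∧ IsRough z n, logPairWeight n / n with hS
    have h4 : |S - (u * T) ^ 2| ≤ δ * T ^ 2 + 3 * (2 * l + 19) * T + 2 * T := by
      rw [abs_le] at h1 h2 h3 ⊢
      constructor <;> linarith [h1.1, h1.2, h2.1, h2.2, h3.1, h3.2]
    have e6 : (q.totient : ℝ) * ((∑ n ∈ Ioc 0 y with ((n : ℕ) : ZMod q) = b ∧ IsRough z n,
        logPairWeight n / n) / T ^ 2) - u ^ 2 = (S - (u * T) ^ 2) / T ^ 2 := by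
      rw [hS]; field_simp
    rw [e6, abs_div, abs_of_pos (by positivity : 0 < T ^ 2)]
    calc _ ≤ (δ * T ^ 2 + 3 * (2 * l + 19) * T + 2 * T) / T ^ 2 := by gcongr
      _ = δ + 3 * ((2 * l + 19) / T) + 2 / T := by field_simp
      _ ≤ _ := by linarith

end Linnik

namespace Linnik

open Finset ArithmeticFunction

/-- The character of `(ZMod q)ˣ` attached to a Dirichlet character. -/
noncomputable def unitHom {q : ℕ} (χ : DirichletCharacter ℂ q) : (ZMod q)ˣ →* ℂ :=
  χ.toMonoidHom.comp (Units.coeHom (ZMod q))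

theorem unitHom_apply {q : ℕ} (χ : DirichletCharacter ℂ q) (g : (ZMod q)ˣ) :
    unitHom χ g = χ (g : ZMod q) := rfl

/-- A sign-valued homomorphism on units extends to a real multiplicative character. -/
theorem exists_mulChar_of_sign_hom {q : ℕ} (f : (ZMod q)ˣ →* ℂ) (hf : ∀ g, f g = 1 ∨ f g = -1) :
    ∃ χ : MulChar (ZMod q) ℝ, (∀ g : (ZMod q)ˣ, χ (g : ZMod q) = 1 ∨ χ (g : ZMod q) = -1) ∧
      ∀ g : (ZMod q)ˣ, χ (g : ZMod q) = 1 ↔ f g = 1 := by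
  classical
  have hne : (-1 : ℂ) ≠ 1 := by norm_num
  let h : (ZMod q)ˣ →* ℝˣ :=
    { toFun := fun g => if f g = 1 then 1 else -1
      map_one' := by simp
      map_mul' := by
        intro a b
        rcases hf a with h1 | h1 <;> rcases hf b with h2 | h2 <;> simp [h1, h2, hne] }
  have happ : ∀ g : (ZMod q)ˣ, (MulChar.ofUnitHom h) (g : ZMod q) =
      if f g = 1 then (1 : ℝ) else -1 := by
    intro g
    rw [MulChar.ofUnitHom_coe]
    show (((if f g = 1 then (1 : ℝˣ) else -1) : ℝˣ) : ℝ) = _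
    split_ifs <;> simp
  refine ⟨MulChar.ofUnitHom h, fun g => ?_, fun g => ?_⟩
  · rw [happ]; split_ifs
    · exact Or.inl rfl
    · exact Or.inr rfl
  · rw [happ]; split_ifs with h1
    · simp [h1]
    · constructor
      · intro h2; norm_num at h2
      · intro h2; exact absurd h2 h1

theorem sum_log_prime_sq_le {z x : ℕ} (hz : 2 ≤ z) (hzx : z ≤ x) :
    ∑ p ∈ (Ioc (z - 1) x).filter Nat.Prime, 2 * Real.log p * ((p : ℝ)⁻¹) ^ (1 + 1) ≤
      4 * Real.log x / z := by
  have h1 := sum_Ioc_inv_sq_le_sub (α := ℝ) (k := z - 1) (n := x) (by omega) (by omega)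
  have hlx := Real.log_natCast_nonneg x
  have h2 : ∀ p ∈ (Ioc (z - 1) x).filter Nat.Prime,
      2 * Real.log p * ((p : ℝ)⁻¹) ^ (1 + 1) ≤ 2 * Real.log x * ((p : ℝ) ^ 2)⁻¹ := by
    intro p hp
    rw [mem_filter, mem_Ioc] at hp
    have h3 : Real.log p ≤ Real.log x :=
      Real.log_le_log (by exact_mod_cast hp.2.pos) (by exact_mod_cast hp.1.2)
    rw [inv_pow]
    gcongr
  refine (sum_le_sum h2).trans ?_
  rw [← mul_sum]
  have h4 : ∑ p ∈ (Ioc (z - 1) x).filter Nat.Prime, ((p : ℝ) ^ 2)⁻¹ ≤ 2 / z := by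
    refine (sum_le_sum_of_subset_of_nonneg (filter_subset _ _) fun _ _ _ => by positivity).trans ?_
    have hx0 : (0 : ℝ) ≤ (x : ℝ)⁻¹ := by positivity
    refine h1.trans ?_
    have hz2 : (2 : ℝ) ≤ z := by exact_mod_cast hz
    rw [Nat.cast_sub (by omega), Nat.cast_one]
    have : ((z : ℝ) - 1)⁻¹ ≤ 2 / z := by
      rw [inv_eq_one_div, div_le_div_iff₀ (by linarith) (by linarith)]; linarith
    linarith
  calc _ ≤ 2 * Real.log x * (2 / z) := by gcongr
    _ = _ := by ring

/-- Either a class contains a small prime, or primes are governed by a real character. -/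
theorem exists_prime_or_exceptional (n j k₀ : ℕ) (hn : 1000 ≤ n) (hj : 1 ≤ j) :
    ∃ k : ℕ, k₀ ≤ k ∧ 1 ≤ k ∧ j ∣ k ∧ ∃ Z : ℕ, ∀ z₁ : ℕ, Z ≤ z₁ → ∀ q : ℕ, q < z₁ →
      ∀ z : ℕ, z = z₁ ^ 1300 → ∀ _ : NeZero q, ∀ a : (ZMod q)ˣ,
      (∃ p : ℕ, p.Prime ∧ ((p : ℕ) : ZMod q) = a ∧ p ≤ z ^ k) ∨
      ∃ χ : MulChar (ZMod q) ℝ, (∀ g : (ZMod q)ˣ, χ (g : ZMod q) = 1 ∨ χ (g : ZMod q) = -1) ∧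
        χ ≠ 1 ∧ χ (a : ZMod q) = 1 ∧ ∀ Y : ℕ, Y ^ 4 ≤ z ^ k →
        ∑ p ∈ Ioc 0 Y with p.Prime ∧ z ≤ p ∧ χ ((p : ℕ) : ZMod q) = 1, Real.log p / p ≤
          16 / n * (k * Real.log z) := by
  have hn0 : (0 : ℝ) < n := by exact_mod_cast (by omega : 0 < n)
  set δ : ℝ := 1 / (2 * (n : ℝ) ^ 8) with hδ
  have hδ0 : 0 < δ := by positivity
  obtain ⟨k, hk1, hk2, hk3, Z, hZ⟩ := logPair_equidistributed δ hδ0 j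
    (max (max k₀ 100) (130 * n ^ 8)) hj
  have hkk0 : k₀ ≤ k := (le_max_left _ _).trans ((le_max_left _ _).trans hk1)
  have hk100 : 100 ≤ k := (le_max_right _ _).trans ((le_max_left _ _).trans hk1)
  have hkn : 130 * n ^ 8 ≤ k := (le_max_right _ _).trans hk1
  refine ⟨k, hkk0, hk2, hk3, max (max Z 3) (8 * n ^ 8), ?_⟩
  intro z₁ hz₁ q hq z hz hNZ a
  have hz₁Z : Z ≤ z₁ := (le_max_left _ _).trans ((le_max_left _ _).trans hz₁)
  have hz₁3 : 3 ≤ z₁ := (le_max_right _ _).trans ((le_max_left _ _).trans hz₁)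
  have hz₁n : 8 * n ^ 8 ≤ z₁ := (le_max_right _ _).trans hz₁
  have hz1z : z₁ ≤ z := by rw [hz]; exact Nat.le_self_pow (by norm_num) _
  have hqz : q < z := hq.trans_le hz1z
  have hS := selbergSystem_of_equidistributed hqz (hz₁3.trans hz1z) hk100 hδ0.le
    (fun y hy b b' => hZ z₁ hz₁Z q hq z hz hNZ y hy b b')
  have hδ' : δ + 65 / k ≤ 1 / (n : ℝ) ^ 8 := by
    have h1 : 65 / (k : ℝ) ≤ 1 / (2 * (n : ℝ) ^ 8) := by
      have hkR : 130 * (n : ℝ) ^ 8 ≤ k := by exact_mod_cast hkn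
      rw [div_le_div_iff₀ (by exact_mod_cast (by omega : 0 < k)) (by positivity)]
      linarith
    have h2 : 1 / (n : ℝ) ^ 8 = δ + 1 / (2 * (n : ℝ) ^ 8) := by rw [hδ]; field_simp; norm_num
    linarith
  by_cases hp : ∃ p : ℕ, p.Prime ∧ ((p : ℕ) : ZMod q) = a ∧ p ≤ z ^ k
  · exact Or.inl hp
  right
  push Not at hp
  have hq0 : 0 < q := NeZero.pos q
  have hz0 : (0 : ℝ) < z := by exact_mod_cast (by omega : 0 < z)
  have hlz : 0 < Real.log z := Real.log_pos (by exact_mod_cast (by omega : 1 < z))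
  have hkR : (0 : ℝ) < k := by exact_mod_cast (by omega : 0 < k)
  set T := k * Real.log z with hT
  have hT0 : 0 < T := by positivity
  have hlogx : Real.log ((z ^ k : ℕ) : ℝ) = T := by push_cast; rw [Real.log_pow]
  have hN : (Fintype.card (ZMod q)ˣ : ℝ) * ∑ n ∈ (Ioc 0 (z ^ k)).filter (IsRough z) with
      Real.log (n : ℕ) / T ≤ 1 ∧ unitClass q n = a, Λ n / n / T * (Real.log n / T) ≤
      δ + 65 / k := by
    have h1 : ∑ n ∈ (Ioc 0 (z ^ k)).filter (IsRough z) with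
        Real.log (n : ℕ) / T ≤ 1 ∧ unitClass q n = a, Λ n / n / T * (Real.log n / T) ≤
        (∑ n ∈ (Ioc 0 (z ^ k)).filter (IsRough z) with
        Real.log (n : ℕ) / T ≤ 1 ∧ unitClass q n = a, Λ n / n) / T := by
      rw [sum_div]
      apply sum_le_sum
      intro m hm
      rw [mem_filter] at hm
      exact mul_le_of_le_one_right
        (div_nonneg (div_nonneg vonMangoldt_nonneg (by positivity)) hT0.le) hm.2.1
    have h2 := sum_vonMangoldt_le_of_prime_pow
      (S := ((Ioc 0 (z ^ k)).filter (IsRough z)).filter fun n : ℕ =>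
        Real.log n / T ≤ 1 ∧ unitClass q n = a)
      (Q := (Ioc (z - 1) (z ^ k)).filter Nat.Prime) (M := 1) (y := z ^ k)
      (fun p hp => (mem_filter.mp hp).2) (by
        intro m hm hΛ
        rw [mem_filter, mem_filter, mem_Ioc] at hm
        obtain ⟨p, i, hpp, hi, hiy, rfl⟩ := exists_prime_pow_of_vonMangoldt_ne_zero hΛ hm.1.1.2
        have hpd : p ∣ p ^ i := dvd_pow_self p hi.ne'
        have hzp := hm.1.2.le_prime hpp hpd
        have hpx : p ≤ z ^ k := (Nat.le_of_dvd hm.1.1.1 hpd).trans hm.1.1.2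
        refine ⟨p, mem_filter.mpr ⟨mem_Ioc.mpr ⟨by omega, hpx⟩, hpp⟩, i, mem_Ioc.mpr ⟨?_, hiy⟩, rfl⟩
        by_contra hi1
        have hi1 : i = 1 := by omega
        rw [hi1, pow_one] at hm
        exact absurd hpx (not_le.mpr
          (hp p hpp ((unitClass_eq_iff (hm.1.2.coprime hq0 hqz) a).mp hm.2.2))))
    have h3 := sum_log_prime_sq_le (x := z ^ k) (by omega : 2 ≤ z) (Nat.le_self_pow (by omega) z)
    rw [hlogx] at h3
    have h4 := h2.trans h3
    have h5 := h1.trans (div_le_div_of_nonneg_right h4 hT0.le)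
    have h6 : 4 * T / z / T = 4 / z := by field_simp
    rw [h6] at h5
    rw [ZMod.card_units_eq_totient]
    have h7 : (q.totient : ℝ) ≤ z₁ := by exact_mod_cast (Nat.totient_le q).trans hq.le
    have h8 : (z₁ : ℝ) * z₁ ≤ z := by
      have : z₁ * z₁ ≤ z := by
        rw [hz, ← sq]; exact Nat.pow_le_pow_right (by omega) (by norm_num)
      exact_mod_cast this
    have h9 : 8 * (n : ℝ) ^ 8 ≤ z₁ := by exact_mod_cast hz₁n
    have h10 : 0 < 65 / (k : ℝ) := by positivity
    have hz₁0 : (0 : ℝ) < z₁ := by exact_mod_cast (by omega : 0 < z₁)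
    calc _ ≤ (z₁ : ℝ) * (4 / z) := by gcongr
      _ ≤ 4 / z₁ := by
        rw [mul_div_assoc', div_le_div_iff₀ hz0 hz₁0]; nlinarith
      _ ≤ δ := by
        rw [hδ, div_le_div_iff₀ hz₁0 (by positivity)]; linarith
      _ ≤ _ := by linarith
  let _ : Fintype (DirichletCharacter ℂ q) := Fintype.ofFinite _
  obtain ⟨i, hi1, ⟨g₀, hg₀⟩, hi3, hi4⟩ := hS.exists_real_character (fun i => unitHom i)
    (by
      intro g
      have h1 := DirichletCharacter.sum_characters_eq ℂ (n := q) (g : ZMod q)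
      simp only [unitHom_apply]
      rw [ZMod.card_units_eq_totient]
      simp only [Units.val_eq_one] at h1
      convert h1) hn hδ' hN
  obtain ⟨χ, hχ1, hχ2⟩ := exists_mulChar_of_sign_hom (unitHom i) hi1
  refine ⟨χ, hχ1, ?_, (hχ2 a).mpr hi3, ?_⟩
  · rintro rfl
    exact hg₀ ((hχ2 g₀).mp (MulChar.one_apply_coe g₀))
  · intro Y hY
    have h1 : ∑ p ∈ Ioc 0 Y with p.Prime ∧ z ≤ p ∧ χ ((p : ℕ) : ZMod q) = 1,
        Λ p / p / T ≤ 16 / n := by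
      refine le_trans (sum_le_sum_of_subset_of_nonneg ?_ fun m _ _ =>
        div_nonneg (div_nonneg vonMangoldt_nonneg (by positivity)) hT0.le) hi4
      intro p hp
      simp only [mem_filter, mem_Ioc] at hp ⊢
      obtain ⟨⟨hp0, hpY⟩, hpp, hzp, hχp⟩ := hp
      have hp4 : p ^ 4 ≤ z ^ k := (Nat.pow_le_pow_left hpY 4).trans hY
      have hr : IsRough z p := by
        intro r hr hrp
        have hr' := Nat.mem_primesBelow.mp hr
        have := (Nat.prime_dvd_prime_iff_eq hr'.2 hpp).mp hrp
        omega
      refine ⟨⟨⟨hp0, (Nat.le_self_pow (by norm_num) p).trans hp4⟩, hr⟩, ?_, ?_⟩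
      · rw [div_le_iff₀ hT0, ← hlogx]
        have h2 : Real.log ((p ^ 4 : ℕ) : ℝ) ≤ Real.log ((z ^ k : ℕ) : ℝ) :=
          Real.log_le_log (by exact_mod_cast pow_pos hp0 4) (by exact_mod_cast hp4)
        push_cast at h2 ⊢
        rw [Real.log_pow (n := 4)] at h2
        push_cast at h2
        linarith
      · rw [← hχ2, coe_unitClass (hr.coprime hq0 hqz)]
        exact hχp
    rw [← sum_div, div_le_iff₀ hT0] at h1
    refine le_trans (le_of_eq ?_) h1
    apply sum_congr rfl
    intro p hp
    rw [vonMangoldt_apply_prime (mem_filter.mp hp).2.1]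

end Linnik

namespace Linnik

open Finset ArithmeticFunction

open scoped ArithmeticFunction.zeta

/-- A quadratic character: real with values `±1` on units, and nontrivial. -/
def IsQuadraticChar {q : ℕ} (χ : MulChar (ZMod q) ℝ) : Prop :=
  (∀ g : (ZMod q)ˣ, χ (g : ZMod q) = 1 ∨ χ (g : ZMod q) = -1) ∧ χ ≠ 1

variable {q : ℕ} [NeZero q] {χ : MulChar (ZMod q) ℝ}

theorem IsQuadraticChar.cases (h : IsQuadraticChar χ) (x : ZMod q) :
    χ x = 0 ∨ χ x = 1 ∨ χ x = -1 := by
  by_cases hx : IsUnit x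
  · obtain ⟨u, rfl⟩ := hx
    exact Or.inr (h.1 u)
  · exact Or.inl (χ.map_nonunit hx)

theorem IsQuadraticChar.abs_le_one (h : IsQuadraticChar χ) (x : ZMod q) : |χ x| ≤ 1 := by
  rcases h.cases x with h | h | h <;> rw [h] <;> norm_num

theorem sum_range_zmod (F : ZMod q → ℝ) : ∑ i ∈ range q, F ((i : ℕ) : ZMod q) = ∑ x, F x := by
  refine sum_nbij' (fun i => ((i : ℕ) : ZMod q)) (fun x => x.val) ?_ ?_ ?_ ?_ ?_
  · intro i _; exact mem_univ _
  · intro x _; exact mem_range.mpr (ZMod.val_lt x)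
  · intro i hi; exact ZMod.val_cast_of_lt (mem_range.mp hi)
  · intro x _; exact ZMod.natCast_zmod_val x
  · intro i _; rfl

theorem IsQuadraticChar.abs_sum_le (h : IsQuadraticChar χ) (M : ℕ) :
    |∑ n ∈ Ioc 0 M, χ ((n : ℕ) : ZMod q)| ≤ q := by
  have key : ∀ M : ℕ, |∑ n ∈ range M, χ (((n : ℕ) : ZMod q) + 1)| ≤ q := by
    intro M
    induction M using Nat.strong_induction_on with
    | _ M ih =>
      rcases lt_or_ge M q with hM | hM
      · calc |∑ n ∈ range M, χ (((n : ℕ) : ZMod q) + 1)|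
            ≤ ∑ n ∈ range M, |χ (((n : ℕ) : ZMod q) + 1)| := abs_sum_le_sum_abs _ _
          _ ≤ ∑ n ∈ range M, 1 := sum_le_sum fun n _ => h.abs_le_one _
          _ = M := by simp
          _ ≤ q := by exact_mod_cast hM.le
      · obtain ⟨M', rfl⟩ := Nat.exists_eq_add_of_le hM
        rw [sum_range_add]
        have h1 : ∑ n ∈ range q, χ (((n : ℕ) : ZMod q) + 1) = 0 := by
          rw [sum_range_zmod (fun x => χ (x + 1))]
          refine (Equiv.sum_comp (Equiv.addRight (1 : ZMod q)) (fun x => χ x)).trans ?_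
          exact MulChar.sum_eq_zero_of_ne_one h.2
        rw [h1, zero_add]
        have h2 : ∑ x ∈ range M', χ (((q + x : ℕ) : ZMod q) + 1) =
            ∑ n ∈ range M', χ (((n : ℕ) : ZMod q) + 1) := by
          apply sum_congr rfl
          intro n _
          simp
        rw [h2]
        exact ih M' (by have := NeZero.pos q; omega)
  have := key M
  have h2 : ∀ M : ℕ, ∑ n ∈ Ioc 0 M, χ ((n : ℕ) : ZMod q) =
      ∑ n ∈ range M, χ (((n : ℕ) : ZMod q) + 1) := by
    intro M
    induction M with
    | zero => simp
    | succ M ih => rw [sum_Ioc_succ_top (Nat.zero_le M), sum_range_succ, ih]; push_cast; rfl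
  rwa [h2]

theorem IsQuadraticChar.abs_sum_Ioc_le (h : IsQuadraticChar χ) {M Y : ℕ} (hMY : M ≤ Y) :
    |∑ n ∈ Ioc M Y, χ ((n : ℕ) : ZMod q)| ≤ 2 * q := by
  have h1 := sum_Ioc_consecutive (fun n : ℕ => χ (n : ZMod q)) (Nat.zero_le M) hMY
  have h2 := h.abs_sum_le M
  have h3 := h.abs_sum_le Y
  rw [← h1] at h3
  rw [abs_le] at *
  constructor <;> linarith

theorem IsQuadraticChar.exists_lseries (h : IsQuadraticChar χ) :
    ∃ l : ℝ, ∀ K : ℕ, |∑ d ∈ Ioc 0 K, χ ((d : ℕ) : ZMod q) / (d : ℕ) - l| ≤ 2 * q / (K + 1) := by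
  set S : ℕ → ℝ := fun K => ∑ d ∈ Ioc 0 K, χ ((d : ℕ) : ZMod q) / (d : ℕ) with hS
  have hdiff : ∀ M Y, M ≤ Y → |S Y - S M| ≤ 2 * q / (M + 1) := by
    intro M Y hMY
    have h1 := abs_sum_mul_antitone_le (φ := fun m => (m : ℝ)⁻¹)
      (e := fun m => χ ((m : ℕ) : ZMod q)) (B := 2 * q) (M := M) (Y := Y)
      (fun m _ => by positivity)
      (fun m hm => by
        have : (0 : ℝ) < m := by exact_mod_cast (by omega : 0 < m)
        push_cast
        gcongr
        linarith) hMY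
      (fun y hy _ => h.abs_sum_Ioc_le hy)
    have h2 := sum_Ioc_consecutive (fun d : ℕ => χ (d : ZMod q) / d) (Nat.zero_le M) hMY
    have h3 : S Y - S M = ∑ m ∈ Ioc M Y, (m : ℝ)⁻¹ * χ ((m : ℕ) : ZMod q) := by
      simp only [hS]
      rw [← h2, add_sub_cancel_left]
      apply sum_congr rfl
      intro d _
      rw [div_eq_inv_mul]
    rw [h3]
    refine h1.trans (le_of_eq ?_)
    push_cast
    rw [div_eq_mul_inv]
  have hlim : Filter.Tendsto (fun N : ℕ => (2 * q : ℝ) / (N + 1)) Filter.atTop (nhds 0) := by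
    have := tendsto_const_div_atTop_nhds_zero_nat (2 * q : ℝ)
    have h2 := (Filter.tendsto_add_atTop_iff_nat 1).mpr this
    refine h2.congr fun n => by push_cast; rfl
  have hc : CauchySeq S := by
    refine cauchySeq_of_le_tendsto_0' (fun N => (2 * q : ℝ) / (N + 1)) ?_ hlim
    intro n m hnm
    rw [Real.dist_eq, abs_sub_comm]
    exact hdiff n m hnm
  obtain ⟨l, hl⟩ := cauchySeq_tendsto_of_complete hc
  refine ⟨l, fun K => ?_⟩
  have h1 : Filter.Tendsto (fun Y => |S Y - S K|) Filter.atTop (nhds |l - S K|) :=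
    (hl.sub_const _).abs
  rw [abs_sub_comm]
  exact le_of_tendsto h1 (Filter.eventually_atTop.mpr ⟨K, fun Y hY => hdiff K Y hY⟩)

/-- The arithmetic function attached to a character. -/
noncomputable def charFun {q : ℕ} (χ : MulChar (ZMod q) ℝ) : ArithmeticFunction ℝ :=
  ⟨fun n => if n = 0 then 0 else χ (n : ZMod q), if_pos rfl⟩

theorem charFun_apply {q : ℕ} {χ : MulChar (ZMod q) ℝ} {n : ℕ} (hn : n ≠ 0) : charFun χ n = χ (n : ZMod q) := if_neg hn

theorem isMultiplicative_charFun : (charFun χ).IsMultiplicative := by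
  rw [IsMultiplicative.iff_ne_zero]
  refine ⟨by rw [charFun_apply one_ne_zero]; simp, ?_⟩
  intro m n hm hn _
  rw [charFun_apply hm, charFun_apply hn, charFun_apply (mul_ne_zero hm hn)]
  simp

/-- The divisor sum of a character. -/
noncomputable def charDivisorSum {q : ℕ} (χ : MulChar (ZMod q) ℝ) : ArithmeticFunction ℝ :=
  charFun χ * ζ

theorem charDivisorSum_apply (n : ℕ) :
    charDivisorSum χ n = ∑ d ∈ n.divisors, χ ((d : ℕ) : ZMod q) := by
  rw [charDivisorSum, coe_mul_zeta_apply]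
  apply sum_congr rfl
  intro d hd
  exact charFun_apply (Nat.pos_of_mem_divisors hd).ne'

theorem isMultiplicative_charDivisorSum : (charDivisorSum χ).IsMultiplicative :=
  isMultiplicative_charFun.mul isMultiplicative_zeta.natCast

theorem charDivisorSum_prime_pow {p : ℕ} (hp : p.Prime) (k : ℕ) :
    charDivisorSum χ (p ^ k) = ∑ i ∈ range (k + 1), χ ((p : ℕ) : ZMod q) ^ i := by
  rw [charDivisorSum_apply, Nat.sum_divisors_prime_pow hp]
  simp

theorem charDivisorSum_prime_mul {p m : ℕ} (hp : p.Prime) (hpm : ¬ p ∣ m) :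
    charDivisorSum χ (p * m) = (1 + χ ((p : ℕ) : ZMod q)) * charDivisorSum χ m := by
  rw [isMultiplicative_charDivisorSum.map_mul_of_coprime
    ((Nat.Prime.coprime_iff_not_dvd hp).mpr hpm)]
  have := charDivisorSum_prime_pow (χ := χ) hp 1
  rw [pow_one] at this
  rw [this]
  simp [sum_range_succ]

theorem IsQuadraticChar.charDivisorSum_nonneg (h : IsQuadraticChar χ) (n : ℕ) :
    0 ≤ charDivisorSum χ n := by
  rcases eq_or_ne n 0 with rfl | hn
  · simp
  rw [isMultiplicative_charDivisorSum.multiplicative_factorization _ hn]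
  apply prod_nonneg
  intro p hp
  dsimp only
  rw [charDivisorSum_prime_pow (Nat.prime_of_mem_primeFactors hp)]
  rcases h.cases ((p : ℕ) : ZMod q) with h | h | h <;> rw [h]
  · exact sum_nonneg fun i _ => by positivity
  · exact sum_nonneg fun i _ => by positivity
  · rw [neg_one_geom_sum]; split_ifs <;> norm_num

theorem IsQuadraticChar.one_le_charDivisorSum_sq (h : IsQuadraticChar χ) {m : ℕ} (hm : m ≠ 0) :
    1 ≤ charDivisorSum χ (m ^ 2) := by
  rw [isMultiplicative_charDivisorSum.multiplicative_factorization _ (pow_ne_zero 2 hm),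
    Finsupp.prod]
  refine prod_induction _ (fun x : ℝ => 1 ≤ x) (fun _ _ => one_le_mul_of_one_le_of_one_le) le_rfl ?_
  intro p hp
  rw [charDivisorSum_prime_pow (Nat.prime_of_mem_primeFactors hp), Nat.factorization_pow]
  have h0 : ∀ k : ℕ, ∑ i ∈ range (2 * k + 1), (0 : ℝ) ^ i = 1 := by
    intro k; rw [sum_range_succ']; simp
  simp only [Finsupp.smul_apply, smul_eq_mul]
  rcases h.cases ((p : ℕ) : ZMod q) with h | h | h <;> rw [h]
  · rw [h0]
  · simp
  · rw [neg_one_geom_sum, if_neg (by simp)]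

theorem IsQuadraticChar.charDivisorSum_le (h : IsQuadraticChar χ) (n : ℕ) :
    charDivisorSum χ n ≤ #n.divisors := by
  rw [charDivisorSum_apply, ← nsmul_one]
  exact sum_le_card_nsmul _ _ _ fun d _ => (le_abs_self _).trans (h.abs_le_one _)

end Linnik

namespace Linnik

open Finset ArithmeticFunction

theorem mul_pow_le_geom_sum (t : ℝ) (n : ℕ) :
    (n + 1) * t ^ n ≤ ∑ i ∈ range (n + 1), (t ^ 2) ^ i := by
  have h1 := sum_range_reflect (fun i => (t ^ 2) ^ i) (n + 1)
  have h2 : ∑ i ∈ range (n + 1), 2 * t ^ n ≤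
      ∑ i ∈ range (n + 1), ((t ^ 2) ^ (n + 1 - 1 - i) + (t ^ 2) ^ i) := by
    apply sum_le_sum
    intro i hi
    have hi' : i ≤ n := Nat.lt_succ_iff.mp (mem_range.mp hi)
    have h3 : t ^ n = t ^ (n - i) * t ^ i := by rw [← pow_add, Nat.sub_add_cancel hi']
    have h4 : ∀ a : ℕ, (t ^ 2) ^ a = (t ^ a) ^ 2 := fun a => by
      rw [← pow_mul, ← pow_mul, mul_comm]
    rw [h3, Nat.add_sub_cancel, h4, h4]
    nlinarith [sq_nonneg (t ^ (n - i) - t ^ i)]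
  rw [sum_add_distrib, h1, sum_const, card_range, nsmul_eq_mul] at h2
  push_cast at h2
  linarith

/-- The kernel comparing a Lambert series with a Dirichlet series decreases. -/
theorem lambert_kernel_antitone {x : ℝ} (hx0 : 0 < x) (hx1 : x < 1) {d : ℕ} (hd : 1 ≤ d) :
    ((d + 1 : ℕ) : ℝ)⁻¹ - x ^ (d + 1) / ∑ i ∈ range (d + 1), x ^ i ≤
      (d : ℝ)⁻¹ - x ^ d / ∑ i ∈ range d, x ^ i := by
  obtain ⟨e, rfl⟩ := Nat.exists_eq_add_of_le' hd
  set t := √x with ht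
  have ht0 : 0 ≤ t := Real.sqrt_nonneg x
  have htx : t ^ 2 = x := Real.sq_sqrt hx0.le
  have ht1 : t ≤ 1 := by rw [ht]; exact Real.sqrt_le_one.mpr hx1.le
  have h1 := mul_pow_le_geom_sum t e
  have h2 := mul_pow_le_geom_sum t (e + 1)
  have h3 : ∑ i ∈ range (e + 1 + 1), x ^ i = x * ∑ i ∈ range (e + 1), x ^ i + 1 := by
    rw [sum_range_succ', mul_sum, pow_zero]
    congr 1
    exact sum_congr rfl fun i _ => pow_succ' x i
  rw [htx] at h1 h2
  set G := ∑ i ∈ range (e + 1), x ^ i with hG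
  have hG0 : 0 < G := sum_pos (fun i _ => pow_pos hx0 i) ⟨0, by simp⟩
  have hH0 : 0 < x * G + 1 := by positivity
  rw [h3] at h2 ⊢
  push_cast at h2 ⊢
  have h4 : ((e : ℝ) + 1) * (e + 1 + 1) * x ^ (e + 1) ≤ G * (x * G + 1) := by
    calc ((e : ℝ) + 1) * (e + 1 + 1) * x ^ (e + 1)
        ≤ ((e + 1) * t ^ e) * ((e + 1 + 1) * t ^ (e + 1)) := by
          have : x ^ (e + 1) ≤ t ^ e * t ^ (e + 1) := by
            rw [← htx, ← pow_mul, ← pow_add]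
            exact pow_le_pow_of_le_one ht0 ht1 (by omega)
          calc _ ≤ ((e : ℝ) + 1) * (e + 1 + 1) * (t ^ e * t ^ (e + 1)) := by gcongr
            _ = _ := by ring
      _ ≤ _ := mul_le_mul h1 h2 (by positivity) hG0.le
  have h5 : x ^ (e + 1) / G - x ^ (e + 1 + 1) / (x * G + 1) =
      x ^ (e + 1) / (G * (x * G + 1)) := by
    rw [div_sub_div _ _ hG0.ne' hH0.ne']
    congr 1
    ring
  have h6 : ((e : ℝ) + 1)⁻¹ - ((e : ℝ) + 1 + 1)⁻¹ = 1 / ((e + 1) * (e + 1 + 1)) := by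
    field_simp
    ring
  have h7 : x ^ (e + 1) / (G * (x * G + 1)) ≤ 1 / (((e : ℝ) + 1) * (e + 1 + 1)) := by
    rw [div_le_div_iff₀ (by positivity) (by positivity)]
    linarith
  linarith

theorem lambert_kernel_nonneg {x : ℝ} (hx0 : 0 < x) (hx1 : x < 1) {d : ℕ} (hd : 1 ≤ d) :
    0 ≤ (d : ℝ)⁻¹ - x ^ d / ∑ i ∈ range d, x ^ i := by
  have hG0 : 0 < ∑ i ∈ range d, x ^ i :=
    sum_pos (fun i _ => pow_pos hx0 i) ⟨0, mem_range.mpr hd⟩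
  have hd0 : (0 : ℝ) < d := by exact_mod_cast hd
  rw [sub_nonneg, inv_eq_one_div, div_le_div_iff₀ hG0 hd0]
  have := card_nsmul_le_sum (range d) (fun i => x ^ i) (x ^ d)
    (fun i hi => pow_le_pow_of_le_one hx0.le hx1.le (mem_range.mp hi).le)
  rw [card_range, nsmul_eq_mul] at this
  linarith

variable {q : ℕ} [NeZero q] {χ : MulChar (ZMod q) ℝ}

theorem sum_pow_mul_charDivisorSum (x : ℝ) (D : ℕ) :
    ∑ n ∈ Ioc 0 D, x ^ n * charDivisorSum χ n =
      ∑ y ∈ Ioc 0 D ×ˢ Ioc 0 D with y.1 * y.2 ≤ D, χ ((y.1 : ℕ) : ZMod q) * x ^ (y.1 * y.2) := by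
  have h := sum_Ioc_divisorsAntidiagonal D (fun _ => True)
    (fun a b => χ ((a : ℕ) : ZMod q) * x ^ (a * b))
  simp only [and_true, filter_true] at h
  rw [← h]
  apply sum_congr rfl
  intro n _
  rw [charDivisorSum_apply, mul_sum,
    ← Nat.sum_divisorsAntidiagonal (fun d _ => x ^ n * χ ((d : ℕ) : ZMod q))]
  apply sum_congr rfl
  intro y hy
  rw [(Nat.mem_divisorsAntidiagonal.mp hy).1, mul_comm]

theorem IsQuadraticChar.le_sum_pow_mul (h : IsQuadraticChar χ) {x : ℝ} (hx0 : 0 < x) (hx1 : x < 1)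
    {M D : ℕ} (hD : M ^ 2 ≤ D) :
    M * x ^ (M ^ 2) ≤ ∑ n ∈ Ioc 0 D, x ^ n * charDivisorSum χ n := by
  have hinj : Set.InjOn (fun m : ℕ => m ^ 2) (Ioc 0 M : Finset ℕ) :=
    fun a _ b _ hab => Nat.pow_left_injective (by norm_num : 2 ≠ 0) hab
  calc (M : ℝ) * x ^ (M ^ 2) = ∑ m ∈ Ioc 0 M, x ^ (M ^ 2) := by simp
    _ ≤ ∑ m ∈ Ioc 0 M, x ^ (m ^ 2) * charDivisorSum χ (m ^ 2) := by
      apply sum_le_sum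
      intro m hm
      rw [mem_Ioc] at hm
      have h1 := h.one_le_charDivisorSum_sq (show m ≠ 0 by omega)
      have h2 : x ^ (M ^ 2) ≤ x ^ (m ^ 2) :=
        pow_le_pow_of_le_one hx0.le hx1.le (Nat.pow_le_pow_left hm.2 2)
      have h3 : 0 < x ^ (m ^ 2) := by positivity
      nlinarith
    _ = ∑ n ∈ (Ioc 0 M).image (fun m : ℕ => m ^ 2), x ^ n * charDivisorSum χ n := by
      rw [sum_image hinj]
    _ ≤ _ := by
      refine sum_le_sum_of_subset_of_nonneg ?_ fun n _ _ =>
        mul_nonneg (by positivity) (h.charDivisorSum_nonneg n)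
      intro n hn
      obtain ⟨m, hm, rfl⟩ := mem_image.mp hn
      rw [mem_Ioc] at hm ⊢
      exact ⟨pow_pos hm.1 2, (Nat.pow_le_pow_left hm.2 2).trans hD⟩

theorem IsQuadraticChar.le_lambert_sum (h : IsQuadraticChar χ) {x : ℝ} (hx0 : 0 < x) (hx1 : x < 1)
    {M D : ℕ} (hD : M ^ 2 ≤ D) :
    M * x ^ (M ^ 2) - D ^ 2 * x ^ D - D * x ^ D / (1 - x) ≤
      ∑ d ∈ Ioc 0 D, χ ((d : ℕ) : ZMod q) * (x ^ d / (1 - x ^ d)) := by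
  have hx : 0 < 1 - x := by linarith
  have h1 := h.le_sum_pow_mul hx0 hx1 hD
  rw [sum_pow_mul_charDivisorSum] at h1
  have h2 : ∀ d ∈ Ioc 0 D, χ ((d : ℕ) : ZMod q) * ∑ m ∈ Ioc 0 D, x ^ (d * m) - x ^ D / (1 - x) ≤
      χ ((d : ℕ) : ZMod q) * (x ^ d / (1 - x ^ d)) := by
    intro d hd
    rw [mem_Ioc] at hd
    have hxd : x ^ d ≤ x := by
      simpa using pow_le_pow_of_le_one hx0.le hx1.le hd.1
    have hxd' : 0 < 1 - x ^ d := by linarith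
    have hgeom : ∀ D : ℕ, ∑ m ∈ Ioc 0 D, x ^ (d * m) =
        x ^ d / (1 - x ^ d) - x ^ (d * (D + 1)) / (1 - x ^ d) := by
      intro D
      induction D with
      | zero => simp
      | succ D ih =>
        rw [sum_Ioc_succ_top (Nat.zero_le D), ih]
        field_simp
        ring
    rw [hgeom, mul_sub]
    have h3 : x ^ (d * (D + 1)) / (1 - x ^ d) ≤ x ^ D / (1 - x) := by
      apply div_le_div₀ (by positivity) _ hx (by linarith)
      apply pow_le_pow_of_le_one hx0.le hx1.le
      nlinarith
    have h4 : 0 ≤ x ^ (d * (D + 1)) / (1 - x ^ d) := by positivity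
    have h5 := neg_le_of_abs_le (h.abs_le_one (d : ZMod q))
    nlinarith
  have h3 := sum_le_sum h2
  rw [sum_sub_distrib, sum_const, Nat.card_Ioc, nsmul_eq_mul, Nat.sub_zero] at h3
  have h4 : ∑ d ∈ Ioc 0 D, χ ((d : ℕ) : ZMod q) * ∑ m ∈ Ioc 0 D, x ^ (d * m) =
      ∑ y ∈ Ioc 0 D ×ˢ Ioc 0 D, χ ((y.1 : ℕ) : ZMod q) * x ^ (y.1 * y.2) := by
    rw [sum_product]
    exact sum_congr rfl fun d _ => mul_sum _ _ _
  rw [h4, ← sum_filter_add_sum_filter_not (Ioc 0 D ×ˢ Ioc 0 D) (fun y : ℕ × ℕ => y.1 * y.2 ≤ D)]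
    at h3
  have h5 : -(D ^ 2 * x ^ D) ≤ ∑ y ∈ Ioc 0 D ×ˢ Ioc 0 D with ¬ y.1 * y.2 ≤ D,
      χ ((y.1 : ℕ) : ZMod q) * x ^ (y.1 * y.2) := by
    have h6 : ∀ y ∈ (Ioc 0 D ×ˢ Ioc 0 D).filter (fun y : ℕ × ℕ => ¬ y.1 * y.2 ≤ D),
        -x ^ D ≤ χ ((y.1 : ℕ) : ZMod q) * x ^ (y.1 * y.2) := by
      intro y hy
      rw [mem_filter, not_le] at hy
      have h7 : x ^ (y.1 * y.2) ≤ x ^ D := pow_le_pow_of_le_one hx0.le hx1.le hy.2.le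
      have h8 : 0 < x ^ (y.1 * y.2) := by positivity
      have h9 := neg_le_of_abs_le (h.abs_le_one (y.1 : ZMod q))
      nlinarith
    have h7 := card_nsmul_le_sum _ _ _ h6
    rw [nsmul_eq_mul] at h7
    have h8 : ((#((Ioc 0 D ×ˢ Ioc 0 D).filter (fun y : ℕ × ℕ => ¬ y.1 * y.2 ≤ D)) : ℕ) : ℝ) ≤
        D ^ 2 := by
      have := card_filter_le (Ioc 0 D ×ˢ Ioc 0 D) (fun y : ℕ × ℕ => ¬ y.1 * y.2 ≤ D)
      rw [card_product, Nat.card_Ioc, Nat.sub_zero, ← sq] at this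
      exact_mod_cast this
    have h9 : 0 < x ^ D := by positivity
    nlinarith
  rw [← mul_div_assoc] at h3
  linarith

/-- The value at `1` of the `L`-series of a quadratic character is not too small. -/
theorem IsQuadraticChar.le_lseries (h : IsQuadraticChar χ) {l : ℝ}
    (hl : ∀ K : ℕ, |∑ d ∈ Ioc 0 K, χ ((d : ℕ) : ZMod q) / (d : ℕ) - l| ≤ 2 * q / (K + 1)) :
    1 / (32 * q) ≤ l := by
  have hq : (0 : ℝ) < q := by exact_mod_cast NeZero.pos q
  have hq1 : (1 : ℝ) ≤ q := by exact_mod_cast NeZero.pos q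
  set M : ℕ := 4 * q with hM
  have hMR : (M : ℝ) = 4 * q := by rw [hM]; push_cast; ring
  set x : ℝ := 1 - 1 / (2 * (M : ℝ) ^ 2) with hx
  have hinv : 0 < 1 / (2 * (M : ℝ) ^ 2) := by rw [hMR]; positivity
  have hinv1 : 1 / (2 * (M : ℝ) ^ 2) < 1 := by
    rw [hMR, div_lt_one (by positivity)]; nlinarith
  have hx0 : 0 < x := by rw [hx]; linarith
  have hx1 : x < 1 := by rw [hx]; linarith
  have hxM : 1 / 2 ≤ x ^ (M ^ 2) := by
    have h1 := one_add_mul_le_pow (a := -(1 / (2 * (M : ℝ) ^ 2))) (by linarith) (M ^ 2)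
    have h2 : (1 : ℝ) + ((M ^ 2 : ℕ) : ℝ) * -(1 / (2 * (M : ℝ) ^ 2)) = 1 / 2 := by
      rw [hMR]; push_cast; rw [hMR]; field_simp; norm_num
    rw [h2] at h1
    exact h1
  have key : ∀ D : ℕ, M ^ 2 ≤ D → (1 - x) * (M * x ^ (M ^ 2) - D ^ 2 * x ^ D -
      D * x ^ D / (1 - x) - q) - 2 * q / (D + 1) ≤ l := by
    intro D hD
    have h1 := h.le_lambert_sum hx0 hx1 hD
    have h2 := abs_sum_mul_antitone_le
      (φ := fun d => (d : ℝ)⁻¹ - x ^ d / ∑ i ∈ range d, x ^ i)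
      (e := fun m => χ ((m : ℕ) : ZMod q)) (B := q) (M := 0) (Y := D)
      (fun d hd => lambert_kernel_nonneg hx0 hx1 hd)
      (fun d hd => lambert_kernel_antitone hx0 hx1 hd) (Nat.zero_le D)
      (fun y _ _ => h.abs_sum_le y)
    have h3 : ∑ m ∈ Ioc 0 D, ((m : ℝ)⁻¹ - x ^ m / ∑ i ∈ range m, x ^ i) * χ ((m : ℕ) : ZMod q) =
        ∑ d ∈ Ioc 0 D, χ ((d : ℕ) : ZMod q) / (d : ℕ) -
        (1 - x) * ∑ d ∈ Ioc 0 D, χ ((d : ℕ) : ZMod q) * (x ^ d / (1 - x ^ d)) := by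
      rw [mul_sum, ← sum_sub_distrib]
      apply sum_congr rfl
      intro d hd
      have hxd : x ^ d ≤ x := by
        simpa using pow_le_pow_of_le_one hx0.le hx1.le (mem_Ioc.mp hd).1
      have hd0 : (0 : ℝ) < d := by exact_mod_cast (mem_Ioc.mp hd).1
      rw [geom_sum_eq hx1.ne, ← neg_div_neg_eq (x ^ d - 1), neg_sub, neg_sub]
      have e1 : 1 - x ≠ 0 := by linarith
      have e2 : 1 - x ^ d ≠ 0 := by linarith
      field_simp
    have h4 : ((0 + 1 : ℕ) : ℝ)⁻¹ - x ^ (0 + 1) / ∑ i ∈ range (0 + 1), x ^ i = 1 - x := by simp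
    rw [h4, h3] at h2
    have h5 := (abs_le.mp h2).1
    have h6 := (abs_le.mp (hl D)).2
    have h7 := mul_le_mul_of_nonneg_left h1 (by linarith : 0 ≤ 1 - x)
    linarith
  have hlim : Filter.Tendsto (fun D : ℕ => (1 - x) * (M * x ^ (M ^ 2) - (D : ℝ) ^ 2 * x ^ D -
      D * x ^ D / (1 - x) - q) - 2 * q / (D + 1)) Filter.atTop
      (nhds ((1 - x) * (M * x ^ (M ^ 2) - 0 - 0 / (1 - x) - q) - 0)) := by
    have hax : |x| < 1 := by rw [abs_of_pos hx0]; exact hx1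
    have t1 := tendsto_pow_const_mul_const_pow_of_abs_lt_one 2 hax
    have t2 := tendsto_pow_const_mul_const_pow_of_abs_lt_one 1 hax
    simp only [pow_one] at t2
    have t3 : Filter.Tendsto (fun N : ℕ => (2 * q : ℝ) / (N + 1)) Filter.atTop (nhds 0) := by
      have := tendsto_const_div_atTop_nhds_zero_nat (2 * q : ℝ)
      have h2 := (Filter.tendsto_add_atTop_iff_nat 1).mpr this
      refine h2.congr fun n => by push_cast; rfl
    exact ((((tendsto_const_nhds.sub t1).sub (t2.div_const _)).sub_const _).const_mul _).sub t3
  have hfin := le_of_tendsto hlim (Filter.eventually_atTop.mpr ⟨M ^ 2, fun D hD => key D hD⟩)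
  refine le_trans ?_ hfin
  rw [zero_div, sub_zero, sub_zero, sub_zero]
  have h1 : 1 - x = 1 / (2 * (4 * (q : ℝ)) ^ 2) := by rw [hx, hMR]; ring
  have h2 : (q : ℝ) ≤ M * x ^ (M ^ 2) - q := by rw [hMR]; nlinarith
  rw [h1]
  calc 1 / (32 * (q : ℝ)) = 1 / (2 * (4 * (q : ℝ)) ^ 2) * q := by field_simp; norm_num
    _ ≤ _ := by gcongr

end Linnik

namespace Linnik

open Finset ArithmeticFunction

theorem sum_Ioc_filter_dvd {F : ℕ} (hF : 0 < F) (K : ℕ) (f : ℕ → ℝ) :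
    ∑ m ∈ Ioc 0 K with F ∣ m, f m = ∑ m ∈ Ioc 0 (K / F), f (F * m) := by
  symm
  refine sum_nbij' (fun m => F * m) (fun m => m / F) ?_ ?_ ?_ ?_ ?_
  · intro m hm
    rw [mem_Ioc] at hm
    rw [mem_filter, mem_Ioc]
    refine ⟨⟨Nat.mul_pos hF hm.1, ?_⟩, dvd_mul_right _ _⟩
    rw [mul_comm]
    exact (Nat.le_div_iff_mul_le hF).mp hm.2
  · intro m hm
    rw [mem_filter, mem_Ioc] at hm
    rw [mem_Ioc]
    exact ⟨Nat.div_pos (Nat.le_of_dvd hm.1.1 hm.2) hF, Nat.div_le_div_right hm.1.2⟩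
  · intro m _
    exact Nat.mul_div_cancel_left m hF
  · intro m hm
    exact Nat.mul_div_cancel' (mem_filter.mp hm).2
  · intro m _
    rfl

theorem cast_gcd_prod {e : Finset ℕ} (he : ∀ p ∈ e, p.Prime) (m : ℕ) :
    ((Nat.gcd m (∏ p ∈ e, p) : ℕ) : ℝ) =
      ∑ f ∈ e.powerset, if ∏ p ∈ f, p ∣ m then ∏ p ∈ f, ((p : ℝ) - 1) else 0 := by
  have h1 : ((Nat.gcd m (∏ p ∈ e, p) : ℕ) : ℝ) =
      ∏ p ∈ e, (1 + if p ∣ m then (p : ℝ) - 1 else 0) := by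
    induction e using Finset.induction_on with
    | empty => simp
    | insert p e hp ih =>
      have hpp := he p (mem_insert_self p e)
      rw [prod_insert hp, prod_insert hp, Nat.Coprime.gcd_mul, Nat.cast_mul,
        ih fun r hr => he r (mem_insert_of_mem hr)]
      · congr 1
        split_ifs with h
        · rw [Nat.gcd_eq_right h]; ring
        · rw [Nat.gcd_comm, (Nat.Prime.coprime_iff_not_dvd hpp).mpr h]; simp
      · apply Nat.Coprime.prod_right
        intro r hr
        exact (Nat.coprime_primes hpp (he r (mem_insert_of_mem hr))).mpr (by
          rintro rfl; exact hp hr)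
  rw [h1, prod_one_add]
  apply sum_congr rfl
  intro f hf
  rw [prod_ite_zero]
  have := prod_dvd_iff (fun p hp => he p (mem_powerset.mp hf hp)) m
  simp only [this]

theorem sum_powerset_prod_sub_one {e : Finset ℕ} :
    ∑ f ∈ e.powerset, ∏ p ∈ f, ((p : ℝ) - 1) = ((∏ p ∈ e, p : ℕ) : ℝ) := by
  rw [← prod_one_add, Nat.cast_prod]
  exact prod_congr rfl fun p _ => by ring

theorem prod_sub_one_nonneg {f : Finset ℕ} (hf : ∀ p ∈ f, p.Prime) :
    0 ≤ ∏ p ∈ f, ((p : ℝ) - 1) :=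
  prod_nonneg fun p hp => sub_nonneg.mpr (by exact_mod_cast (hf p hp).one_lt.le)

variable {q : ℕ} [NeZero q] {χ : MulChar (ZMod q) ℝ}

theorem sum_char_mul_gcd {e : Finset ℕ} (he : ∀ p ∈ e, p.Prime) (K : ℕ) (w : ℕ → ℝ) :
    ∑ m ∈ Ioc 0 K, χ ((m : ℕ) : ZMod q) * w m * Nat.gcd m (∏ p ∈ e, p) =
      ∑ f ∈ e.powerset, (∏ p ∈ f, ((p : ℝ) - 1)) *
        ∑ m ∈ Ioc 0 (K / ∏ p ∈ f, p), χ ((∏ p ∈ f, p : ℕ) : ZMod q) * χ ((m : ℕ) : ZMod q) *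
          w ((∏ p ∈ f, p) * m) := by
  simp only [cast_gcd_prod he, mul_sum]
  rw [sum_comm]
  apply sum_congr rfl
  intro f hf
  have hF : 0 < ∏ p ∈ f, p := prod_pos fun p hp => (he p (mem_powerset.mp hf hp)).pos
  have := sum_Ioc_filter_dvd hF K
    (fun m => χ ((m : ℕ) : ZMod q) * w m * ∏ p ∈ f, ((p : ℝ) - 1))
  rw [sum_filter] at this
  calc _ = ∑ m ∈ Ioc 0 K, if ∏ p ∈ f, p ∣ m then
      χ ((m : ℕ) : ZMod q) * w m * ∏ p ∈ f, ((p : ℝ) - 1) else 0 :=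
        sum_congr rfl fun m _ => mul_ite_zero ..
    _ = _ := this
    _ = _ := by
      apply sum_congr rfl
      intro m _
      rw [Nat.cast_mul, map_mul]
      ring

theorem IsQuadraticChar.abs_sum_mul_gcd_le (h : IsQuadraticChar χ) {e : Finset ℕ}
    (he : ∀ p ∈ e, p.Prime) (K : ℕ) :
    |∑ m ∈ Ioc 0 K, χ ((m : ℕ) : ZMod q) * Nat.gcd m (∏ p ∈ e, p)| ≤
      q * (∏ p ∈ e, p : ℕ) := by
  have h1 := sum_char_mul_gcd (χ := χ) he K (fun _ => 1)
  simp only [mul_one] at h1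
  rw [h1, ← sum_powerset_prod_sub_one, mul_sum]
  refine (abs_sum_le_sum_abs _ _).trans (sum_le_sum fun f hf => ?_)
  have hf0 := prod_sub_one_nonneg fun p hp => he p (mem_powerset.mp hf hp)
  rw [abs_mul, abs_of_nonneg hf0, mul_comm (q : ℝ), ← mul_sum, abs_mul]
  apply mul_le_mul_of_nonneg_left _ hf0
  have h2 := h.abs_le_one ((∏ p ∈ f, p : ℕ) : ZMod q)
  have h3 := h.abs_sum_le (K / ∏ p ∈ f, p)
  nlinarith [abs_nonneg (χ ((∏ p ∈ f, p : ℕ) : ZMod q)),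
    abs_nonneg (∑ i ∈ Ioc 0 (K / ∏ p ∈ f, p), χ ((i : ℕ) : ZMod q))]

theorem IsQuadraticChar.abs_sum_div_mul_gcd_sub_le (h : IsQuadraticChar χ) {l : ℝ}
    (hl : ∀ K : ℕ, |∑ d ∈ Ioc 0 K, χ ((d : ℕ) : ZMod q) / (d : ℕ) - l| ≤ 2 * q / (K + 1))
    {e : Finset ℕ} (he : ∀ p ∈ e, p.Prime) (K : ℕ) :
    |∑ m ∈ Ioc 0 K, χ ((m : ℕ) : ZMod q) * (m : ℝ)⁻¹ * Nat.gcd m (∏ p ∈ e, p) -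
      l * ∏ p ∈ e, (1 + (p - 1) * χ ((p : ℕ) : ZMod q) / p)| ≤
      2 * q / (K + 1) * (∏ p ∈ e, p : ℕ) := by
  rw [sum_char_mul_gcd (χ := χ) he K (fun m => (m : ℝ)⁻¹), prod_one_add, mul_sum,
    ← sum_sub_distrib, ← sum_powerset_prod_sub_one, mul_sum]
  refine (abs_sum_le_sum_abs _ _).trans (sum_le_sum fun f hf => ?_)
  have hfp : ∀ p ∈ f, p.Prime := fun p hp => he p (mem_powerset.mp hf hp)
  have hf0 := prod_sub_one_nonneg hfp
  have hF : 0 < ∏ p ∈ f, p := prod_pos fun p hp => (hfp p hp).pos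
  set F := ∏ p ∈ f, p with hFdef
  have hFR : (0 : ℝ) < F := by exact_mod_cast hF
  have h1 : ∏ p ∈ f, (((p : ℝ) - 1) * χ ((p : ℕ) : ZMod q) / p) =
      (∏ p ∈ f, ((p : ℝ) - 1)) * (χ (F : ZMod q) / F) := by
    rw [hFdef, prod_div_distrib, prod_mul_distrib, Nat.cast_prod, Nat.cast_prod, map_prod,
      mul_div_assoc]
  have h2 : ∑ m ∈ Ioc 0 (K / F), χ (F : ZMod q) * χ ((m : ℕ) : ZMod q) * ((F * m : ℕ) : ℝ)⁻¹ =
      χ (F : ZMod q) / F * ∑ m ∈ Ioc 0 (K / F), χ ((m : ℕ) : ZMod q) / (m : ℕ) := by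
    rw [mul_sum]
    apply sum_congr rfl
    intro m _
    push_cast
    rw [mul_inv]
    ring
  rw [h1, h2]
  have h3 : (∏ p ∈ f, ((p : ℝ) - 1)) *
      (χ (F : ZMod q) / F * ∑ m ∈ Ioc 0 (K / F), χ ((m : ℕ) : ZMod q) / (m : ℕ)) -
      l * ((∏ p ∈ f, ((p : ℝ) - 1)) * (χ (F : ZMod q) / F)) =
      (∏ p ∈ f, ((p : ℝ) - 1)) * (χ (F : ZMod q) *
      ((∑ m ∈ Ioc 0 (K / F), χ ((m : ℕ) : ZMod q) / (m : ℕ) - l) / F)) := by ring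
  rw [h3, abs_mul, abs_of_nonneg hf0, mul_comm (2 * (q : ℝ) / (K + 1))]
  apply mul_le_mul_of_nonneg_left _ hf0
  rw [abs_mul, abs_div, abs_of_pos hFR]
  have h4 := h.abs_le_one (F : ZMod q)
  have h5 := hl (K / F)
  have h6 : (K : ℝ) + 1 ≤ (((K / F : ℕ) : ℝ) + 1) * F := by
    have := Nat.lt_div_mul_add hF (a := K)
    have h7 : K + 1 ≤ (K / F + 1) * F := by rw [add_mul]; omega
    exact_mod_cast h7
  calc _ ≤ 1 * (2 * (q : ℝ) / (((K / F : ℕ) : ℝ) + 1) / F) := by gcongr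
    _ = 2 * (q : ℝ) / ((((K / F : ℕ) : ℝ) + 1) * F) := by rw [one_mul, div_div]
    _ ≤ _ := by gcongr

/-- Multiples of `d` that are divisible by `E` and lie in a residue class. -/
theorem card_mul_progression_near {d E : ℕ} (hd : d.Coprime q) (hE : E.Coprime q) (hE0 : 0 < E)
    (a : ZMod q) (Y : ℕ) :
    |(#{m ∈ Ioc 0 Y | ((d * m : ℕ) : ZMod q) = a ∧ E ∣ d * m} : ℝ) -
      Y * Nat.gcd d E / (q * E)| ≤ 1 := by
  set g := Nat.gcd d E with hg
  have hg0 : 0 < g := Nat.gcd_pos_of_pos_right d hE0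
  obtain ⟨E', hE'⟩ : g ∣ E := Nat.gcd_dvd_right d E
  obtain ⟨d', hd'⟩ : g ∣ d := Nat.gcd_dvd_left d E
  have hE'0 : 0 < E' := Nat.pos_of_ne_zero (by rintro rfl; simp at hE'; omega)
  have hcop : E'.Coprime d' := by
    have := Nat.coprime_div_gcd_div_gcd (m := d) (n := E) hg0
    rw [← hg, Nat.div_eq_of_eq_mul_right hg0 hd', Nat.div_eq_of_eq_mul_right hg0 hE'] at this
    exact this.symm
  have hE'q : q.Coprime E' :=
    (Nat.Coprime.coprime_dvd_left (Dvd.intro_left g hE'.symm) hE).symm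
  have hdu : IsUnit (d : ZMod q) := (ZMod.isUnit_iff_coprime d q).mpr hd
  obtain ⟨u, hu⟩ := hdu
  obtain ⟨v, hv1, hv2⟩ := Nat.chineseRemainder hE'q ((↑u⁻¹ * a : ZMod q).val) 0
  have hset : ∀ m : ℕ, (((d * m : ℕ) : ZMod q) = a ∧ E ∣ d * m) ↔ m ≡ v [MOD q * E'] := by
    intro m
    rw [← Nat.modEq_and_modEq_iff_modEq_mul hE'q]
    apply and_congr
    · have h1 : (m ≡ v [MOD q]) ↔ ((m : ZMod q) = ↑u⁻¹ * a) := by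
        rw [← ZMod.natCast_eq_natCast_iff]
        have h2 := (ZMod.natCast_eq_natCast_iff _ _ _).mpr hv1
        rw [h2, ZMod.natCast_zmod_val]
      rw [h1, Nat.cast_mul, ← hu, Units.eq_inv_mul_iff_mul_eq]
    · have h1 : (m ≡ v [MOD E']) ↔ E' ∣ m := by
        rw [← Nat.modEq_zero_iff_dvd]
        exact ⟨fun h => h.trans hv2, fun h => h.trans hv2.symm⟩
      rw [h1, hE', hd', mul_assoc, Nat.mul_dvd_mul_iff_left hg0]
      exact ⟨hcop.dvd_of_dvd_mul_left, fun h => h.mul_left _⟩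
  have hr : 0 < q * E' := Nat.mul_pos (NeZero.pos q) hE'0
  have := card_modEq_near hr (Nat.zero_le Y) v
  simp only [hset]
  convert this using 3
  have hq : (0 : ℝ) < q := by exact_mod_cast NeZero.pos q
  have hgR : (0 : ℝ) < g := by exact_mod_cast hg0
  have hE'R : (0 : ℝ) < E' := by exact_mod_cast hE'0
  have hER : (E : ℝ) = g * E' := by exact_mod_cast hE'
  rw [hER]
  push_cast
  field_simp
  simp

end Linnik

namespace Linnik

open Finset ArithmeticFunction

/-- A symmetric form of the hyperbola method. -/
theorem sum_hyperbola_symm {c : ℕ → ℝ} {P : ℕ → Prop} [DecidablePred P]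
    (hP : ∀ d m, P (d * m) → c d = c m) (N : ℕ) :
    ∑ x ∈ Ioc 0 N ×ˢ Ioc 0 N with x.1 * x.2 ≤ N ∧ P (x.1 * x.2), c x.1 =
      ∑ d ∈ Ioc 0 (Nat.sqrt N), c d * (2 * #{m ∈ Ioc 0 (N / d) | P (d * m)} -
        #{m ∈ Ioc 0 (Nat.sqrt N) | P (d * m)}) := by
  set K := Nat.sqrt N with hK
  have hKK : K * K ≤ N := Nat.sqrt_le N
  have hKN : K ≤ N := Nat.sqrt_le_self N
  have hNK : N < (K + 1) * (K + 1) := Nat.lt_succ_sqrt N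
  have hKd : ∀ d, 0 < d → d ≤ K → K ≤ N / d := fun d hd hdK =>
    (Nat.le_div_iff_mul_le hd).mpr ((Nat.mul_le_mul_left K hdK).trans hKK)
  have hcard : ∀ d ∈ Ioc 0 K, (#{m ∈ Ioc 0 (N / d) | P (d * m)} : ℝ) =
      #{m ∈ Ioc 0 K | P (d * m)} + #{m ∈ Ioc K (N / d) | P (d * m)} := by
    intro d hd
    rw [mem_Ioc] at hd
    rw [← Ioc_union_Ioc_eq_Ioc (Nat.zero_le K) (hKd d hd.1 hd.2), filter_union,
      card_union_of_disjoint, Nat.cast_add]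
    exact disjoint_filter_filter (Ioc_disjoint_Ioc_of_le le_rfl)
  have hsplit := sum_filter_add_sum_filter_not
    ((Ioc 0 N ×ˢ Ioc 0 N).filter fun x : ℕ × ℕ => x.1 * x.2 ≤ N ∧ P (x.1 * x.2))
    (fun x => x.1 ≤ K) (fun x => c x.1)
  rw [← hsplit]
  have h1 : ∑ x ∈ ((Ioc 0 N ×ˢ Ioc 0 N).filter fun x : ℕ × ℕ =>
      x.1 * x.2 ≤ N ∧ P (x.1 * x.2)) with x.1 ≤ K, c x.1 =
      ∑ d ∈ Ioc 0 K, ∑ m ∈ Ioc 0 (N / d) with P (d * m), c d := by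
    refine sum_finset_product' _ _ _ (f := fun d _ : ℕ => c d) ?_
    rintro ⟨d, m⟩
    simp only [mem_filter, mem_product, mem_Ioc]
    constructor
    · rintro ⟨⟨⟨⟨hd, hdN⟩, hm, hmN⟩, hdm, hp⟩, hdK⟩
      refine ⟨⟨hd, hdK⟩, ⟨hm, (Nat.le_div_iff_mul_le hd).mpr ?_⟩, hp⟩
      rwa [mul_comm]
    · rintro ⟨⟨hd, hdK⟩, ⟨hm, hmN⟩, hp⟩
      have hdm : d * m ≤ N := by rw [mul_comm]; exact (Nat.le_div_iff_mul_le hd).mp hmN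
      exact ⟨⟨⟨⟨hd, hdK.trans hKN⟩, hm, hmN.trans (Nat.div_le_self N d)⟩, hdm, hp⟩, hdK⟩
  have h2 : ∑ x ∈ ((Ioc 0 N ×ˢ Ioc 0 N).filter fun x : ℕ × ℕ =>
      x.1 * x.2 ≤ N ∧ P (x.1 * x.2)) with ¬ x.1 ≤ K, c x.1 =
      ∑ d ∈ Ioc 0 K, ∑ m ∈ Ioc K (N / d) with P (d * m), c d := by
    refine (sum_congr rfl fun x hx => hP x.1 x.2 (mem_filter.mp (mem_filter.mp hx).1).2.2).trans ?_
    refine sum_finset_product_right' _ _ _ (f := fun _ m : ℕ => c m) ?_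
    rintro ⟨d, m⟩
    simp only [mem_filter, mem_product, mem_Ioc]
    constructor
    · rintro ⟨⟨⟨⟨hd, hdN⟩, hm, hmN⟩, hdm, hp⟩, hdK⟩
      have hmK : m ≤ K := by
        by_contra hmK
        have : (K + 1) * (K + 1) ≤ d * m := Nat.mul_le_mul (by omega) (by omega)
        omega
      refine ⟨⟨hm, hmK⟩, ⟨by omega, (Nat.le_div_iff_mul_le hm).mpr hdm⟩, ?_⟩
      rwa [mul_comm]
    · rintro ⟨⟨hm, hmK⟩, ⟨hd, hdN⟩, hp⟩
      have hdm : d * m ≤ N := (Nat.le_div_iff_mul_le hm).mp hdN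
      rw [mul_comm] at hp
      exact ⟨⟨⟨⟨by omega, hdN.trans (Nat.div_le_self N m)⟩, hm, hmK.trans hKN⟩, hdm, hp⟩, by omega⟩
  rw [h1, h2, ← sum_add_distrib]
  apply sum_congr rfl
  intro d hd
  have h3 := hcard d hd
  rw [sum_const, sum_const, nsmul_eq_mul, nsmul_eq_mul]
  rw [h3]
  ring

/-- The density of multiples of a prime for the divisor sum of a character. -/
noncomputable def charDensity {q : ℕ} (χ : MulChar (ZMod q) ℝ) (p : ℕ) : ℝ :=
  (1 + (p - 1) * χ ((p : ℕ) : ZMod q) / p) / p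

variable {q : ℕ} [NeZero q] {χ : MulChar (ZMod q) ℝ}

theorem IsQuadraticChar.eq_of_mul_eq_one (h : IsQuadraticChar χ) {x y : ZMod q}
    (hxy : χ (x * y) = 1) : χ x = χ y := by
  rw [map_mul] at hxy
  rcases h.cases x with h1 | h1 | h1 <;> rcases h.cases y with h2 | h2 | h2 <;>
    rw [h1, h2] at hxy <;> norm_num at hxy <;> rw [h1, h2]

/-- Distribution of the divisor sum of a quadratic character in residue classes. -/
theorem IsQuadraticChar.abs_sum_progression_sub_le (h : IsQuadraticChar χ) {l : ℝ}
    (hl : ∀ K : ℕ, |∑ d ∈ Ioc 0 K, χ ((d : ℕ) : ZMod q) / (d : ℕ) - l| ≤ 2 * q / (K + 1))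
    {a : ZMod q} (ha : χ a = 1) {e : Finset ℕ} (he : ∀ p ∈ e, p.Prime)
    (heq : (∏ p ∈ e, p).Coprime q) (N : ℕ) :
    |∑ n ∈ Ioc 0 N with ((n : ℕ) : ZMod q) = a ∧ ∏ p ∈ e, p ∣ n, charDivisorSum χ n -
      2 * N * l / q * ∏ p ∈ e, charDensity χ p| ≤ 14 * Nat.sqrt N := by
  set E := ∏ p ∈ e, p with hE
  set K := Nat.sqrt N with hK
  have hE0 : 0 < E := prod_pos fun p hp => (he p hp).pos
  have hER : (0 : ℝ) < E := by exact_mod_cast hE0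
  have hq : (0 : ℝ) < q := by exact_mod_cast NeZero.pos q
  have h1 : ∑ n ∈ Ioc 0 N with ((n : ℕ) : ZMod q) = a ∧ E ∣ n, charDivisorSum χ n =
      ∑ d ∈ Ioc 0 K, χ ((d : ℕ) : ZMod q) *
        (2 * #{m ∈ Ioc 0 (N / d) | ((d * m : ℕ) : ZMod q) = a ∧ E ∣ d * m} -
        #{m ∈ Ioc 0 K | ((d * m : ℕ) : ZMod q) = a ∧ E ∣ d * m}) := by
    rw [hK, ← sum_hyperbola_symm (c := fun d => χ ((d : ℕ) : ZMod q))
      (P := fun n => ((n : ℕ) : ZMod q) = a ∧ E ∣ n),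
      ← sum_Ioc_divisorsAntidiagonal N (fun n => ((n : ℕ) : ZMod q) = a ∧ E ∣ n)
        (fun d _ => χ ((d : ℕ) : ZMod q))]
    · apply sum_congr rfl
      intro n _
      rw [charDivisorSum_apply, ← Nat.sum_divisorsAntidiagonal (fun d _ => χ ((d : ℕ) : ZMod q))]
    · intro d m hdm
      apply h.eq_of_mul_eq_one
      rw [← Nat.cast_mul, hdm.1, ha]
  have h2 : |∑ d ∈ Ioc 0 K, χ ((d : ℕ) : ZMod q) *
        (2 * #{m ∈ Ioc 0 (N / d) | ((d * m : ℕ) : ZMod q) = a ∧ E ∣ d * m} -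
        #{m ∈ Ioc 0 K | ((d * m : ℕ) : ZMod q) = a ∧ E ∣ d * m}) -
      ∑ d ∈ Ioc 0 K, χ ((d : ℕ) : ZMod q) *
        (2 * (N / d * Nat.gcd d E / (q * E)) - K * Nat.gcd d E / (q * E))| ≤ 5 * K := by
    rw [← sum_sub_distrib]
    refine (abs_sum_le_sum_abs _ _).trans ?_
    have h3 : ∀ d ∈ Ioc 0 K, |χ ((d : ℕ) : ZMod q) *
        (2 * #{m ∈ Ioc 0 (N / d) | ((d * m : ℕ) : ZMod q) = a ∧ E ∣ d * m} -
        #{m ∈ Ioc 0 K | ((d * m : ℕ) : ZMod q) = a ∧ E ∣ d * m}) - χ ((d : ℕ) : ZMod q) *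
        (2 * (N / d * Nat.gcd d E / (q * E)) - K * Nat.gcd d E / (q * E))| ≤ 5 := by
      intro d hd
      by_cases hdu : IsUnit ((d : ℕ) : ZMod q)
      · have hdq := (ZMod.isUnit_iff_coprime d q).mp hdu
        have h4 := card_mul_progression_near hdq heq hE0 a (N / d)
        have h5 := card_mul_progression_near hdq heq hE0 a K
        have hg : ((Nat.gcd d E : ℕ) : ℝ) ≤ E := by
          exact_mod_cast Nat.gcd_le_right d hE0
        have hq1 : (1 : ℝ) ≤ q := by exact_mod_cast NeZero.pos q
        have hG0 : 0 ≤ (Nat.gcd d E : ℝ) / (q * E) := by positivity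
        have hG1 : (Nat.gcd d E : ℝ) / (q * E) ≤ 1 := by
          rw [div_le_one (by positivity)]; nlinarith
        have h6 : ((N / d : ℕ) : ℝ) ≤ N / d := Nat.cast_div_le
        have h7 : (N : ℝ) / d ≤ ((N / d : ℕ) : ℝ) + 1 := by
          have hd0 : (0 : ℝ) < d := by exact_mod_cast (mem_Ioc.mp hd).1
          rw [div_le_iff₀ hd0]
          have := Nat.lt_div_mul_add (mem_Ioc.mp hd).1 (a := N)
          have h8 : N ≤ (N / d + 1) * d := by rw [add_mul]; omega
          exact_mod_cast h8
        rw [mul_div_assoc] at h4 h5 ⊢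
        rw [mul_div_assoc]
        rw [abs_le] at h4 h5
        rw [← mul_sub, abs_mul]
        have h9 := h.abs_le_one (d : ZMod q)
        refine (mul_le_of_le_one_left (abs_nonneg _) h9).trans ?_
        rw [abs_le]
        constructor <;> nlinarith
      · rw [χ.map_nonunit hdu]
        norm_num
    have h4 := sum_le_card_nsmul _ _ _ h3
    rw [Nat.card_Ioc, nsmul_eq_mul, Nat.sub_zero] at h4
    linarith
  have h3 : ∑ d ∈ Ioc 0 K, χ ((d : ℕ) : ZMod q) *
        (2 * (N / d * Nat.gcd d E / (q * E)) - K * Nat.gcd d E / (q * E)) =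
      2 * N / (q * E) * ∑ m ∈ Ioc 0 K, χ ((m : ℕ) : ZMod q) * (m : ℝ)⁻¹ * Nat.gcd m E -
      K / (q * E) * ∑ m ∈ Ioc 0 K, χ ((m : ℕ) : ZMod q) * Nat.gcd m E := by
    rw [mul_sum, mul_sum, ← sum_sub_distrib]
    apply sum_congr rfl
    intro d _
    ring
  have h4 := h.abs_sum_div_mul_gcd_sub_le hl he K
  have h5 := h.abs_sum_mul_gcd_le he K
  rw [← hE] at h4 h5
  have h6 : 2 * N * l / q * ∏ p ∈ e, charDensity χ p =
      2 * N / (q * E) * (l * ∏ p ∈ e, (1 + (p - 1) * χ ((p : ℕ) : ZMod q) / p)) := by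
    have : ∏ p ∈ e, charDensity χ p =
        (∏ p ∈ e, (1 + (p - 1) * χ ((p : ℕ) : ZMod q) / p)) / E := by
      simp only [charDensity]
      rw [prod_div_distrib, hE, Nat.cast_prod]
    rw [this]
    field_simp
  have hNK : (N : ℝ) ≤ (K + 1) * (K + 1) := by
    exact_mod_cast (Nat.lt_succ_sqrt N).le
  have h7 : |2 * N / (q * E) * ∑ m ∈ Ioc 0 K, χ ((m : ℕ) : ZMod q) * (m : ℝ)⁻¹ * Nat.gcd m E -
      2 * N / (q * E) * (l * ∏ p ∈ e, (1 + (p - 1) * χ ((p : ℕ) : ZMod q) / p))| ≤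
      4 * (K + 1) := by
    rw [← mul_sub, abs_mul, abs_of_nonneg (by positivity)]
    calc _ ≤ 2 * (N : ℝ) / (q * E) * (2 * q / (K + 1) * E) := by gcongr
      _ = 4 * ((N : ℝ) / (K + 1)) := by field_simp; ring
      _ ≤ _ := by
        gcongr
        rw [div_le_iff₀ (by positivity)]
        exact hNK
  have h8 : |K / (q * E) * ∑ m ∈ Ioc 0 K, χ ((m : ℕ) : ZMod q) * Nat.gcd m E| ≤ (K : ℝ) := by
    rw [abs_mul, abs_of_nonneg (by positivity)]
    calc _ ≤ (K : ℝ) / (q * E) * (q * E) := by gcongr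
      _ = K := by field_simp
  rcases Nat.eq_zero_or_pos N with h0 | h0
  · subst h0; simp
  have hK1 : (1 : ℝ) ≤ K := by exact_mod_cast Nat.sqrt_pos.mpr h0
  rw [h1, h6]
  rw [h3] at h2
  rw [abs_le] at *
  constructor <;> linarith

end Linnik

namespace Linnik

open Finset ArithmeticFunction

theorem card_divisors_le_of_isRough {w : ℕ} (t : ℕ) {n : ℕ} (hn : 0 < n) (h : IsRough w n)
    (hlt : n < w ^ (t + 1)) : #n.divisors ≤ 2 ^ t := by
  induction t generalizing n with
  | zero =>
    rcases h.eq_one_or_le hn.ne' with rfl | h1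
    · simp
    · rw [zero_add, pow_one] at hlt; omega
  | succ t ih =>
    rcases eq_or_ne n 1 with rfl | hn1
    · simpa using Nat.one_le_two_pow
    have hp := Nat.minFac_prime hn1
    obtain ⟨m, hm⟩ := Nat.minFac_dvd n
    set p := n.minFac with hpdef
    have hwp : w ≤ p := h.le_prime hp (Dvd.intro m hm.symm)
    have hm0 : 0 < m := Nat.pos_of_ne_zero (by rintro rfl; omega)
    have hw0 : 0 < w := Nat.pos_of_ne_zero (by rintro rfl; simp at hlt)
    have hmlt : m < w ^ (t + 1) := by
      by_contra hle
      have : w * w ^ (t + 1) ≤ p * m := Nat.mul_le_mul hwp (not_lt.mp hle)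
      rw [← hm, ← pow_succ'] at this
      omega
    have h1 := ih hm0 (h.of_dvd (Dvd.intro_left p hm.symm)) hmlt
    have h2 : #(p * m).divisors ≤ #p.divisors * #m.divisors := by
      rw [Nat.divisors_mul]
      exact card_mul_le
    rw [hm, pow_succ']
    refine h2.trans ?_
    rw [hp.divisors, card_pair hp.one_lt.ne]
    exact Nat.mul_le_mul_left 2 h1

variable {q : ℕ} [NeZero q] {χ : MulChar (ZMod q) ℝ}

theorem IsQuadraticChar.charDivisorSum_le_of_not_prime (h : IsQuadraticChar χ) {w J n : ℕ}
    (hw : 2 ≤ w) (hqw : q < w) (hn : 0 < n) (hnx : n ≤ w ^ (2 * J)) (hr : IsRough w n)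
    (hnp : ¬ n.Prime) :
    charDivisorSum χ n ≤ (if n = 1 then 1 else 0) +
      ∑ p ∈ Ioc 0 (w ^ J) with p.Prime ∧ w ≤ p, (if p ^ 2 ∣ n then (2 : ℝ) ^ (2 * J) else 0) +
      ∑ p ∈ Ioc 0 (w ^ J) with p.Prime ∧ w ≤ p ∧ χ ((p : ℕ) : ZMod q) = 1,
        (if p ∣ n then 2 * charDivisorSum χ (n / p) else 0) := by
  have hA : 0 ≤ ∑ p ∈ Ioc 0 (w ^ J) with p.Prime ∧ w ≤ p,
      (if p ^ 2 ∣ n then (2 : ℝ) ^ (2 * J) else 0) :=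
    sum_nonneg fun p _ => by split_ifs <;> positivity
  have hB0 : ∀ p : ℕ, 0 ≤ (if p ∣ n then 2 * charDivisorSum χ (n / p) else 0) := fun p => by
    split_ifs
    · exact mul_nonneg (by norm_num) (h.charDivisorSum_nonneg _)
    · exact le_rfl
  have hB : 0 ≤ ∑ p ∈ Ioc 0 (w ^ J) with p.Prime ∧ w ≤ p ∧ χ ((p : ℕ) : ZMod q) = 1,
        (if p ∣ n then 2 * charDivisorSum χ (n / p) else 0) := sum_nonneg fun p _ => hB0 p
  rcases eq_or_ne n 1 with rfl | hn1
  · rw [if_pos rfl, isMultiplicative_charDivisorSum.map_one]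
    linarith
  rw [if_neg hn1, zero_add]
  have hp := Nat.minFac_prime hn1
  have hpd := Nat.minFac_dvd n
  have hp2 := Nat.minFac_sq_le_self hn hnp
  set p := n.minFac with hpdef
  have hwp : w ≤ p := hr.le_prime hp hpd
  have hpJ : p ≤ w ^ J := by
    rw [mul_comm, pow_mul] at hnx
    exact (Nat.pow_le_pow_iff_left two_ne_zero).mp (hp2.trans hnx)
  by_cases hpp : p ^ 2 ∣ n
  · have h1 : charDivisorSum χ n ≤ (2 : ℝ) ^ (2 * J) := by
      refine (h.charDivisorSum_le n).trans ?_
      exact_mod_cast card_divisors_le_of_isRough (2 * J) hn hr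
        (hnx.trans_lt (Nat.pow_lt_pow_right (by omega) (by omega)))
    have h2 := single_le_sum (f := fun p : ℕ => if p ^ 2 ∣ n then (2 : ℝ) ^ (2 * J) else 0)
      (s := (Ioc 0 (w ^ J)).filter fun p => p.Prime ∧ w ≤ p)
      (fun p _ => by split_ifs <;> positivity)
      (mem_filter.mpr ⟨mem_Ioc.mpr ⟨hp.pos, hpJ⟩, hp, hwp⟩)
    rw [if_pos hpp] at h2
    linarith
  · obtain ⟨m, hm⟩ := hpd
    have hpm : ¬ p ∣ m := by
      rintro ⟨c, rfl⟩
      exact hpp ⟨c, by rw [hm, sq, mul_assoc]⟩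
    have h1 : charDivisorSum χ n = (1 + χ ((p : ℕ) : ZMod q)) * charDivisorSum χ m := by
      rw [hm, charDivisorSum_prime_mul hp hpm]
    have hu : IsUnit ((p : ℕ) : ZMod q) := by
      rw [ZMod.isUnit_iff_coprime, Nat.Prime.coprime_iff_not_dvd hp]
      intro hpq
      have := Nat.le_of_dvd (NeZero.pos q) hpq
      omega
    obtain ⟨u, hu⟩ := hu
    rcases h.1 u with hχ | hχ
    · rw [hu] at hχ
      have h2 := single_le_sum
        (f := fun p : ℕ => if p ∣ n then 2 * charDivisorSum χ (n / p) else 0)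
        (s := (Ioc 0 (w ^ J)).filter fun p => p.Prime ∧ w ≤ p ∧ χ ((p : ℕ) : ZMod q) = 1)
        (fun p _ => hB0 p)
        (mem_filter.mpr ⟨mem_Ioc.mpr ⟨hp.pos, hpJ⟩, hp, hwp, hχ⟩)
      have h3 : n / p = m := Nat.div_eq_of_eq_mul_right hp.pos hm
      rw [if_pos (Dvd.intro m hm.symm), h3] at h2
      rw [h1, hχ]
      linarith
    · rw [hu] at hχ
      rw [h1, hχ]
      linarith

/-- The sum of the divisor sums of `χ` over rough integers in a residue class. -/
noncomputable def roughCharSum {q : ℕ} (χ : MulChar (ZMod q) ℝ) (w y : ℕ) (a : ZMod q) : ℝ :=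
  ∑ n ∈ Ioc 0 y with ((n : ℕ) : ZMod q) = a ∧ IsRough w n, charDivisorSum χ n

theorem sum_primes_inv_sq_le {w Y : ℕ} (hw : 2 ≤ w) (hwY : w ≤ Y) :
    ∑ p ∈ Ioc 0 Y with p.Prime ∧ w ≤ p, ((p : ℝ) ^ 2)⁻¹ ≤ 2 / w := by
  have h1 := sum_Ioc_inv_sq_le_sub (α := ℝ) (k := w - 1) (n := Y) (by omega) (by omega)
  have h2 : ∑ p ∈ Ioc 0 Y with p.Prime ∧ w ≤ p, ((p : ℝ) ^ 2)⁻¹ ≤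
      ∑ p ∈ Ioc (w - 1) Y, ((p : ℝ) ^ 2)⁻¹ := by
    refine sum_le_sum_of_subset_of_nonneg ?_ fun _ _ _ => by positivity
    intro p hp
    rw [mem_filter, mem_Ioc] at hp
    rw [mem_Ioc]
    omega
  refine h2.trans (h1.trans ?_)
  have hY : (0 : ℝ) ≤ (Y : ℝ)⁻¹ := by positivity
  have hw2 : (2 : ℝ) ≤ w := by exact_mod_cast hw
  rw [Nat.cast_sub (by omega), Nat.cast_one]
  have : ((w : ℝ) - 1)⁻¹ ≤ 2 / w := by
    rw [inv_eq_one_div, div_le_div_iff₀ (by linarith) (by linarith)]; linarith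
  linarith

/-- If a class has no small prime, its rough sum is controlled by rough sums over other classes. -/
theorem IsQuadraticChar.roughCharSum_le_of_no_prime (h : IsQuadraticChar χ) {w J : ℕ} (hw : 2 ≤ w)
    (hqw : q < w) (hJ : 1 ≤ J) {a : ZMod q}
    (hno : ∀ p : ℕ, p.Prime → ((p : ℕ) : ZMod q) = a → w ^ (2 * J) < p) :
    roughCharSum χ w (w ^ (2 * J)) a ≤ 1 + 2 ^ (2 * J) * (w : ℝ) ^ (2 * J) * (2 / w) +
      ∑ p ∈ Ioc 0 (w ^ J) with p.Prime ∧ w ≤ p ∧ χ ((p : ℕ) : ZMod q) = 1,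
        2 * roughCharSum χ w (w ^ (2 * J) / p) (((p : ℕ) : ZMod q)⁻¹ * a) := by
  set x := w ^ (2 * J) with hx
  have h1 : roughCharSum χ w x a ≤ ∑ n ∈ Ioc 0 x with ((n : ℕ) : ZMod q) = a ∧ IsRough w n,
      ((if n = 1 then 1 else 0) +
      ∑ p ∈ Ioc 0 (w ^ J) with p.Prime ∧ w ≤ p, (if p ^ 2 ∣ n then (2 : ℝ) ^ (2 * J) else 0) +
      ∑ p ∈ Ioc 0 (w ^ J) with p.Prime ∧ w ≤ p ∧ χ ((p : ℕ) : ZMod q) = 1,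
        (if p ∣ n then 2 * charDivisorSum χ (n / p) else 0)) := by
    apply sum_le_sum
    intro n hn
    rw [mem_filter, mem_Ioc] at hn
    refine h.charDivisorSum_le_of_not_prime hw hqw hn.1.1 hn.1.2 hn.2.2 fun hp => ?_
    exact absurd hn.1.2 (not_le.mpr (hno n hp hn.2.1))
  refine h1.trans ?_
  rw [sum_add_distrib, sum_add_distrib]
  refine add_le_add (add_le_add ?_ ?_) ?_
  · rw [sum_ite_eq']
    split_ifs <;> norm_num
  · rw [sum_comm]
    have h2 : ∀ p ∈ (Ioc 0 (w ^ J)).filter (fun p => p.Prime ∧ w ≤ p),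
        ∑ n ∈ Ioc 0 x with ((n : ℕ) : ZMod q) = a ∧ IsRough w n,
          (if p ^ 2 ∣ n then (2 : ℝ) ^ (2 * J) else 0) ≤
        2 ^ (2 * J) * (w : ℝ) ^ (2 * J) * ((p : ℝ) ^ 2)⁻¹ := by
      intro p hp
      have hp0 : 0 < p := (mem_Ioc.mp (mem_filter.mp hp).1).1
      calc _ ≤ ∑ n ∈ Ioc 0 x, (if p ^ 2 ∣ n then (2 : ℝ) ^ (2 * J) else 0) :=
            sum_le_sum_of_subset_of_nonneg (filter_subset _ _) fun _ _ _ => by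
              split_ifs <;> positivity
        _ = ((x / p ^ 2 : ℕ) : ℝ) * 2 ^ (2 * J) := by
            rw [← sum_filter, sum_Ioc_filter_dvd (pow_pos hp0 2) x (fun _ => (2 : ℝ) ^ (2 * J))]
            simp
        _ ≤ ((x : ℝ) / ((p ^ 2 : ℕ) : ℝ)) * 2 ^ (2 * J) := by
            gcongr
            exact Nat.cast_div_le
        _ = _ := by rw [hx]; push_cast; rw [div_eq_mul_inv]; ring
    refine (sum_le_sum h2).trans ?_
    rw [← mul_sum]
    have h3 := sum_primes_inv_sq_le hw (Nat.le_self_pow (by omega : J ≠ 0) w)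
    gcongr
  · rw [sum_comm]
    apply sum_le_sum
    intro p hp
    rw [mem_filter, mem_Ioc] at hp
    have hp0 : 0 < p := hp.1.1
    have hu : IsUnit ((p : ℕ) : ZMod q) := by
      by_contra hu
      have := χ.map_nonunit hu
      rw [hp.2.2.2] at this
      norm_num at this
    have h2 : ∑ n ∈ Ioc 0 x with ((n : ℕ) : ZMod q) = a ∧ IsRough w n,
        (if p ∣ n then 2 * charDivisorSum χ (n / p) else 0) =
        ∑ n ∈ Ioc 0 x with p ∣ n, (if ((n : ℕ) : ZMod q) = a ∧ IsRough w n then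
          2 * charDivisorSum χ (n / p) else 0) := by
      rw [← sum_filter, ← sum_filter, filter_filter, filter_filter]
      apply sum_congr _ fun _ _ => rfl
      ext n
      simp only [mem_filter]
      tauto
    rw [h2, sum_Ioc_filter_dvd hp0 x (fun n => if ((n : ℕ) : ZMod q) = a ∧ IsRough w n then
          2 * charDivisorSum χ (n / p) else 0), roughCharSum, mul_sum, ← sum_filter]
    refine le_trans (le_of_eq (sum_congr rfl fun m _ => by rw [Nat.mul_div_cancel_left m hp0])) ?_
    refine sum_le_sum_of_subset_of_nonneg ?_ fun m _ _ =>
      mul_nonneg (by norm_num) (h.charDivisorSum_nonneg m)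
    intro m hm
    rw [mem_filter] at hm ⊢
    refine ⟨hm.1, ?_, (isRough_mul.mp hm.2.2).2⟩
    rw [← hm.2.1, Nat.cast_mul, ← mul_assoc, ZMod.inv_mul_of_unit _ hu, one_mul]

end Linnik

namespace Linnik

open Finset ArithmeticFunction

variable {q : ℕ} [NeZero q] {χ : MulChar (ZMod q) ℝ}

theorem IsQuadraticChar.charDensity_bounds (h : IsQuadraticChar χ) {p : ℕ} (hp : 0 < p) :
    1 / (p : ℝ) ^ 2 ≤ charDensity χ p ∧ (1 - 1 / (p : ℝ)) ^ 2 ≤ 1 - charDensity χ p := by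
  have hp1 : (1 : ℝ) ≤ p := by exact_mod_cast hp
  have hp0 : (0 : ℝ) < p := by linarith
  have hc := abs_le.mp (h.abs_le_one ((p : ℕ) : ZMod q))
  have e : charDensity χ p =
      1 / (p : ℝ) * (1 + (1 - 1 / (p : ℝ)) * χ ((p : ℕ) : ZMod q)) := by
    rw [charDensity]; field_simp
  have ht : 1 / (p : ℝ) ≤ 1 := by rw [div_le_one hp0]; exact hp1
  have ht0 : 0 < 1 / (p : ℝ) := by positivity
  rw [e, show 1 / (p : ℝ) ^ 2 = (1 / (p : ℝ)) ^ 2 by rw [one_div_pow]]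
  generalize 1 / (p : ℝ) = t at ht ht0
  generalize χ ((p : ℕ) : ZMod q) = c at hc
  have h1 : 0 ≤ t * ((1 - t) * (1 + c)) :=
    mul_nonneg ht0.le (mul_nonneg (by linarith) (by linarith))
  have h2 : 0 ≤ t * ((1 - t) * (1 - c)) :=
    mul_nonneg ht0.le (mul_nonneg (by linarith) (by linarith))
  constructor <;> nlinarith

theorem IsQuadraticChar.mertensProd_sq_le (h : IsQuadraticChar χ) (w : ℕ) :
    mertensProd w ^ 2 ≤ ∏ p ∈ sievePrimes q w, (1 - charDensity χ p) := by
  have hP : ∀ p ∈ sievePrimes q w, p.Prime := fun p hp => (mem_sievePrimes.mp hp).1.2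
  have h1 : ∀ p : ℕ, p.Prime → 0 ≤ (1 - 1 / (p : ℝ)) ^ 2 ∧ (1 - 1 / (p : ℝ)) ^ 2 ≤ 1 := by
    intro p hp
    have hp1 : (1 : ℝ) ≤ p := by exact_mod_cast hp.one_le
    have ht : 1 / (p : ℝ) ≤ 1 := by rw [div_le_one (by linarith)]; exact hp1
    have ht0 : 0 ≤ 1 / (p : ℝ) := by positivity
    exact ⟨sq_nonneg _, by nlinarith⟩
  calc mertensProd w ^ 2 = ∏ p ∈ w.primesBelow, (1 - 1 / (p : ℝ)) ^ 2 := by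
        rw [mertensProd, ← prod_pow]; simp only [one_div]
    _ ≤ ∏ p ∈ sievePrimes q w, (1 - 1 / (p : ℝ)) ^ 2 := by
        rw [sievePrimes, prod_filter]
        refine prod_le_prod (fun p _ => sq_nonneg _) fun p hp => ?_
        split_ifs
        · exact (h1 p (Nat.prime_of_mem_primesBelow hp)).2
        · exact le_rfl
    _ ≤ _ := prod_le_prod (fun p _ => sq_nonneg _)
        fun p hp => (h.charDensity_bounds (hP p hp).pos).2

theorem IsQuadraticChar.abs_roughCharSum_sub_le (h : IsQuadraticChar χ) {l : ℝ}
    (hl : ∀ K : ℕ, |∑ d ∈ Ioc 0 K, χ ((d : ℕ) : ZMod q) / (d : ℕ) - l| ≤ 2 * q / (K + 1))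
    {a : ZMod q} (ha : χ a = 1) {w : ℕ} (hw : 2 ≤ w) (y : ℕ) :
    |roughCharSum χ w y a -
        2 * l / q * (∏ p ∈ sievePrimes q w, (1 - charDensity χ p)) * y| ≤
      1 / 4 * (2 * l / q * (∏ p ∈ sievePrimes q w, (1 - charDensity χ p)) * y) +
        (w : ℝ) ^ 1226 * (14 * Nat.sqrt y) := by
  have hu : IsUnit a := by
    by_contra hu
    have := χ.map_nonunit hu
    rw [ha] at this
    norm_num at this
  have hl0 : 0 ≤ l := le_trans (by positivity) (h.le_lseries hl)
  have hP : ∀ p ∈ sievePrimes q w, p.Prime ∧ p < w := fun p hp =>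
    ⟨(mem_sievePrimes.mp hp).1.2, (mem_sievePrimes.mp hp).1.1⟩
  have key := fundamental_lemma (s := 408) (z := w) (by norm_num) hw (P := sievePrimes q w)
    (g := charDensity χ) hP (fun p hp => h.charDensity_bounds (hP p hp).1.pos)
    ((Ioc 0 y).filter fun n : ℕ => ((n : ℕ) : ZMod q) = a) (charDivisorSum χ)
    (fun n _ => h.charDivisorSum_nonneg n) (X := 2 * y * l / q) (R := 14 * Nat.sqrt y)
    (by positivity) (by positivity) (by
      intro e he _
      have := h.abs_sum_progression_sub_le hl ha (e := e) (fun p hp => (hP p (he hp)).1)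
        (prod_coprime_of_sievePrimes he) y
      convert this using 3
      rw [filter_filter]
      refine sum_congr (filter_congr fun n _ => ?_) fun _ _ => rfl
      rw [prod_dvd_iff fun p hp => (hP p (he hp)).1])
  have e1 : ∑ n ∈ (Ioc 0 y).filter (fun n : ℕ => ((n : ℕ) : ZMod q) = a) with
      ∀ p ∈ sievePrimes q w, ¬ p ∣ n, charDivisorSum χ n = roughCharSum χ w y a := by
    rw [filter_filter, roughCharSum]
    refine sum_congr (filter_congr fun n _ => ?_) fun _ _ => rfl
    refine and_congr_right fun hn => (isRough_iff_of_isUnit (by rw [hn]; exact hu)).symm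
  rw [e1] at key
  set V := ∏ p ∈ sievePrimes q w, (1 - charDensity χ p) with hV
  have hV0 : 0 ≤ V := le_trans (sq_nonneg _) (h.mertensProd_sq_le w)
  have e2 : 2 * y * l / q * V = 2 * l / q * V * y := by ring
  rw [e2] at key
  have hM : 0 ≤ 2 * l / q * V * y := by positivity
  refine key.trans ?_
  have h3 : Real.exp (100 - ((408 : ℕ) : ℝ) / 4) ≤ 1 / 4 := by
    have h4 : (2 : ℝ) ≤ Real.exp 1 := by linarith [Real.add_one_le_exp (1 : ℝ)]
    have h5 : Real.exp (100 - ((408 : ℕ) : ℝ) / 4) = (Real.exp 1 ^ 2)⁻¹ := by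
      rw [← Real.exp_nat_mul, ← Real.exp_neg]; congr 1; norm_num
    rw [h5, one_div]
    apply inv_anti₀ (by norm_num)
    nlinarith
  have e4 : 3 * 408 + 2 = 1226 := rfl
  rw [e4]
  gcongr

end Linnik

namespace Linnik

open Finset ArithmeticFunction

theorem IsQuadraticChar.exists_inv_pow_le_density :
    ∃ C : ℕ, ∀ u : ℕ, C ≤ u → ∀ q : ℕ, q < u → ∀ _ : NeZero q, ∀ χ : MulChar (ZMod q) ℝ,
      IsQuadraticChar χ → ∀ l : ℝ,
      (∀ K : ℕ, |∑ d ∈ Ioc 0 K, χ ((d : ℕ) : ZMod q) / (d : ℕ) - l| ≤ 2 * q / (K + 1)) →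
      1 / (u : ℝ) ^ 5 ≤
        2 * l / q * ∏ p ∈ sievePrimes q (u ^ 1300), (1 - charDensity χ p) := by
  refine ⟨⌈16 * 1300 ^ 2 / Real.exp (-24) ^ 2⌉₊ + 2, fun u hu q hqu hN χ h l hl => ?_⟩
  have hC : 16 * 1300 ^ 2 / Real.exp (-24) ^ 2 ≤ u := Nat.ceil_le.mp (by omega)
  have hu2 : 2 ≤ u := by omega
  have hu1 : (2 : ℝ) ≤ u := by exact_mod_cast hu2
  have hq0 : (0 : ℝ) < q := by exact_mod_cast NeZero.pos q
  have hqu' : (q : ℝ) ≤ u := by exact_mod_cast hqu.le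
  set E := Real.exp (-24) with hE
  have hE0 : 0 < E := Real.exp_pos _
  rw [div_le_iff₀ (by positivity)] at hC
  have h1 : 1 / (16 * (u : ℝ) ^ 2) ≤ 2 * l / q := by
    have := h.le_lseries hl
    calc 1 / (16 * (u : ℝ) ^ 2) ≤ 1 / (16 * (q : ℝ) ^ 2) := by gcongr
      _ = 2 * (1 / (32 * (q : ℝ))) / q := by field_simp; norm_num
      _ ≤ _ := by gcongr
  have hw2 : 2 ≤ u ^ 1300 := hu2.trans (Nat.le_self_pow (by norm_num) u)
  have hlog : Real.log ((u ^ 1300 : ℕ) : ℝ) ≤ 1300 * u := by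
    rw [Nat.cast_pow, Real.log_pow]
    have := Real.log_le_sub_one_of_pos (x := (u : ℝ)) (by linarith)
    push_cast
    nlinarith
  have hlog0 : 0 < Real.log ((u ^ 1300 : ℕ) : ℝ) := Real.log_pos (Nat.one_lt_cast.mpr hw2)
  have h2 : E / (1300 * u) ≤ mertensProd (u ^ 1300) := by
    rw [div_le_iff₀ (by positivity)]
    exact (le_mertensProd_mul_log _ hw2).trans
      (mul_le_mul_of_nonneg_left hlog (mertensProd_pos _).le)
  have h3 : (E / (1300 * u)) ^ 2 ≤ ∏ p ∈ sievePrimes q (u ^ 1300), (1 - charDensity χ p) :=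
    (pow_le_pow_left₀ (by positivity) h2 2).trans (h.mertensProd_sq_le _)
  calc 1 / (u : ℝ) ^ 5 ≤ 1 / (16 * (u : ℝ) ^ 2) * (E / (1300 * u)) ^ 2 := by
        rw [div_pow, div_mul_div_comm, div_le_div_iff₀ (by positivity) (by positivity)]
        have : 0 ≤ (u : ℝ) ^ 4 := by positivity
        nlinarith [mul_le_mul_of_nonneg_left hC this]
    _ ≤ _ := mul_le_mul h1 h3 (by positivity) (le_trans (by positivity) h1)

theorem IsQuadraticChar.exists_abs_roughCharSum_sub_le :
    ∃ C : ℕ, ∀ u : ℕ, C ≤ u → ∀ q : ℕ, q < u → ∀ _ : NeZero q, ∀ χ : MulChar (ZMod q) ℝ,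
      IsQuadraticChar χ → ∃ M : ℝ, 1 / (u : ℝ) ^ 5 ≤ M ∧ ∀ w : ℕ, w = u ^ 1300 →
        ∀ a : ZMod q, χ a = 1 → ∀ y : ℕ, w ^ 2464 ≤ y →
          |roughCharSum χ w y a - M * y| ≤ 1 / 2 * (M * y) := by
  obtain ⟨C, hC⟩ := IsQuadraticChar.exists_inv_pow_le_density
  refine ⟨C + 56, fun u hu q hqu hN χ h => ?_⟩
  obtain ⟨l, hl⟩ := h.exists_lseries
  refine ⟨_, hC u (by omega) q hqu hN χ h l hl, fun w hw a ha y hy => ?_⟩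
  have hM := hC u (by omega) q hqu hN χ h l hl
  have huw : u ≤ w := hw ▸ Nat.le_self_pow (by norm_num) u
  rw [← hw] at hM ⊢
  have key := h.abs_roughCharSum_sub_le hl ha (w := w) (by omega) y
  set M := 2 * l / q * ∏ p ∈ sievePrimes q w, (1 - charDensity χ p) with hMdef
  clear_value M
  have hu0 : (0 : ℝ) < u := by exact_mod_cast (by omega : 0 < u)
  have hM0 : 0 < M := lt_of_lt_of_le (by positivity) hM
  have hw0 : (56 : ℝ) ≤ w := by exact_mod_cast (by omega : 56 ≤ w)
  have hMw : 1 ≤ M * (w : ℝ) ^ 5 := by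
    rw [div_le_iff₀ (by positivity)] at hM
    refine hM.trans ?_
    have : (u : ℝ) ≤ w := by exact_mod_cast huw
    gcongr
  set S := Nat.sqrt y with hS
  have hS1 : w ^ 1232 ≤ S := by
    rw [hS, Nat.le_sqrt', ← pow_mul]
    exact hy
  have hS2 : S ^ 2 ≤ y := Nat.sqrt_le' y
  have hS1' : (w : ℝ) ^ 1232 ≤ S := by exact_mod_cast hS1
  have hS2' : (S : ℝ) ^ 2 ≤ y := by exact_mod_cast hS2
  have h5 : 56 * (w : ℝ) ^ 1226 ≤ M * S := by
    calc 56 * (w : ℝ) ^ 1226 ≤ w * (w : ℝ) ^ 1226 := by gcongr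
      _ = 1 * (w : ℝ) ^ 1227 := by rw [one_mul, ← pow_succ']
      _ ≤ (M * (w : ℝ) ^ 5) * (w : ℝ) ^ 1227 := by gcongr
      _ = M * (w : ℝ) ^ 1232 := by rw [mul_assoc, ← pow_add]
      _ ≤ M * S := by gcongr
  have h6 : (w : ℝ) ^ 1226 * (14 * S) ≤ 1 / 4 * (M * y) := by
    have h7 : 56 * (w : ℝ) ^ 1226 * S ≤ M * S * S := by gcongr
    have h8 : M * (S : ℝ) ^ 2 ≤ M * y := by gcongr
    generalize (w : ℝ) ^ 1226 = W at h7 ⊢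
    linarith
  linarith

theorem IsQuadraticChar.exists_prime_le {J : ℕ} (hJ : 2464 ≤ J) :
    ∃ C : ℕ, ∀ u : ℕ, C ≤ u → ∀ q : ℕ, q < u → ∀ _ : NeZero q, ∀ χ : MulChar (ZMod q) ℝ,
      IsQuadraticChar χ → ∀ a : ZMod q, χ a = 1 → ∀ w : ℕ, w = u ^ 1300 →
      ∑ p ∈ Ioc 0 (w ^ J) with p.Prime ∧ w ≤ p ∧ χ ((p : ℕ) : ZMod q) = 1, 1 / (p : ℝ) ≤ 1 / 12 →
      ∃ p : ℕ, p.Prime ∧ ((p : ℕ) : ZMod q) = a ∧ p ≤ w ^ (2 * J) := by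
  obtain ⟨C, hC⟩ := IsQuadraticChar.exists_abs_roughCharSum_sub_le
  refine ⟨C + 4 * (1 + 2 * 2 ^ (2 * J)) + 2, fun u hu q hqu hN χ h a ha w hw hsum => ?_⟩
  by_contra! hno
  obtain ⟨M, hM, hy⟩ := hC u (by omega) q hqu hN χ h
  specialize hy w hw
  have huw : u ≤ w := hw ▸ Nat.le_self_pow (by norm_num) u
  have hu0 : (0 : ℝ) < u := by exact_mod_cast (by omega : 0 < u)
  have hw0 : (0 : ℝ) < w := by exact_mod_cast (by omega : 0 < w)
  have hM0 : 0 < M := lt_of_lt_of_le (by positivity) hM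
  have h1 := h.roughCharSum_le_of_no_prime (w := w) (J := J) (by omega) (by omega) (by omega) hno
  have hxx : w ^ (2 * J) = w ^ J * w ^ J := by rw [two_mul, pow_add]
  have hJw : w ^ 2464 ≤ w ^ J := Nat.pow_le_pow_right (by omega) hJ
  have hwJ : 0 < w ^ J := Nat.pow_pos (by omega)
  have hle : w ^ J ≤ w ^ (2 * J) := Nat.pow_le_pow_right (by omega) (by omega)
  set x := w ^ (2 * J) with hx
  have hx0 : (w : ℝ) ≤ x := by
    exact_mod_cast (Nat.le_self_pow (by omega : J ≠ 0) w).trans hle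
  have hxr : (w : ℝ) ^ (2 * J) = x := by rw [hx, Nat.cast_pow]
  rw [hxr] at h1
  have h2 := (abs_le.mp (hy a ha x (hJw.trans hle))).1
  have h3 : ∑ p ∈ Ioc 0 (w ^ J) with p.Prime ∧ w ≤ p ∧ χ ((p : ℕ) : ZMod q) = 1,
        2 * roughCharSum χ w (x / p) (((p : ℕ) : ZMod q)⁻¹ * a) ≤
      3 * M * x * (1 / 12) := by
    refine le_trans ?_ (mul_le_mul_of_nonneg_left hsum (by positivity))
    rw [mul_sum]
    apply sum_le_sum
    intro p hp
    rw [mem_filter, mem_Ioc] at hp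
    have hp0 : 0 < p := hp.1.1
    have hχ : χ (((p : ℕ) : ZMod q)⁻¹ * a) = 1 := by
      have hu : IsUnit ((p : ℕ) : ZMod q) := by
        by_contra hu
        have := χ.map_nonunit hu
        rw [hp.2.2.2] at this
        norm_num at this
      have h4 := congrArg χ (ZMod.inv_mul_of_unit _ hu)
      rw [map_mul, hp.2.2.2, map_one, mul_one] at h4
      rw [map_mul, h4, ha, one_mul]
    have hyp : w ^ 2464 ≤ x / p := by
      rw [Nat.le_div_iff_mul_le hp0, hxx]
      exact Nat.mul_le_mul hJw hp.1.2
    have h4 := (abs_le.mp (hy _ hχ _ hyp)).2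
    have h5 : ((x / p : ℕ) : ℝ) ≤ x / p := Nat.cast_div_le
    have h6 : M * ((x / p : ℕ) : ℝ) ≤ M * (x / p) := mul_le_mul_of_nonneg_left h5 hM0.le
    calc 2 * roughCharSum χ w (x / p) (((p : ℕ) : ZMod q)⁻¹ * a) ≤ 3 * (M * (x / p)) := by linarith
      _ = 3 * M * x * (1 / p) := by ring
  have h7 : 1 / 4 * (M * x) ≤ 1 + 2 ^ (2 * J) * x * (2 / w) := by linarith
  have hx1 : (0 : ℝ) < x := hw0.trans_le hx0
  have h8 : 1 / 4 * (1 / (u : ℝ) ^ 5) * x ≤ (1 + 2 * 2 ^ (2 * J)) / w * x := by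
    calc 1 / 4 * (1 / (u : ℝ) ^ 5) * x ≤ 1 / 4 * M * x := by gcongr
      _ = 1 / 4 * (M * x) := by ring
      _ ≤ 1 + 2 ^ (2 * J) * x * (2 / w) := h7
      _ ≤ x / w + 2 ^ (2 * J) * x * (2 / w) := by
        gcongr
        rwa [one_le_div hw0]
      _ = _ := by ring
  have h9 := le_of_mul_le_mul_right h8 hx1
  rw [one_div_mul_one_div, div_le_div_iff₀ (by positivity) hw0, one_mul] at h9
  have h10 : (u : ℝ) ^ 6 ≤ w := by
    rw [hw, Nat.cast_pow]
    exact pow_le_pow_right₀ (by exact_mod_cast (by omega : 1 ≤ u)) (by norm_num)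
  have h11 : 4 * (1 + 2 * 2 ^ (2 * J)) + 2 ≤ (u : ℝ) := by
    exact_mod_cast (by omega : 4 * (1 + 2 * 2 ^ (2 * J)) + 2 ≤ u)
  have h12 : 0 < (u : ℝ) ^ 5 := by positivity
  have h13 : (u : ℝ) ^ 6 = u ^ 5 * u := pow_succ _ _
  have h14 := mul_le_mul_of_nonneg_left h11 h12.le
  linarith

end Linnik

namespace Linnik

open Finset ArithmeticFunction

theorem exists_prime_le_pow :
    ∃ k Z : ℕ, 1 ≤ k ∧ ∀ z₁ : ℕ, Z ≤ z₁ → ∀ q : ℕ, q < z₁ → ∀ _ : NeZero q, ∀ a : (ZMod q)ˣ,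
      ∃ p : ℕ, p.Prime ∧ ((p : ℕ) : ZMod q) = a ∧ p ≤ (z₁ ^ 1300) ^ k := by
  obtain ⟨J, hJ⟩ : ∃ J, J = 2464 := ⟨_, rfl⟩
  obtain ⟨C, hC⟩ := IsQuadraticChar.exists_prime_le hJ.ge
  obtain ⟨k, -, hk1, ⟨m, hm⟩, Z, hZ⟩ := exists_prime_or_exceptional (192 * (4 * J)) (4 * J) 0
    (by omega) (by omega)
  have hm0 : m ≠ 0 := by rintro rfl; omega
  refine ⟨k, Z + C + 2, hk1, fun z₁ hz q hq hN a => ?_⟩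
  rcases hZ z₁ (by omega) q hq _ rfl hN a with hp | ⟨χ, h1, h2, h3, h4⟩
  · exact hp
  obtain ⟨w, hw⟩ : ∃ w, w = (z₁ ^ m) ^ 1300 := ⟨_, rfl⟩
  obtain ⟨z, hz'⟩ : ∃ z, z = z₁ ^ 1300 := ⟨_, rfl⟩
  have hwz : w = z ^ m := by rw [hw, hz', ← pow_mul, ← pow_mul, mul_comm]
  rw [← hz'] at h4 ⊢
  have hu : z₁ ≤ z₁ ^ m := Nat.le_self_pow hm0 z₁
  have hzz : z₁ ≤ z := hz' ▸ Nat.le_self_pow (by norm_num) z₁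
  have hzw : z ≤ w := hwz ▸ Nat.le_self_pow hm0 z
  have hY : (w ^ J) ^ 4 = z ^ k := by rw [hwz, hm, ← pow_mul, ← pow_mul]; congr 1; ring
  have hw1 : 1 < w := by omega
  have hlog : 0 < Real.log w := Real.log_pos (by exact_mod_cast hw1)
  have hsum := h4 (w ^ J) hY.le
  have hkl : k * Real.log z = 4 * J * Real.log w := by
    rw [hwz, hm, Nat.cast_pow, Real.log_pow]; push_cast; ring
  have hS : ∑ p ∈ Ioc 0 (w ^ J) with p.Prime ∧ w ≤ p ∧ χ ((p : ℕ) : ZMod q) = 1, 1 / (p : ℝ) ≤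
      1 / 12 := by
    refine le_of_mul_le_mul_right ?_ hlog
    calc _ = ∑ p ∈ Ioc 0 (w ^ J) with p.Prime ∧ w ≤ p ∧ χ ((p : ℕ) : ZMod q) = 1,
          Real.log w / (p : ℝ) := by
          rw [sum_mul]; exact sum_congr rfl fun p _ => by ring
      _ ≤ ∑ p ∈ Ioc 0 (w ^ J) with p.Prime ∧ w ≤ p ∧ χ ((p : ℕ) : ZMod q) = 1,
          Real.log p / (p : ℝ) := by
          apply sum_le_sum
          intro p hp
          have hp := (mem_filter.mp hp).2.2.1
          gcongr
      _ ≤ ∑ p ∈ Ioc 0 (w ^ J) with p.Prime ∧ z ≤ p ∧ χ ((p : ℕ) : ZMod q) = 1,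
          Real.log p / (p : ℝ) := by
          refine sum_le_sum_of_subset_of_nonneg ?_ fun p _ _ =>
            div_nonneg (Real.log_natCast_nonneg p) (Nat.cast_nonneg p)
          intro p hp
          rw [mem_filter] at hp ⊢
          exact ⟨hp.1, hp.2.1, hzw.trans hp.2.2.1, hp.2.2.2⟩
      _ ≤ _ := hsum
      _ = 1 / 12 * Real.log w := by
          rw [hkl]
          have : (J : ℝ) ≠ 0 := by rw [hJ]; norm_num
          push_cast
          field_simp
          norm_num
  obtain ⟨p, hp, hpa, hle⟩ := hC (z₁ ^ m) (by omega) q (by omega) hN χ ⟨h1, h2⟩ a h3 w hw hS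
  refine ⟨p, hp, hpa, hle.trans ?_⟩
  rw [← hY, ← pow_mul]
  exact Nat.pow_le_pow_right (by omega) (by omega)

end Linnik

theorem linnik_theorem :
    ∃ L : ℝ, 0 < L ∧ ∀ q : ℕ, 2 ≤ q → ∀ a : ℤ, Int.gcd a (q : ℤ) = 1 →
      ∃ p : ℕ, p.Prime ∧ ((p : ℤ) : ZMod q) = (a : ZMod q) ∧ (p : ℝ) ≤ (q : ℝ) ^ L := by
  obtain ⟨k, Z, hk, H⟩ := Linnik.exists_prime_le_pow
  refine ⟨(((Z + 2) * 1300 * k : ℕ) : ℝ), by exact_mod_cast (by positivity), fun q hq a ha => ?_⟩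
  have hu : IsUnit (a : ZMod q) := by
    rw [ZMod.coe_int_isUnit_iff_isCoprime, isCoprime_comm, Int.isCoprime_iff_gcd_eq_one]
    exact ha
  obtain ⟨u, hu⟩ := hu
  have h1 : Z ≤ q ^ (Z + 2) := by
    have h2 : Z + 2 < 2 ^ (Z + 2) := Nat.lt_two_pow_self
    have h3 : 2 ^ (Z + 2) ≤ q ^ (Z + 2) := Nat.pow_le_pow_left hq _
    omega
  have h2 : q < q ^ (Z + 2) := by
    have := Nat.pow_lt_pow_right (a := q) (by omega) (by omega : 1 < Z + 2)
    rwa [pow_one] at this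
  obtain ⟨p, hp, hpa, hle⟩ := H _ h1 q h2 ⟨by omega⟩ u
  refine ⟨p, hp, ?_, ?_⟩
  · rw [← hu, ← hpa]; simp
  · rw [Real.rpow_natCast]
    rw [← pow_mul, ← pow_mul, ← mul_assoc] at hle
    exact_mod_cast hle
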